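/- arXiv:2203.09826 — 2 statements merged into one kernel-verified Lean document; each statement's English description precedes it below -/
import Mathlib

section
/- For every integer n ≥ 0, M_ω(1,5,5n+2) − M_ω(4,5,5n+2) = 2·NT(3,5,5n+2) − 2·NT(2,5,5n+2). -/
/-!
Common definitions: for a partition `π` of `n`,
`numParts` is the number of parts, `largestPart` the largest part,
`omegaOnes` the number of parts equal to 1, `rank` and `crank` the
Dyson rank and Andrews–Garvan crank.  `NT m j n` is the total number of
parts over partitions of `n` with rank ≡ m (mod j), and `Mw m j n` is
the total number of ones over partitions of `n` with crank ≡ m (mod j).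
`poch a q = (a; q)_∞ = ∏_{n ≥ 0} (1 - a qⁿ)`.
-/

namespace Beck

/-- number of parts of a partition -/
def numParts {n : ℕ} (π : n.Partition) : ℕ := Multiset.card π.parts

/-- largest part of a partition (0 for the empty partition) -/
def largestPart {n : ℕ} (π : n.Partition) : ℕ := π.parts.sup

/-- number of ones in a partition -/
def omegaOnes {n : ℕ} (π : n.Partition) : ℕ := π.parts.count 1

/-- number of parts strictly larger than the number of ones -/
def muParts {n : ℕ} (π : n.Partition) : ℕ :=
  Multiset.card (π.parts.filter fun x => omegaOnes π < x)

/-- Dyson's rank: largest part minus number of parts -/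
def rank {n : ℕ} (π : n.Partition) : ℤ :=
  (largestPart π : ℤ) - (numParts π : ℤ)

/-- the Andrews–Garvan crank -/
def crank {n : ℕ} (π : n.Partition) : ℤ :=
  if omegaOnes π = 0 then (largestPart π : ℤ)
  else (muParts π : ℤ) - (omegaOnes π : ℤ)

/-- `NT m j n`: total number of parts in partitions of `n` with rank ≡ m (mod j) -/
def NT (m j n : ℕ) : ℤ :=
  ∑ π : n.Partition,
    if rank π % (j : ℤ) = (m : ℤ) % (j : ℤ) then (numParts π : ℤ) else 0

/-- `Mw m j n`: total number of ones in partitions of `n` with crank ≡ m (mod j) -/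
def Mw (m j n : ℕ) : ℤ :=
  ∑ π : n.Partition,
    if crank π % (j : ℤ) = (m : ℤ) % (j : ℤ) then (omegaOnes π : ℤ) else 0

/-- `(a; q)_∞ = ∏_{n ≥ 0} (1 - a qⁿ)` -/
noncomputable def poch (a q : ℂ) : ℂ := ∏' n : ℕ, (1 - a * q ^ n)

theorem young_card_eq_sum (μ : YoungDiagram) : μ.card = μ.rowLens.sum := by
  unfold YoungDiagram.rowLens
  have h : μ.cells = (Finset.range (μ.colLen 0)).biUnion fun i => μ.row i := by
    ext ⟨i, j⟩
    simp only [Finset.mem_biUnion, Finset.mem_range, YoungDiagram.mem_row_iff,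
      YoungDiagram.mem_cells]
    constructor
    · intro h
      exact ⟨i, YoungDiagram.mem_iff_lt_colLen.1 (μ.up_left_mem le_rfl (Nat.zero_le j) h), h, rfl⟩
    · rintro ⟨_, _, h, _⟩
      exact h
  rw [YoungDiagram.card, h, Finset.card_biUnion]
  · simp only [← YoungDiagram.rowLen_eq_card]
    rfl
  · intro a _ b _ hab
    rw [Function.onFun, Finset.disjoint_left]
    rintro c hc hc'
    exact hab ((YoungDiagram.mem_row_iff.1 hc).2.symm.trans (YoungDiagram.mem_row_iff.1 hc').2)

/-- The Young diagram of a partition. -/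
noncomputable def youngOf {n : ℕ} (π : n.Partition) : YoungDiagram :=
  YoungDiagram.equivListRowLens.symm ⟨π.parts.sort (· ≥ ·),
    (π.parts.pairwise_sort (· ≥ ·)).sortedGE, fun _ hx => π.parts_pos ((Multiset.mem_sort _).1 hx)⟩

theorem rowLens_youngOf {n : ℕ} (π : n.Partition) :
    (youngOf π).rowLens = π.parts.sort (· ≥ ·) := by
  have := YoungDiagram.equivListRowLens.apply_symm_apply ⟨π.parts.sort (· ≥ ·),
    (π.parts.pairwise_sort (· ≥ ·)).sortedGE, fun _ hx => π.parts_pos ((Multiset.mem_sort _).1 hx)⟩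
  exact congrArg Subtype.val this

theorem card_youngOf {n : ℕ} (π : n.Partition) : (youngOf π).card = n := by
  rw [young_card_eq_sum, rowLens_youngOf, ← Multiset.sum_coe, Multiset.sort_eq, π.parts_sum]

/-- The partition whose parts are the row lengths of a Young diagram. -/
def ofYoung {n : ℕ} (μ : YoungDiagram) (h : μ.card = n) : n.Partition where
  parts := μ.rowLens
  parts_pos := fun hx => μ.pos_of_mem_rowLens _ hx
  parts_sum := by rw [Multiset.sum_coe, ← young_card_eq_sum, h]

theorem ofYoung_youngOf {n : ℕ} (π : n.Partition) (h : (youngOf π).card = n) :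
    ofYoung (youngOf π) h = π := by
  apply Nat.Partition.ext
  simp [ofYoung, rowLens_youngOf]

theorem youngOf_ofYoung {n : ℕ} (μ : YoungDiagram) (h : μ.card = n) :
    youngOf (ofYoung μ h) = μ := by
  apply YoungDiagram.equivListRowLens.injective
  apply Subtype.ext
  change (youngOf (ofYoung μ h)).rowLens = μ.rowLens
  rw [rowLens_youngOf]
  simp only [ofYoung, Multiset.coe_sort]
  exact List.mergeSort_of_pairwise (by simpa using μ.rowLens_sorted.pairwise)

theorem card_transpose (μ : YoungDiagram) : μ.transpose.card = μ.card := by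
  unfold YoungDiagram.card YoungDiagram.transpose
  simp

theorem numParts_ofYoung {n : ℕ} (μ : YoungDiagram) (h : μ.card = n) :
    numParts (ofYoung μ h) = μ.colLen 0 := by
  simp [numParts, ofYoung]

theorem largestPart_ofYoung {n : ℕ} (μ : YoungDiagram) (h : μ.card = n) :
    largestPart (ofYoung μ h) = μ.rowLen 0 := by
  unfold largestPart ofYoung
  apply le_antisymm
  · rw [Multiset.sup_le]
    intro b hb
    simp only [YoungDiagram.rowLens, Multiset.mem_coe, List.mem_map] at hb
    obtain ⟨i, _, rfl⟩ := hb
    exact μ.rowLen_anti 0 i (Nat.zero_le _)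
  · rcases Nat.eq_zero_or_pos (μ.rowLen 0) with h0 | h0
    · simp [h0]
    · apply Multiset.le_sup
      simp only [YoungDiagram.rowLens, Multiset.mem_coe, List.mem_map, List.mem_range]
      exact ⟨0, YoungDiagram.mem_iff_lt_colLen.1 (YoungDiagram.mem_iff_lt_rowLen.2 h0), rfl⟩

/-- Conjugation of partitions. -/
noncomputable def conj {n : ℕ} (π : n.Partition) : n.Partition :=
  ofYoung (youngOf π).transpose ((card_transpose _).trans (card_youngOf π))

theorem conj_conj {n : ℕ} (π : n.Partition) : conj (conj π) = π := by
  have : ∀ (μ ν : YoungDiagram) (h : μ.card = n) (h' : ν.card = n), μ = ν →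
      ofYoung μ h = ofYoung ν h' := by
    rintro μ _ h h' rfl
    rfl
  rw [← ofYoung_youngOf π (card_youngOf π)]
  unfold conj
  apply this
  rw [youngOf_ofYoung, youngOf_ofYoung, YoungDiagram.transpose_transpose]

theorem numParts_conj {n : ℕ} (π : n.Partition) : numParts (conj π) = largestPart π := by
  rw [conj, numParts_ofYoung]
  conv_rhs => rw [← ofYoung_youngOf π (card_youngOf π)]
  rw [largestPart_ofYoung, YoungDiagram.colLen_transpose]

theorem largestPart_conj {n : ℕ} (π : n.Partition) : largestPart (conj π) = numParts π := by
  rw [← numParts_conj, conj_conj]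

theorem rank_conj {n : ℕ} (π : n.Partition) : rank (conj π) = -rank π := by
  rw [rank, rank, numParts_conj, largestPart_conj, neg_sub]

/-- Conjugation as an equivalence. -/
noncomputable def conjEquiv (n : ℕ) : n.Partition ≃ n.Partition :=
  ⟨conj, conj, conj_conj, conj_conj⟩

theorem sum_filter_pred (s : Multiset ℕ) (h : ∀ x ∈ s, 0 < x) :
    ((s.map Nat.pred).filter (0 < ·)).sum + Multiset.card s = s.sum := by
  induction s using Multiset.induction_on with
  | empty => simp
  | cons a s ih =>
    have ha := h a (Multiset.mem_cons_self _ _)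
    have := ih fun x hx => h x (Multiset.mem_cons_of_mem hx)
    rw [Multiset.map_cons, Multiset.filter_cons, Multiset.sum_add, Multiset.card_cons,
      Multiset.sum_cons, ← this]
    have h2 : (if 0 < Nat.pred a then ({Nat.pred a} : Multiset ℕ) else 0).sum = a - 1 := by
      split_ifs with h
      · simp
      · have : a - 1 = 0 := by rw [← Nat.pred_eq_sub_one]; omega
        simp [this]
    omega

theorem map_succ_filter_pred (s : Multiset ℕ) (h : ∀ x ∈ s, 0 < x) :
    ((s.map Nat.pred).filter (0 < ·)).map Nat.succ +
      Multiset.replicate (Multiset.card s - Multiset.card ((s.map Nat.pred).filter (0 < ·))) 1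
        = s := by
  induction s using Multiset.induction_on with
  | empty => simp
  | cons a s ih =>
    have ha := h a (Multiset.mem_cons_self _ _)
    have ih := ih fun x hx => h x (Multiset.mem_cons_of_mem hx)
    have hc : Multiset.card ((s.map Nat.pred).filter (0 < ·)) ≤ Multiset.card s := by
      refine (Multiset.card_le_card (Multiset.filter_le _ _)).trans ?_
      simp
    rw [Multiset.map_cons]
    by_cases h1 : 0 < Nat.pred a
    · rw [Multiset.filter_cons_of_pos _ h1, Multiset.map_cons, Multiset.card_cons,
        Multiset.card_cons, Nat.add_sub_add_right, Multiset.cons_add, ih]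
      congr 1
      exact Nat.succ_pred_eq_of_pos ha
    · rw [Multiset.filter_cons_of_neg _ h1, Multiset.card_cons, Nat.sub_add_comm hc,
        Multiset.replicate_succ, Multiset.add_cons, ih]
      congr 1
      have : a - 1 = 0 := by rw [← Nat.pred_eq_sub_one]; omega
      omega

theorem filter_pred_map_succ (s : Multiset ℕ) (h : ∀ x ∈ s, 0 < x) (m : ℕ) :
    ((s.map Nat.succ + Multiset.replicate m 1).map Nat.pred).filter (0 < ·) = s := by
  rw [Multiset.map_add, Multiset.filter_add, Multiset.map_map, Multiset.map_replicate]
  have h1 : (Multiset.replicate m (Nat.pred 1)).filter (0 < ·) = 0 := by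
    rw [Multiset.filter_eq_nil]
    intro a ha
    rw [Multiset.eq_of_mem_replicate ha]
    simp
  rw [h1, add_zero]
  have h2 : s.map (Nat.pred ∘ Nat.succ) = s := by simp
  rw [h2, Multiset.filter_eq_self]
  exact h

theorem mem_sup_of_ne_zero (s : Multiset ℕ) (h : s ≠ 0) : s.sup ∈ s := by
  induction s using Multiset.induction_on with
  | empty => exact absurd rfl h
  | cons a s ih =>
    rw [Multiset.sup_cons]
    by_cases hs : s = 0
    · simp [hs]
    · rcases le_total a s.sup with h1 | h1
      · rw [sup_eq_right.2 h1]
        exact Multiset.mem_cons_of_mem (ih hs)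
      · rw [sup_eq_left.2 h1]
        exact Multiset.mem_cons_self _ _

/-- Dyson's map: remove the first column, add a new largest part. -/
def dysonMap (r n : ℕ) (π : n.Partition) : (n + r + 1).Partition where
  parts := (Multiset.card π.parts + r + 1) ::ₘ ((π.parts.map Nat.pred).filter (0 < ·))
  parts_pos := by
    intro i hi
    rcases Multiset.mem_cons.1 hi with rfl | h
    · omega
    · exact (Multiset.mem_filter.1 h).2
  parts_sum := by
    have := sum_filter_pred π.parts fun x hx => π.parts_pos hx
    rw [Multiset.sum_cons]
    have h2 := π.parts_sum
    omega

theorem largestPart_dysonMap (r n : ℕ) (π : n.Partition)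
    (h : largestPart π ≤ numParts π + r + 2) :
    largestPart (dysonMap r n π) = numParts π + r + 1 := by
  unfold largestPart dysonMap numParts
  rw [Multiset.sup_cons, sup_eq_left, Multiset.sup_le]
  intro b hb
  obtain ⟨hb, -⟩ := Multiset.mem_filter.1 hb
  obtain ⟨a, ha, rfl⟩ := Multiset.mem_map.1 hb
  have := Multiset.le_sup ha
  unfold largestPart numParts at h
  rw [Nat.pred_eq_sub_one]
  omega

theorem numParts_dysonMap_le (r n : ℕ) (π : n.Partition) :
    numParts (dysonMap r n π) ≤ numParts π + 1 := by
  unfold dysonMap numParts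
  rw [Multiset.card_cons]
  have := Multiset.card_le_card (Multiset.filter_le (0 < ·) (π.parts.map Nat.pred))
  rw [Multiset.card_map] at this
  omega

theorem exists_dyson_preimage (r n : ℕ) (μ : (n + r + 1).Partition)
    (h : (r : ℤ) ≤ rank μ) : ∃ π : n.Partition, rank π ≤ r + 2 ∧ dysonMap r n π = μ := by
  have hne : μ.parts ≠ 0 := by
    intro h0
    have := μ.parts_sum
    rw [h0] at this
    simp at this
  have hM := mem_sup_of_ne_zero _ hne
  obtain ⟨t, ht⟩ := Multiset.exists_cons_of_mem hM
  have hpos : ∀ x ∈ t, 0 < x := fun x hx => μ.parts_pos (ht ▸ Multiset.mem_cons_of_mem hx)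
  have hle : ∀ x ∈ t, x ≤ μ.parts.sup := fun x hx =>
    Multiset.le_sup (ht ▸ Multiset.mem_cons_of_mem hx)
  have hcard : Multiset.card μ.parts = Multiset.card t + 1 := by
    conv_lhs => rw [ht]
    simp
  have hsum : μ.parts.sup + t.sum = n + r + 1 := by
    rw [← Multiset.sum_cons, ← ht, μ.parts_sum]
  unfold rank largestPart numParts at h
  rw [hcard] at h
  push_cast at h
  obtain ⟨m, hm⟩ : ∃ m, μ.parts.sup = Multiset.card t + r + 1 + m :=
    ⟨μ.parts.sup - (Multiset.card t + r + 1), by omega⟩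
  have hs : (t.map Nat.succ).sum = t.sum + Multiset.card t := by
    have := sum_filter_pred (t.map Nat.succ) (by simp)
    have h2 := filter_pred_map_succ t hpos 0
    rw [Multiset.replicate_zero, add_zero] at h2
    rw [h2, Multiset.card_map] at this
    omega
  refine ⟨⟨t.map Nat.succ + Multiset.replicate m 1, ?_, ?_⟩, ?_, ?_⟩
  · intro i hi
    rcases Multiset.mem_add.1 hi with hi | hi
    · obtain ⟨a, -, rfl⟩ := Multiset.mem_map.1 hi
      exact Nat.succ_pos a
    · rw [Multiset.eq_of_mem_replicate hi]
      exact one_pos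
  · rw [Multiset.sum_add, hs, Multiset.sum_replicate]
    simp only [smul_eq_mul, mul_one]
    omega
  · unfold rank largestPart numParts
    simp only [Multiset.card_add, Multiset.card_map, Multiset.card_replicate]
    have : (t.map Nat.succ + Multiset.replicate m 1).sup ≤ μ.parts.sup + 1 := by
      rw [Multiset.sup_le]
      intro b hb
      rcases Multiset.mem_add.1 hb with hi | hi
      · obtain ⟨a, ha, rfl⟩ := Multiset.mem_map.1 hi
        exact Nat.succ_le_succ (hle a ha)
      · rw [Multiset.eq_of_mem_replicate hi]
        omega
    push_cast
    omega
  · apply Nat.Partition.ext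
    simp only [dysonMap]
    rw [filter_pred_map_succ t hpos m]
    conv_rhs => rw [ht]
    congr 1
    simp only [Multiset.card_add, Multiset.card_map, Multiset.card_replicate]
    omega

theorem dysonMap_injOn (r n : ℕ) (π σ : n.Partition) (hπ : rank π ≤ r + 2)
    (hσ : rank σ ≤ r + 2) (h : dysonMap r n π = dysonMap r n σ) : π = σ := by
  unfold rank at hπ hσ
  have hc : numParts π = numParts σ := by
    have h1 := largestPart_dysonMap r n π (by omega)
    have h2 := largestPart_dysonMap r n σ (by omega)
    rw [h] at h1
    omega
  have hp : (dysonMap r n π).parts = (dysonMap r n σ).parts := by rw [h]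
  unfold numParts at hc
  simp only [dysonMap, hc] at hp
  rw [Multiset.cons_inj_right] at hp
  apply Nat.Partition.ext
  rw [← map_succ_filter_pred π.parts fun x hx => π.parts_pos hx,
    ← map_succ_filter_pred σ.parts fun x hx => σ.parts_pos hx, hp, hc]

/-- Number of partitions, extended by zero to negative integers. -/
def pZ (z : ℤ) : ℤ := if 0 ≤ z then Fintype.card z.toNat.Partition else 0

/-- Number of partitions of `z` of rank at least `r`. -/
def rankGe (r z : ℤ) : ℤ :=
  if 0 ≤ z then (Finset.univ.filter fun π : z.toNat.Partition => r ≤ rank π).card else 0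

theorem pZ_natCast (n : ℕ) : pZ n = Fintype.card n.Partition := by simp [pZ]

theorem pZ_of_neg {z : ℤ} (h : z < 0) : pZ z = 0 := by
  rw [pZ, if_neg (by omega)]

theorem rankGe_natCast (r : ℤ) (n : ℕ) :
    rankGe r n = (Finset.univ.filter fun π : n.Partition => r ≤ rank π).card := by simp [rankGe]

theorem rankGe_of_neg (r : ℤ) {z : ℤ} (h : z < 0) : rankGe r z = 0 := by
  rw [rankGe, if_neg (by omega)]

theorem largestPart_le {n : ℕ} (π : n.Partition) : largestPart π ≤ n := by
  unfold largestPart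
  rw [Multiset.sup_le]
  intro b hb
  rw [← π.parts_sum]
  exact Multiset.single_le_sum (by simp) _ hb

theorem numParts_pos {n : ℕ} (hn : 0 < n) (π : n.Partition) : 0 < numParts π := by
  unfold numParts
  rw [Multiset.card_pos]
  intro h0
  have := π.parts_sum
  rw [h0] at this
  simp at this
  omega

theorem rank_lt {n : ℕ} (π : n.Partition) (r : ℕ) (h : 0 < n ∨ 0 < r) (hr : n < r + 1) :
    rank π < r := by
  have h1 := largestPart_le π
  unfold rank
  rcases Nat.eq_zero_or_pos n with h0 | h0
  · omega
  · have := numParts_pos h0 π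
    omega

theorem rankGe_add_rankGe (r n : ℕ) (h : 0 < n ∨ 0 < r) :
    rankGe r n + rankGe (r + 3) (n - r - 1) = pZ (n - r - 1) := by
  by_cases hr : n < r + 1
  · rw [pZ_of_neg (z := n - r - 1) (by omega), rankGe_of_neg _ (z := n - r - 1) (by omega),
      rankGe_natCast, add_zero,
      Nat.cast_eq_zero, Finset.card_eq_zero, Finset.filter_eq_empty_iff]
    intro π _
    have := rank_lt π r h hr
    omega
  · obtain ⟨m, rfl⟩ : ∃ m, n = m + r + 1 := ⟨n - r - 1, by omega⟩
    have e : ((m + r + 1 : ℕ) : ℤ) - r - 1 = m := by push_cast; ring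
    rw [e, rankGe_natCast, rankGe_natCast, pZ_natCast]
    have h1 : (Finset.univ.filter fun π : m.Partition => rank π ≤ r + 2).card =
        (Finset.univ.filter fun π : (m + r + 1).Partition => (r : ℤ) ≤ rank π).card := by
      apply Finset.card_bij fun π _ => dysonMap r m π
      · intro π hπ
        simp only [Finset.mem_filter, Finset.mem_univ, true_and] at hπ ⊢
        unfold rank at hπ ⊢
        rw [largestPart_dysonMap r m π (by omega)]
        have := numParts_dysonMap_le r m π
        push_cast
        omega
      · intro π hπ σ hσ h
        simp only [Finset.mem_filter, Finset.mem_univ, true_and] at hπ hσ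
        exact dysonMap_injOn r m π σ hπ hσ h
      · intro μ hμ
        simp only [Finset.mem_filter, Finset.mem_univ, true_and] at hμ
        obtain ⟨π, h1, h2⟩ := exists_dyson_preimage r m μ hμ
        exact ⟨π, by simpa using h1, h2⟩
    rw [← h1, ← Nat.cast_add, ← Finset.card_univ,
      ← Finset.card_filter_add_card_filter_not (s := Finset.univ)
        (fun π : m.Partition => rank π ≤ r + 2)]
    congr 3
    apply Finset.filter_congr
    intro π _
    omega

/-- The pentagonal exponent `k (3 k - 1) / 2`. -/
def pent (k : ℤ) : ℤ := k * (3 * k - 1) / 2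

theorem two_mul_pent (k : ℤ) : 2 * pent k = k * (3 * k - 1) := by
  unfold pent
  apply Int.mul_ediv_cancel'
  rcases Int.even_or_odd' k with ⟨c, rfl | rfl⟩
  · exact ⟨c * (3 * (2 * c) - 1), by ring⟩
  · exact ⟨(2 * c + 1) * (3 * c + 1), by ring⟩

theorem rankGe_eq_sum (N : ℕ) : ∀ (r n : ℕ), (0 < n ∨ 0 < r) → n < N →
    rankGe r n = ∑ k ∈ Finset.range N, (-1) ^ k * pZ (n - pent (k + 1) - (k + 1) * r) := by
  induction N with
  | zero => intro r n _ h; omega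
  | succ N ih =>
    intro r n h hN
    have h1 := rankGe_add_rankGe r n h
    have hp1 : pent 1 = 1 := by decide
    have h2 : rankGe (r + 3) (n - r - 1) = ∑ k ∈ Finset.range N,
        (-1) ^ k * pZ (n - r - 1 - pent (k + 1) - (k + 1) * (r + 3)) := by
      by_cases hr : n < r + 1
      · rw [rankGe_of_neg _ (by omega)]
        symm
        apply Finset.sum_eq_zero
        intro k _
        have := two_mul_pent (k + 1)
        have h3 : 0 ≤ pent (k + 1) := by nlinarith
        rw [pZ_of_neg, mul_zero]
        have : (0 : ℤ) ≤ (k + 1) * (r + 3) := by positivity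
        omega
      · obtain ⟨m, rfl⟩ : ∃ m, n = m + r + 1 := ⟨n - r - 1, by omega⟩
        have e : ((m + r + 1 : ℕ) : ℤ) - r - 1 = m := by push_cast; ring
        rw [e]
        have := ih (r + 3) m (by omega) (by omega)
        push_cast at this
        exact this
    rw [Finset.sum_range_succ']
    have h4 : ∀ k ∈ Finset.range N, (-1) ^ (k + 1) *
        pZ (n - pent ((k + 1 : ℕ) + 1) - ((k + 1 : ℕ) + 1) * r) =
        -((-1) ^ k * pZ (n - r - 1 - pent (k + 1) - (k + 1) * (r + 3))) := by
      intro k _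
      have e : (n : ℤ) - pent ((k + 1 : ℕ) + 1) - ((k + 1 : ℕ) + 1) * r =
          n - r - 1 - pent (k + 1) - (k + 1) * (r + 3) := by
        have h5 := two_mul_pent ((k + 1 : ℕ) + 1)
        have h6 := two_mul_pent (k + 1)
        push_cast at h5 ⊢
        linarith
      rw [e, pow_succ]
      ring
    rw [Finset.sum_congr rfl h4, Finset.sum_neg_distrib, ← h2]
    push_cast
    simp only [hp1, one_mul]
    have e2 : (n : ℤ) - 1 - r = n - r - 1 := by ring
    rw [e2]
    linarith

theorem rankGe_zero_add_one (n : ℕ) : rankGe 0 n + rankGe 1 n = pZ n := by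
  rw [rankGe_natCast, rankGe_natCast, pZ_natCast, ← Nat.cast_add, ← Finset.card_univ,
    ← Finset.card_filter_add_card_filter_not (s := Finset.univ)
        (fun π : n.Partition => 0 ≤ rank π)]
  congr 2
  apply Finset.card_equiv (conjEquiv n)
  intro π
  have : rank (conjEquiv n π) = -rank π := rank_conj π
  simp only [Finset.mem_filter, Finset.mem_univ, true_and, this]
  omega

/-- Euler's recurrence, in a form truncated at any large enough `N`. -/
theorem euler_recurrence (N n : ℕ) (hn : 0 < n) (hN : n < N) :
    pZ n = ∑ k ∈ Finset.range N,
      (-1) ^ k * (pZ (n - pent (k + 1)) + pZ (n - pent (-(k + 1)))) := by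
  rw [← rankGe_zero_add_one n]
  have h0 := rankGe_eq_sum N 0 n (by omega) hN
  have h1 := rankGe_eq_sum N 1 n (by omega) hN
  push_cast at h0 h1
  rw [h0, h1, ← Finset.sum_add_distrib]
  apply Finset.sum_congr rfl
  intro k _
  have e : (n : ℤ) - pent (-(k + 1)) = n - pent (k + 1) - (k + 1) * 1 := by
    have h5 := two_mul_pent (-(k + 1))
    have h6 := two_mul_pent (k + 1)
    linarith
  rw [e, mul_zero, sub_zero]
  ring

/-- A weighted indicator of a residue class, as a sum over the class. -/
theorem sum_class_indicator (N : ℕ) (ρ c : ℤ) (hc : 0 < c) (hc5 : c < 5) (hρ : ρ ≤ N) :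
    ∑ s ∈ Finset.range (N + 1), (5 * (s : ℤ) + c) * (if ρ = 5 * s + c then 1 else 0) =
      if 0 < ρ ∧ ρ % 5 = c then ρ else 0 := by
  split_ifs with h
  · rw [Finset.sum_eq_single (ρ / 5).toNat]
    · have : ((ρ / 5).toNat : ℤ) = ρ / 5 := Int.toNat_of_nonneg (by omega)
      rw [if_pos (by omega)]
      omega
    · intro b _ hb
      rw [if_neg (by omega), mul_zero]
    · intro hb
      simp only [Finset.mem_range] at hb
      omega
  · apply Finset.sum_eq_zero
    intro s _
    rw [if_neg (by omega), mul_zero]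

theorem card_rank_eq (N : ℕ) (m : ℤ) :
    rankGe m N - rankGe (m + 1) N = ∑ π : N.Partition, if rank π = m then 1 else 0 := by
  rw [rankGe_natCast, rankGe_natCast, Finset.card_filter, Finset.card_filter]
  push_cast
  rw [← Finset.sum_sub_distrib]
  apply Finset.sum_congr rfl
  intro π _
  split_ifs <;> omega

theorem rank_le {n : ℕ} (π : n.Partition) : rank π ≤ n := by
  have := largestPart_le π
  unfold rank
  omega

theorem sum_class_rankGe (N : ℕ) (c : ℤ) (hc : 0 < c) (hc5 : c < 5) :
    ∑ s ∈ Finset.range (N + 1), (5 * (s : ℤ) + c) *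
      (rankGe (5 * s + c) N - rankGe (5 * s + c + 1) N) =
    ∑ π : N.Partition, if 0 < rank π ∧ rank π % 5 = c then rank π else 0 := by
  simp only [card_rank_eq, Finset.mul_sum]
  rw [Finset.sum_comm]
  apply Finset.sum_congr rfl
  intro π _
  exact sum_class_indicator N _ c hc hc5 (rank_le π)

/-- `NT(3,5,N) - NT(2,5,N)` in terms of rank counts. -/
theorem NT_sub_NT (N : ℕ) : NT 3 5 N - NT 2 5 N =
    ∑ s ∈ Finset.range (N + 1), (5 * (s : ℤ) + 2) * (rankGe (5 * s + 2) N - rankGe (5 * s + 3) N) -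
    ∑ s ∈ Finset.range (N + 1), (5 * (s : ℤ) + 3) *
      (rankGe (5 * s + 3) N - rankGe (5 * s + 4) N) := by
  have h2 := sum_class_rankGe N 2 (by norm_num) (by norm_num)
  have h3 := sum_class_rankGe N 3 (by norm_num) (by norm_num)
  simp only [add_assoc] at h2 h3
  norm_num at h2 h3
  rw [h2, h3]
  have e (F : N.Partition → ℤ) : ∑ π, F (conj π) = ∑ π, F π :=
    (conjEquiv N).sum_comp F
  have k1 : NT 3 5 N - NT 2 5 N = ∑ π : N.Partition, ((if rank π % 5 = 3 then 1 else 0) -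
      (if rank π % 5 = 2 then 1 else 0)) * (numParts π : ℤ) := by
    unfold NT
    rw [← Finset.sum_sub_distrib]
    apply Finset.sum_congr rfl
    intro π _
    norm_num
    split_ifs <;> ring
  have k2 := k1
  rw [← e] at k2
  simp only [rank_conj, numParts_conj] at k2
  have k3 : 2 * (NT 3 5 N - NT 2 5 N) = ∑ π : N.Partition,
      ((if rank π % 5 = 2 then rank π else 0) - (if rank π % 5 = 3 then rank π else 0)) := by
    rw [two_mul]
    nth_rw 1 [k1]
    rw [k2, ← Finset.sum_add_distrib]
    apply Finset.sum_congr rfl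
    intro π _
    have hr : rank π = largestPart π - numParts π := rfl
    have a1 : (-rank π % 5 = 3) ↔ rank π % 5 = 2 := by omega
    have a2 : (-rank π % 5 = 2) ↔ rank π % 5 = 3 := by omega
    simp only [a1, a2]
    split_ifs <;> linarith
  rw [← Finset.sum_sub_distrib]
  have k4 : ∑ π : N.Partition, ((if rank π % 5 = 2 then rank π else 0) -
      (if rank π % 5 = 3 then rank π else 0)) =
      ∑ π : N.Partition, ((if 0 < rank π ∧ rank π % 5 = 2 then rank π else 0) -
      (if 0 < rank π ∧ rank π % 5 = 3 then rank π else 0)) +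
      ∑ π : N.Partition, ((if 0 < rank π ∧ rank π % 5 = 2 then rank π else 0) -
      (if 0 < rank π ∧ rank π % 5 = 3 then rank π else 0)) := by
    conv_rhs =>
      enter [2]
      rw [← e]
    rw [← Finset.sum_add_distrib]
    apply Finset.sum_congr rfl
    intro π _
    simp only [rank_conj]
    split_ifs <;> omega
  linarith

section CrankGF

open PowerSeries

open Classical in
/-- Number of partitions of `n` whose multiset of parts satisfies `P`. -/
noncomputable def cnt (P : Multiset ℕ → Prop) (n : ℕ) : ℕ :=
  (Finset.univ.filter fun π : n.Partition => P π.parts).card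

/-- Generating function of `cnt P`. -/
noncomputable def gf (P : Multiset ℕ → Prop) : ℤ⟦X⟧ := PowerSeries.mk fun n => (cnt P n : ℤ)

theorem gf_congr {P Q : Multiset ℕ → Prop} (h : ∀ s, (∀ x ∈ s, 0 < x) → (P s ↔ Q s)) :
    gf P = gf Q := by
  classical
  ext n
  simp only [gf, coeff_mk, cnt]
  congr 2
  apply Finset.filter_congr
  intro π _
  exact h _ fun x hx => π.parts_pos hx

theorem gf_split (P Q : Multiset ℕ → Prop) :
    gf P = gf (fun s => P s ∧ Q s) + gf (fun s => P s ∧ ¬ Q s) := by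
  classical
  ext n
  simp only [gf, coeff_mk, cnt, map_add]
  rw [← Nat.cast_add, ← Finset.card_filter_add_card_filter_not (fun π : n.Partition => Q π.parts),
    Finset.filter_filter, Finset.filter_filter]

theorem gf_mem (P : Multiset ℕ → Prop) (i : ℕ) (hi : 0 < i) :
    gf (fun s => P s ∧ i ∈ s) = X ^ i * gf (fun s => P (i ::ₘ s)) := by
  classical
  ext n
  rw [coeff_X_pow_mul']
  simp only [gf, coeff_mk, cnt]
  split_ifs with h
  · congr 1
    symm
    apply Finset.card_bij fun (π : (n - i).Partition) _ => (⟨i ::ₘ π.parts, by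
      intro x hx
      rcases Multiset.mem_cons.1 hx with rfl | hx
      · exact hi
      · exact π.parts_pos hx, by rw [Multiset.sum_cons, π.parts_sum]; omega⟩ : n.Partition)
    · intro π hπ
      simpa using hπ
    · intro π _ σ _ hs
      have := congrArg Nat.Partition.parts hs
      exact Nat.Partition.ext ((Multiset.cons_inj_right i).1 this)
    · intro μ hμ
      simp only [Finset.mem_filter, Finset.mem_univ, true_and] at hμ
      obtain ⟨t, ht⟩ := Multiset.exists_cons_of_mem hμ.2
      refine ⟨⟨t, fun hx => μ.parts_pos (ht ▸ Multiset.mem_cons_of_mem hx), ?_⟩, ?_, ?_⟩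
      · have := μ.parts_sum
        rw [ht, Multiset.sum_cons] at this
        omega
      · simp only [Finset.mem_filter, Finset.mem_univ, true_and]
        rw [← ht]
        exact hμ.1
      · exact Nat.Partition.ext ht.symm
  · rw [Nat.cast_eq_zero, Finset.card_eq_zero, Finset.filter_eq_empty_iff]
    rintro π _ ⟨-, hm⟩
    have := Multiset.single_le_sum (by simp) _ hm
    rw [π.parts_sum] at this
    omega

theorem gf_map_succ (P : Multiset ℕ → Prop) (j : ℕ) (hP : ∀ s, P s → Multiset.card s = j) :
    gf (fun s => P s ∧ ∀ x ∈ s, 1 < x) =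
      X ^ j * gf (fun s => P (s.map Nat.succ) ∧ ∀ x ∈ s, 0 < x) := by
  classical
  have hs (s : Multiset ℕ) : (s.map Nat.succ).sum = s.sum + Multiset.card s := by
    have : Nat.succ = fun x => x + 1 := rfl
    rw [this, Multiset.sum_map_add]
    simp
  have hsp (s : Multiset ℕ) (h : ∀ x ∈ s, 1 < x) : (s.map Nat.pred).map Nat.succ = s := by
    rw [Multiset.map_map]
    conv_rhs => rw [← Multiset.map_id s]
    apply Multiset.map_congr rfl
    intro x hx
    have := h x hx
    simp only [Function.comp, Nat.pred_eq_sub_one, id]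
    omega
  ext n
  rw [coeff_X_pow_mul']
  simp only [gf, coeff_mk, cnt]
  split_ifs with h
  · congr 1
    apply Finset.card_bij fun (π : n.Partition) hπ => (⟨π.parts.map Nat.pred, by
        intro x hx
        simp only [Finset.mem_filter, Finset.mem_univ, true_and] at hπ
        obtain ⟨a, ha, rfl⟩ := Multiset.mem_map.1 hx
        have := hπ.2 a ha
        simp only [Nat.pred_eq_sub_one]
        omega, by
        simp only [Finset.mem_filter, Finset.mem_univ, true_and] at hπ
        have := hs (π.parts.map Nat.pred)
        rw [hsp _ hπ.2, Multiset.card_map, hP _ hπ.1, π.parts_sum] at this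
        omega⟩ : (n - j).Partition)
    · intro π hπ
      simp only [Finset.mem_filter, Finset.mem_univ, true_and] at hπ ⊢
      refine ⟨?_, ?_⟩
      · rw [hsp _ hπ.2]
        exact hπ.1
      · intro x hx
        obtain ⟨a, ha, rfl⟩ := Multiset.mem_map.1 hx
        have := hπ.2 a ha
        simp only [Nat.pred_eq_sub_one]
        omega
    · intro π hπ σ hσ h
      simp only [Finset.mem_filter, Finset.mem_univ, true_and] at hπ hσ
      have := congrArg (fun τ => τ.parts.map Nat.succ) h
      simp only [hsp _ hπ.2, hsp _ hσ.2] at this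
      exact Nat.Partition.ext this
    · intro μ hμ
      simp only [Finset.mem_filter, Finset.mem_univ, true_and] at hμ
      have hc := hP _ hμ.1
      rw [Multiset.card_map] at hc
      refine ⟨⟨μ.parts.map Nat.succ, ?_, ?_⟩, ?_, ?_⟩
      · intro x hx
        obtain ⟨a, ha, rfl⟩ := Multiset.mem_map.1 hx
        exact Nat.succ_pos a
      · rw [hs, hc, μ.parts_sum]
        omega
      · simp only [Finset.mem_filter, Finset.mem_univ, true_and]
        refine ⟨hμ.1, ?_⟩
        intro x hx
        obtain ⟨a, ha, rfl⟩ := Multiset.mem_map.1 hx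
        exact Nat.succ_lt_succ (hμ.2 a ha)
      · apply Nat.Partition.ext
        simp
  · rw [Nat.cast_eq_zero, Finset.card_eq_zero, Finset.filter_eq_empty_iff]
    rintro π _ ⟨h1, h2⟩
    have h3 := hs (π.parts.map Nat.pred)
    rw [hsp _ h2, Multiset.card_map, hP _ h1, π.parts_sum] at h3
    omega

/-- Generating function of partitions with parts at most `j`. -/
noncomputable def pl : ℕ → ℤ⟦X⟧
  | 0 => 1
  | j + 1 => pl j * invOfUnit (1 - X ^ (j + 1)) 1

theorem one_sub_mul_pl (j : ℕ) : (1 - X ^ (j + 1)) * pl (j + 1) = pl j := by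
  rw [pl, mul_left_comm, mul_invOfUnit _ _ (by simp), mul_one]

theorem one_sub_X_pow_ne_zero (j : ℕ) : (1 - X ^ (j + 1) : ℤ⟦X⟧) ≠ 0 := by
  intro h
  have := congrArg constantCoeff h
  simp at this

theorem gf_eq_zero_multiset (P : Multiset ℕ → Prop) (h : ∀ s, (∀ x ∈ s, 0 < x) → (P s ↔ s = 0)) :
    gf P = 1 := by
  classical
  rw [gf_congr h]
  ext n
  simp only [gf, coeff_mk, cnt, coeff_one]
  split_ifs with h0
  · subst h0
    rw [Finset.filter_true_of_mem]
    · simp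
    · intro π _
      exact Multiset.eq_zero_of_forall_notMem fun x hx => by
        have h1 := π.parts_pos hx
        have := Multiset.single_le_sum (by simp) _ hx
        rw [π.parts_sum] at this
        omega
  · rw [Nat.cast_eq_zero, Finset.card_eq_zero, Finset.filter_eq_empty_iff]
    intro π _ hp
    have := π.parts_sum
    rw [hp] at this
    simp at this
    omega

theorem gf_parts_le (r : ℕ) : gf (fun s => ∀ x ∈ s, x ≤ r) = pl r := by
  induction r with
  | zero =>
    apply gf_eq_zero_multiset
    intro s hs
    constructor
    · intro h
      apply Multiset.eq_zero_of_forall_notMem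
      intro x hx
      have := hs x hx
      have := h x hx
      omega
    · rintro rfl
      simp
  | succ r ih =>
    have h := gf_split (fun s => ∀ x ∈ s, x ≤ r + 1) (fun s => r + 1 ∈ s)
    rw [gf_mem _ _ (Nat.succ_pos r)] at h
    have e1 : gf (fun s => ∀ x ∈ (r + 1) ::ₘ s, x ≤ r + 1) = gf (fun s => ∀ x ∈ s, x ≤ r + 1) :=
      gf_congr fun s _ => by simp
    have e2 : gf (fun s => (∀ x ∈ s, x ≤ r + 1) ∧ r + 1 ∉ s) = gf (fun s => ∀ x ∈ s, x ≤ r) :=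
      gf_congr fun s _ => by
        constructor
        · rintro ⟨h1, h2⟩ x hx
          have := h1 x hx
          have : x ≠ r + 1 := fun h => h2 (h ▸ hx)
          omega
        · intro h1
          exact ⟨fun x hx => (h1 x hx).trans (Nat.le_succ r), fun h2 => by
            have := h1 _ h2
            omega⟩
    rw [Nat.succ_eq_add_one, e1, e2, ih, ← one_sub_mul_pl r] at h
    apply mul_left_cancel₀ (one_sub_X_pow_ne_zero r)
    linear_combination h

theorem gf_card_eq (k j : ℕ) :
    gf (fun s => Multiset.card s = j ∧ ∀ x ∈ s, k < x) = X ^ (j * (k + 1)) * pl j := by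
  induction j with
  | zero =>
    rw [zero_mul, pow_zero, pl, mul_one]
    apply gf_eq_zero_multiset
    intro s _
    constructor
    · exact fun h => Multiset.card_eq_zero.1 h.1
    · rintro rfl
      simp
  | succ j ih =>
    have h := gf_split (fun s => Multiset.card s = j + 1 ∧ ∀ x ∈ s, k < x) (fun s => k + 1 ∈ s)
    rw [gf_mem _ _ (Nat.succ_pos k)] at h
    have e1 : gf (fun s => Multiset.card ((k + 1) ::ₘ s) = j + 1 ∧ ∀ x ∈ (k + 1) ::ₘ s, k < x) =
        gf (fun s => Multiset.card s = j ∧ ∀ x ∈ s, k < x) :=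
      gf_congr fun s _ => by simp
    have e2 : gf (fun s => (Multiset.card s = j + 1 ∧ ∀ x ∈ s, k < x) ∧ k + 1 ∉ s) =
        gf (fun s => (Multiset.card s = j + 1 ∧ ∀ x ∈ s, k + 1 < x) ∧ ∀ x ∈ s, 1 < x) :=
      gf_congr fun s _ => by
        constructor
        · rintro ⟨⟨h1, h2⟩, h3⟩
          refine ⟨⟨h1, fun x hx => ?_⟩, fun x hx => ?_⟩
          · have := h2 x hx
            have : x ≠ k + 1 := fun h => h3 (h ▸ hx)
            omega
          · have := h2 x hx
            have : x ≠ k + 1 := fun h => h3 (h ▸ hx)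
            omega
        · rintro ⟨⟨h1, h2⟩, -⟩
          refine ⟨⟨h1, fun x hx => ?_⟩, fun hx => ?_⟩
          · have := h2 x hx
            omega
          · have := h2 _ hx
            omega
    have e3 : gf (fun s => (Multiset.card (s.map Nat.succ) = j + 1 ∧
        ∀ x ∈ s.map Nat.succ, k + 1 < x) ∧ ∀ x ∈ s, 0 < x) =
        gf (fun s => Multiset.card s = j + 1 ∧ ∀ x ∈ s, k < x) :=
      gf_congr fun s hs => by
        simp only [Multiset.card_map, Multiset.mem_map, forall_exists_index, and_imp,
          forall_apply_eq_imp_iff₂]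
        constructor
        · rintro ⟨⟨h1, h2⟩, -⟩
          exact ⟨h1, fun x hx => Nat.lt_of_succ_lt_succ (h2 x hx)⟩
        · rintro ⟨h1, h2⟩
          exact ⟨⟨h1, fun x hx => Nat.succ_lt_succ (h2 x hx)⟩, hs⟩
    rw [Nat.succ_eq_add_one, e1, e2, gf_map_succ _ (j + 1) (fun s hs => hs.1), e3, ih] at h
    apply mul_left_cancel₀ (one_sub_X_pow_ne_zero j)
    have e4 := one_sub_mul_pl j
    linear_combination h - X ^ ((j + 1) * (k + 1)) * e4

theorem gf_no_ones (k j i : ℕ) (hik : i + 1 ≤ k) :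
    gf (fun s => (∀ x ∈ s, (2 ≤ x ∧ x ≤ i + 1) ∨ k < x) ∧
      Multiset.card (s.filter (k < ·)) = j) =
      (1 - X) * pl (i + 1) * (X ^ (j * (k + 1)) * pl j) := by
  induction i with
  | zero =>
    have := one_sub_mul_pl 0
    rw [zero_add, pow_one] at this
    rw [zero_add, this, pl, one_mul, ← gf_card_eq]
    apply gf_congr
    intro s _
    constructor
    · rintro ⟨h1, h2⟩
      have h3 : ∀ x ∈ s, k < x := fun x hx => by
        have := h1 x hx
        omega
      rw [Multiset.filter_eq_self.2 h3] at h2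
      exact ⟨h2, h3⟩
    · rintro ⟨h1, h2⟩
      rw [Multiset.filter_eq_self.2 h2]
      exact ⟨fun x hx => Or.inr (h2 x hx), h1⟩
  | succ i ih =>
    have h := gf_split (fun s => (∀ x ∈ s, (2 ≤ x ∧ x ≤ i + 1 + 1) ∨ k < x) ∧
      Multiset.card (s.filter (k < ·)) = j) (fun s => i + 1 + 1 ∈ s)
    rw [gf_mem _ _ (Nat.succ_pos _)] at h
    have e1 : gf (fun s => (∀ x ∈ (i + 1 + 1) ::ₘ s, (2 ≤ x ∧ x ≤ i + 1 + 1) ∨ k < x) ∧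
        Multiset.card (((i + 1 + 1) ::ₘ s).filter (k < ·)) = j) =
        gf (fun s => (∀ x ∈ s, (2 ≤ x ∧ x ≤ i + 1 + 1) ∨ k < x) ∧
        Multiset.card (s.filter (k < ·)) = j) :=
      gf_congr fun s _ => by
        rw [Multiset.filter_cons_of_neg _ (by omega)]
        simp
    have e2 : gf (fun s => ((∀ x ∈ s, (2 ≤ x ∧ x ≤ i + 1 + 1) ∨ k < x) ∧
        Multiset.card (s.filter (k < ·)) = j) ∧ i + 1 + 1 ∉ s) =
        gf (fun s => (∀ x ∈ s, (2 ≤ x ∧ x ≤ i + 1) ∨ k < x) ∧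
        Multiset.card (s.filter (k < ·)) = j) :=
      gf_congr fun s _ => by
        constructor
        · rintro ⟨⟨h1, h2⟩, h3⟩
          refine ⟨fun x hx => ?_, h2⟩
          have := h1 x hx
          have : x ≠ i + 1 + 1 := fun h => h3 (h ▸ hx)
          omega
        · rintro ⟨h1, h2⟩
          refine ⟨⟨fun x hx => ?_, h2⟩, fun hx => ?_⟩
          · have := h1 x hx
            omega
          · have := h1 _ hx
            omega
    rw [Nat.succ_eq_add_one, e1, e2, ih (by omega)] at h
    apply mul_left_cancel₀ (one_sub_X_pow_ne_zero (i + 1))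
    have e4 := one_sub_mul_pl (i + 1)
    linear_combination h - (1 - X) * (X ^ (j * (k + 1)) * pl j) * e4

theorem gf_ones (k j m : ℕ) (hk : 1 ≤ k) :
    gf (fun s => s.count 1 = m ∧ Multiset.card (s.filter (k < ·)) = j) =
      X ^ m * ((1 - X) * pl k * (X ^ (j * (k + 1)) * pl j)) := by
  induction m with
  | zero =>
    obtain ⟨i, rfl⟩ : ∃ i, k = i + 1 := ⟨k - 1, by omega⟩
    rw [pow_zero, one_mul, ← gf_no_ones (i + 1) j i le_rfl]
    apply gf_congr
    intro s hs
    rw [Multiset.count_eq_zero]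
    constructor
    · rintro ⟨h1, h2⟩
      refine ⟨fun x hx => ?_, h2⟩
      have := hs x hx
      have : x ≠ 1 := fun h => h1 (h ▸ hx)
      omega
    · rintro ⟨h1, h2⟩
      refine ⟨fun hx => ?_, h2⟩
      have := h1 _ hx
      omega
  | succ m ih =>
    rw [pow_succ', mul_assoc, ← ih]
    conv_rhs => rw [← pow_one X]
    have := gf_mem (fun s => s.count 1 = m + 1 ∧ Multiset.card (s.filter (k < ·)) = j) 1 one_pos
    have e1 : gf (fun s => (1 ::ₘ s).count 1 = m + 1 ∧
        Multiset.card ((1 ::ₘ s).filter (k < ·)) = j) =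
        gf (fun s => s.count 1 = m ∧ Multiset.card (s.filter (k < ·)) = j) :=
      gf_congr fun s _ => by
        rw [Multiset.filter_cons_of_neg _ (by omega)]
        simp
    rw [e1] at this
    rw [← this]
    apply gf_congr
    intro s _
    constructor
    · rintro ⟨h1, h2⟩
      exact ⟨⟨h1, h2⟩, Multiset.count_pos.1 (by omega)⟩
    · exact fun h => h.1

end CrankGF

section CrankAlg

/-- Triangular numbers. -/
def tri (k : ℕ) : ℕ := k * (k + 1) / 2

theorem two_mul_tri (k : ℕ) : 2 * tri k = k * (k + 1) :=
  Nat.mul_div_cancel' (Nat.even_mul_succ_self k).two_dvd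

theorem tri_succ (k : ℕ) : tri (k + 1) = tri k + k + 1 := by
  have h1 := two_mul_tri k
  have h2 := two_mul_tri (k + 1)
  have : (k + 1) * (k + 1 + 1) = k * (k + 1) + 2 * k + 2 := by ring
  omega

section Ring
variable {R : Type*} [CommRing R] (x : R) (p : ℕ → R) (L : ℕ)

/-- Truncated rectangle sum. -/
def rectT (r : ℕ) : R := ∑ l ∈ Finset.range L, x ^ (l * (l + r)) * p l * p (l + r)

/-- Truncated generating function of partitions of crank at least `r`. -/
def rectH (r : ℕ) : R := ∑ l ∈ Finset.range L, x ^ ((l + 1) * (l + r)) * p l * p (l + r)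

/-- Auxiliary shifted form of `rectH`. -/
def rectH' (r : ℕ) : R :=
  ∑ l ∈ Finset.range L, x ^ (l + (l + r) * (l + 1)) * p l * p (l + r + 1)

/-- Truncated generating function of partitions of crank `m`, up to a factor. -/
def rectS (m : ℕ) : R := ∑ l ∈ Finset.range L, x ^ (l + (l + m) * (l + 1)) * p l * p (l + m)

/-- The sequence `p` shifted by one. -/
def shiftSeq : ℕ → R
  | 0 => 0
  | l + 1 => p l

variable {x p L}

theorem shiftSeq_zero : shiftSeq p 0 = 0 := rfl

theorem shiftSeq_succ (l : ℕ) : shiftSeq p (l + 1) = p l := rfl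

theorem one_sub_mul_eq_shiftSeq (hp : ∀ j, (1 - x ^ (j + 1)) * p (j + 1) = p j) (l : ℕ) :
    (1 - x ^ l) * p l = shiftSeq p l := by
  cases l with
  | zero => simp [shiftSeq]
  | succ l => exact hp l

theorem pow_eq_zero_of_le' (hx : x ^ L = 0) {N : ℕ} (h : L ≤ N) : x ^ N = 0 := by
  obtain ⟨c, rfl⟩ := Nat.exists_eq_add_of_le h
  rw [pow_add, hx, zero_mul]

theorem rectT_succ (hL : 0 < L) (hx : x ^ L = 0)
    (hp : ∀ j, (1 - x ^ (j + 1)) * p (j + 1) = p j) (r : ℕ) :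
    rectT x p L (r + 1) = rectT x p L r := by
  have h : ∀ l, x ^ (l * (l + r)) * p l * p (l + r) -
      x ^ (l * (l + (r + 1))) * p l * p (l + (r + 1)) =
      x ^ (l * (l + r)) * shiftSeq p l * p (l + r) -
      x ^ ((l + 1) * (l + 1 + r)) * shiftSeq p (l + 1) * p (l + 1 + r) := by
    intro l
    have h1 := one_sub_mul_eq_shiftSeq hp l
    have h2 := hp (l + r)
    have e : l + 1 + r = l + r + 1 := by ring
    have e' : l + (r + 1) = l + r + 1 := by ring
    rw [e, e', ← h1, shiftSeq_succ, ← h2]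
    ring
  have h2 : rectT x p L r - rectT x p L (r + 1) = 0 := by
    unfold rectT
    rw [← Finset.sum_sub_distrib, Finset.sum_congr rfl fun l _ => h l,
      Finset.sum_range_sub' (fun l => x ^ (l * (l + r)) * shiftSeq p l * p (l + r)),
      pow_eq_zero_of_le' hx (show L ≤ L * (L + r) by nlinarith)]
    simp [shiftSeq]
  exact (sub_eq_zero.1 h2).symm

theorem rectT_sub_rectH (hL : 0 < L) (hx : x ^ L = 0)
    (hp : ∀ j, (1 - x ^ (j + 1)) * p (j + 1) = p j) (r : ℕ) :
    rectT x p L r - rectH x p L (r + 1) =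
      ∑ l ∈ Finset.range L, x ^ (l * (l + r) + l) * p l * p (l + r) := by
  have h1 : rectH x p L (r + 1) =
      ∑ l ∈ Finset.range L, x ^ (l * (l + r)) * shiftSeq p l * p (l + r) := by
    have h2 := Finset.sum_range_succ' (fun l => x ^ (l * (l + r)) * shiftSeq p l * p (l + r)) L
    rw [Finset.sum_range_succ,
      pow_eq_zero_of_le' hx (show L ≤ L * (L + r) by nlinarith)] at h2
    simp only [shiftSeq_zero, shiftSeq_succ, zero_mul, mul_zero, add_zero] at h2
    rw [h2]
    unfold rectH
    apply Finset.sum_congr rfl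
    intro l _
    have e : l + 1 + r = l + (r + 1) := by ring
    rw [e]
  rw [h1, rectT, ← Finset.sum_sub_distrib]
  apply Finset.sum_congr rfl
  intro l _
  rw [← one_sub_mul_eq_shiftSeq hp l]
  ring

theorem rectH_eq (hL : 0 < L) (hx : x ^ L = 0)
    (hp : ∀ j, (1 - x ^ (j + 1)) * p (j + 1) = p j) (r : ℕ) :
    rectH x p L r = x ^ r * (rectT x p L r - rectH x p L (r + 1)) := by
  rw [rectT_sub_rectH hL hx hp, Finset.mul_sum, rectH]
  apply Finset.sum_congr rfl
  intro l _
  ring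

theorem rectH'_eq (hL : 0 < L) (hx : x ^ L = 0)
    (hp : ∀ j, (1 - x ^ (j + 1)) * p (j + 1) = p j) (r : ℕ) :
    rectH' x p L r = x ^ r * (rectT x p L (r + 1) - rectH x p L (r + 2)) := by
  rw [rectT_sub_rectH hL hx hp, Finset.mul_sum, rectH']
  apply Finset.sum_congr rfl
  intro l _
  have e : l + r + 1 = l + (r + 1) := by ring
  rw [e]
  ring

theorem rectS_add (hp : ∀ j, (1 - x ^ (j + 1)) * p (j + 1) = p j) (m : ℕ) :
    rectS x p L m + x ^ m * rectS x p L (m + 1) = rectH' x p L m := by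
  unfold rectS rectH'
  rw [Finset.mul_sum, ← Finset.sum_add_distrib]
  apply Finset.sum_congr rfl
  intro l _
  have e : l + (m + 1) = l + m + 1 := by ring
  rw [e, ← hp (l + m)]
  ring

theorem rectT_eq_rectT_zero (hL : 0 < L) (hx : x ^ L = 0)
    (hp : ∀ j, (1 - x ^ (j + 1)) * p (j + 1) = p j) (r : ℕ) :
    rectT x p L r = rectT x p L 0 := by
  induction r with
  | zero => rfl
  | succ r ih => rw [rectT_succ hL hx hp, ih]

theorem rectS_eq (hL : 0 < L) (hx : x ^ L = 0)
    (hp : ∀ j, (1 - x ^ (j + 1)) * p (j + 1) = p j) (m : ℕ) (hm : 0 < m) :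
    (1 - x) * rectS x p L m = rectH x p L m - rectH x p L (m + 1) := by
  set E : ℕ → R := fun m => rectH x p L m - rectH x p L (m + 1) - (1 - x) * rectS x p L m with hE
  have hrec : ∀ m, E m = -(x ^ m * E (m + 1)) := by
    intro m
    have h1 := rectH_eq hL hx hp m
    have h2 := rectH_eq hL hx hp (m + 1)
    have h3 := rectH'_eq hL hx hp m
    have h4 := rectS_add (L := L) hp m
    rw [rectT_eq_rectT_zero hL hx hp] at h1 h2 h3
    simp only [hE]
    linear_combination h1 - h2 + x * h3 - h3 - (1 - x) * h4
  have hN : ∀ N m, 0 < m → ∃ c, E m = x ^ N * c := by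
    intro N
    induction N with
    | zero => exact fun m _ => ⟨E m, by simp⟩
    | succ N ih =>
      intro m hm
      obtain ⟨c, hc⟩ := ih (m + 1) (by omega)
      obtain ⟨k, rfl⟩ : ∃ k, m = k + 1 := ⟨m - 1, by omega⟩
      exact ⟨-(x ^ k * c), by rw [hrec, hc]; ring⟩
  obtain ⟨c, hc⟩ := hN L m hm
  rw [hx, zero_mul] at hc
  exact (sub_eq_zero.1 hc).symm

theorem rectH_eq_sum (hL : 0 < L) (hx : x ^ L = 0)
    (hp : ∀ j, (1 - x ^ (j + 1)) * p (j + 1) = p j) (r : ℕ) (hr : 0 < r) :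
    rectH x p L r = ∑ k ∈ Finset.range L, (-1) ^ k * x ^ ((k + 1) * r + tri k) *
      rectT x p L 0 := by
  have hN : ∀ N r, 0 < r → ∃ c, rectH x p L r =
      ∑ k ∈ Finset.range N, (-1) ^ k * x ^ ((k + 1) * r + tri k) * rectT x p L 0 + x ^ N * c := by
    intro N
    induction N with
    | zero => exact fun m _ => ⟨_, by simp; rfl⟩
    | succ N ih =>
      intro r hr
      obtain ⟨c, hc⟩ := ih (r + 1) (by omega)
      obtain ⟨k, rfl⟩ : ∃ k, r = k + 1 := ⟨r - 1, by omega⟩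
      refine ⟨-(x ^ k * c), ?_⟩
      rw [rectH_eq hL hx hp, rectT_eq_rectT_zero hL hx hp, hc, Finset.sum_range_succ']
      have : ∀ l, (-1 : R) ^ (l + 1) * x ^ ((l + 1 + 1) * (k + 1) + tri (l + 1)) *
          rectT x p L 0 = -(x ^ (k + 1) * ((-1) ^ l * x ^ ((l + 1) * (k + 1 + 1) + tri l) *
          rectT x p L 0)) := by
        intro l
        rw [tri_succ]
        ring
      rw [Finset.sum_congr rfl fun l _ => this l, Finset.sum_neg_distrib, ← Finset.mul_sum]
      have h0 : tri 0 = 0 := rfl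
      rw [h0]
      ring
  obtain ⟨c, hc⟩ := hN L r hr
  rw [hc, hx, zero_mul, add_zero]

end Ring

open PowerSeries

theorem coeff_eq_of_mk_eq (L : ℕ) (f g : ℤ⟦X⟧)
    (h : Ideal.Quotient.mk (Ideal.span {(X : ℤ⟦X⟧) ^ L}) f = Ideal.Quotient.mk _ g)
    (n : ℕ) (hn : n < L) : coeff n f = coeff n g := by
  rw [Ideal.Quotient.eq, Ideal.mem_span_singleton, X_pow_dvd_iff] at h
  have := h n hn
  rwa [map_sub, sub_eq_zero] at this

/-- Number of partitions of `n` of crank at least `r`, as an alternating sum. -/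
def crankGe (r n : ℕ) : ℤ :=
  ∑ k ∈ Finset.range (n + 1), (-1) ^ k * pZ (n - tri k - (k + 1) * r)

theorem coeff_rectS (n m : ℕ) (hm : 0 < m) :
    coeff n ((1 - X) * rectS X pl (n + 1) m) = crankGe m n - crankGe (m + 1) n := by
  set I := Ideal.span {(X : ℤ⟦X⟧) ^ (n + 1)} with hI
  set φ := Ideal.Quotient.mk I with hφ
  have hx : (φ X) ^ (n + 1) = 0 := by
    rw [← map_pow, Ideal.Quotient.eq_zero_iff_mem]
    exact Ideal.mem_span_singleton_self _
  have hp : ∀ j, (1 - φ X ^ (j + 1)) * φ (pl (j + 1)) = φ (pl j) := by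
    intro j
    rw [← one_sub_mul_pl j]
    simp
  set PP : ℤ⟦X⟧ := PowerSeries.mk fun n => pZ n with hPP
  have hT : rectT (φ X) (fun j => φ (pl j)) (n + 1) 0 = φ PP := by
    rw [← rectT_eq_rectT_zero (Nat.succ_pos n) hx hp n, rectT, Finset.sum_eq_single 0]
    · rw [zero_mul, pow_zero, one_mul, zero_add, pl, map_one, one_mul, hφ,
        Ideal.Quotient.eq, hI, Ideal.mem_span_singleton, X_pow_dvd_iff]
      intro k hk
      rw [map_sub, sub_eq_zero, ← gf_parts_le]
      classical
      simp only [gf, hPP, coeff_mk, pZ_natCast, cnt]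
      rw [Finset.filter_true_of_mem]
      · rfl
      · intro π _ y hy
        have := Multiset.single_le_sum (by simp) _ hy
        rw [π.parts_sum] at this
        omega
    · intro l _ hl
      have : n + 1 ≤ l * (l + n) := by
        have : 1 ≤ l := Nat.pos_of_ne_zero hl
        nlinarith
      rw [pow_eq_zero_of_le' hx this, zero_mul, zero_mul]
    · simp
  have hH : ∀ r, 0 < r → coeff n (∑ k ∈ Finset.range (n + 1),
      (-1) ^ k * X ^ ((k + 1) * r + tri k) * PP) = crankGe r n := by
    intro r _
    rw [map_sum, crankGe]
    apply Finset.sum_congr rfl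
    intro k _
    have : ((-1) ^ k * X ^ ((k + 1) * r + tri k) * PP : ℤ⟦X⟧) =
        C ((-1) ^ k) * (X ^ ((k + 1) * r + tri k) * PP) := by
      rw [map_pow, map_neg, map_one]
      ring
    rw [this, coeff_C_mul, coeff_X_pow_mul']
    split_ifs with h
    · simp only [hPP, coeff_mk]
      congr 2
      push_cast [Nat.cast_sub h]
      ring
    · rw [pZ_of_neg]
      have h2 : (n : ℤ) < ((k + 1) * r + tri k : ℕ) := by exact_mod_cast not_le.1 h
      push_cast at h2
      linarith
  rw [← hH m hm, ← hH (m + 1) (Nat.succ_pos m), ← map_sub]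
  apply coeff_eq_of_mk_eq (n + 1) _ _ _ n (Nat.lt_succ_self n)
  change φ _ = φ _
  have h1 := rectS_eq (p := fun j => φ (pl j)) (Nat.succ_pos n) hx hp m hm
  rw [rectH_eq_sum (p := fun j => φ (pl j)) (Nat.succ_pos n) hx hp m hm,
    rectH_eq_sum (p := fun j => φ (pl j)) (Nat.succ_pos n) hx hp (m + 1) (Nat.succ_pos m), hT] at h1
  simpa [rectS, map_sum] using h1

end CrankAlg

section CrankMom

open PowerSeries

/-- Number of partitions of `n` with `k` ones and `j` parts larger than `k`. -/
noncomputable def cc (n k j : ℕ) : ℤ :=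
  coeff n (gf (fun s => s.count 1 = k ∧ Multiset.card (s.filter (k < ·)) = j))

theorem cc_eq (n k j : ℕ) (hk : 1 ≤ k) :
    cc n k j = coeff n (X ^ k * ((1 - X) * pl k * (X ^ (j * (k + 1)) * pl j))) := by
  rw [cc, gf_ones k j k hk]

theorem cc_comm (n k j : ℕ) (hk : 1 ≤ k) (hj : 1 ≤ j) : cc n k j = cc n j k := by
  rw [cc_eq n k j hk, cc_eq n j k hj]
  congr 1
  ring

theorem numParts_le {n : ℕ} (π : n.Partition) : numParts π ≤ n := by
  rw [← largestPart_conj]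
  exact largestPart_le _

theorem muParts_le {n : ℕ} (π : n.Partition) : muParts π ≤ n :=
  (Multiset.card_le_card (Multiset.filter_le _ _)).trans (numParts_le π)

theorem omegaOnes_le {n : ℕ} (π : n.Partition) : omegaOnes π ≤ n :=
  (Multiset.count_le_card _ _).trans (numParts_le π)

theorem cc_eq_sum (n k j : ℕ) : cc n k j =
    ∑ π : n.Partition, if omegaOnes π = k ∧ muParts π = j then 1 else 0 := by
  classical
  simp only [cc, gf, coeff_mk, cnt]
  rw [Finset.card_filter]
  push_cast
  apply Finset.sum_congr rfl
  intro π _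
  unfold muParts omegaOnes
  congr 1
  apply propext
  constructor
  · rintro ⟨rfl, rfl⟩
    exact ⟨rfl, rfl⟩
  · rintro ⟨rfl, rfl⟩
    exact ⟨rfl, rfl⟩

theorem cc_eq_zero (n k j : ℕ) (h : n < k ∨ n < j) : cc n k j = 0 := by
  rw [cc_eq_sum]
  apply Finset.sum_eq_zero
  intro π _
  have h1 := omegaOnes_le π
  have h2 := muParts_le π
  rw [if_neg (by omega)]

theorem sum_omega_mu (n : ℕ) (f : ℕ → ℕ → ℤ) :
    ∑ π : n.Partition, f (omegaOnes π) (muParts π) =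
      ∑ k ∈ Finset.range (n + 1), ∑ j ∈ Finset.range (n + 1), f k j * cc n k j := by
  simp only [cc_eq_sum, Finset.mul_sum]
  have : ∀ π : n.Partition, f (omegaOnes π) (muParts π) = ∑ k ∈ Finset.range (n + 1),
      ∑ j ∈ Finset.range (n + 1),
        f k j * (if omegaOnes π = k ∧ muParts π = j then 1 else 0) := by
    intro π
    have h1 := omegaOnes_le π
    have h2 := muParts_le π
    rw [Finset.sum_eq_single (omegaOnes π), Finset.sum_eq_single (muParts π)]
    · simp
    · intro j _ hj
      rw [if_neg (fun h => hj h.2.symm), mul_zero]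
    · intro h
      exact absurd (Finset.mem_range.2 (by omega)) h
    · intro k _ hk
      apply Finset.sum_eq_zero
      intro j _
      rw [if_neg (fun h => hk h.1.symm), mul_zero]
    · intro h
      exact absurd (Finset.mem_range.2 (by omega)) h
  rw [Finset.sum_congr rfl fun π _ => this π, Finset.sum_comm]
  apply Finset.sum_congr rfl
  intro k _
  rw [Finset.sum_comm]

/-- The number of partitions of crank `m > 0` in terms of `cc`. -/
theorem crankGe_sub (n m : ℕ) (hm : 0 < m) :
    crankGe m n - crankGe (m + 1) n =
      cc n m 0 + ∑ l ∈ Finset.range n, cc n (l + 1) (l + 1 + m) := by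
  rw [← coeff_rectS n m hm, rectS, Finset.sum_range_succ', mul_add, map_add, add_comm]
  congr 1
  · rw [cc_eq n m 0 hm]
    congr 1
    simp only [pl, zero_add, zero_mul, pow_zero, mul_one]
    ring
  · rw [Finset.mul_sum, map_sum]
    apply Finset.sum_congr rfl
    intro l _
    rw [cc_eq n (l + 1) (l + 1 + m) (by omega)]
    congr 1
    ring

theorem sum_diag (n m : ℕ) : ∑ l ∈ Finset.range n, cc n (l + 1) (l + 1 + m) =
    ∑ k ∈ Finset.range n, ∑ j ∈ Finset.range n,
      (if ((j : ℤ) - k = m) then 1 else 0) * cc n (k + 1) (j + 1) := by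
  apply Finset.sum_congr rfl
  intro k _
  by_cases h : k + m < n
  · rw [Finset.sum_eq_single (k + m)]
    · rw [if_pos (by push_cast; ring), one_mul]
      congr 1
      omega
    · intro j _ hj
      rw [if_neg (by omega), zero_mul]
    · intro h'
      exact absurd (Finset.mem_range.2 h) h'
  · rw [cc_eq_zero _ _ _ (Or.inr (by omega))]
    symm
    apply Finset.sum_eq_zero
    intro j hj
    have := Finset.mem_range.1 hj
    rw [if_neg (by omega), zero_mul]

theorem sum_zero_col (n m : ℕ) (hm : 0 < m) : cc n m 0 =
    ∑ k ∈ Finset.range n, (if ((k + 1 : ℤ) = m) then 1 else 0) * cc n (k + 1) 0 := by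
  by_cases h : m ≤ n
  · rw [Finset.sum_eq_single (m - 1)]
    · rw [if_pos (by omega), one_mul]
      congr 1
      omega
    · intro j _ hj
      rw [if_neg (by omega), zero_mul]
    · intro h'
      exact absurd (Finset.mem_range.2 (by omega)) h'
  · rw [cc_eq_zero _ _ _ (Or.inl (by omega))]
    symm
    apply Finset.sum_eq_zero
    intro j hj
    have := Finset.mem_range.1 hj
    rw [if_neg (by omega), zero_mul]

theorem sum_class_crankGe (n c : ℕ) (hc : 0 < c) (hc5 : c < 5) :
    ∑ s ∈ Finset.range (n + 1), (5 * (s : ℤ) + c) *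
      (crankGe (5 * s + c) n - crankGe (5 * s + c + 1) n) =
    ∑ k ∈ Finset.range n, (if ((k + 1 : ℤ) % 5 = c) then (k + 1 : ℤ) else 0) * cc n (k + 1) 0 +
    ∑ k ∈ Finset.range n, ∑ j ∈ Finset.range n,
      (if 0 < (j : ℤ) - k ∧ ((j : ℤ) - k) % 5 = c then (j : ℤ) - k else 0) *
        cc n (k + 1) (j + 1) := by
  have h : ∀ s : ℕ, crankGe (5 * s + c) n - crankGe (5 * s + c + 1) n = _ := fun s =>
    crankGe_sub n (5 * s + c) (by omega)
  simp only [h, mul_add, Finset.sum_add_distrib]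
  congr 1
  · have h2 : ∀ s : ℕ, cc n (5 * s + c) 0 = _ := fun s => sum_zero_col n (5 * s + c) (by omega)
    simp only [h2, Finset.mul_sum]
    rw [Finset.sum_comm]
    apply Finset.sum_congr rfl
    intro k hk
    have := Finset.mem_range.1 hk
    have h3 := sum_class_indicator n (k + 1) c (by omega) (by omega) (by omega)
    simp only [← mul_assoc]
    rw [← Finset.sum_mul]
    push_cast
    rw [h3]
    congr 1
    have : (0 : ℤ) < k + 1 := by omega
    simp [this]
  · simp only [sum_diag, Finset.mul_sum]
    rw [Finset.sum_comm]
    apply Finset.sum_congr rfl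
    intro k _
    rw [Finset.sum_comm]
    apply Finset.sum_congr rfl
    intro j hj
    have := Finset.mem_range.1 hj
    have h3 := sum_class_indicator n (j - k) c (by omega) (by omega) (by omega)
    simp only [← mul_assoc]
    rw [← Finset.sum_mul]
    push_cast
    rw [h3]

/-- `Mω(1,5,n) - Mω(4,5,n)` in terms of crank counts. -/
theorem Mw_sub_Mw (n : ℕ) : Mw 1 5 n - Mw 4 5 n =
    -(∑ s ∈ Finset.range (n + 1), (5 * (s : ℤ) + 1) *
      (crankGe (5 * s + 1) n - crankGe (5 * s + 2) n) -
    ∑ s ∈ Finset.range (n + 1), (5 * (s : ℤ) + 4) *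
      (crankGe (5 * s + 4) n - crankGe (5 * s + 5) n)) := by
  have h1 := sum_class_crankGe n 1 (by norm_num) (by norm_num)
  have h4 := sum_class_crankGe n 4 (by norm_num) (by norm_num)
  simp only [add_assoc] at h1 h4
  simp only [Nat.cast_one, Nat.cast_ofNat, Nat.reduceAdd] at h1 h4
  rw [h1, h4]
  have k1 : Mw 1 5 n - Mw 4 5 n = ∑ k ∈ Finset.range (n + 1), ∑ j ∈ Finset.range (n + 1),
      ((if ((j : ℤ) - k) % 5 = 1 then (k : ℤ) else 0) -
        (if ((j : ℤ) - k) % 5 = 4 then (k : ℤ) else 0)) * cc n k j := by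
    rw [← sum_omega_mu n fun k j => ((if ((j : ℤ) - k) % 5 = 1 then (k : ℤ) else 0) -
        (if ((j : ℤ) - k) % 5 = 4 then (k : ℤ) else 0))]
    unfold Mw
    rw [← Finset.sum_sub_distrib]
    apply Finset.sum_congr rfl
    intro π _
    unfold crank
    norm_num
    by_cases h : omegaOnes π = 0
    · simp [h]
    · simp only [if_neg h]
  rw [k1, Finset.sum_range_succ']
  have z1 : ∑ j ∈ Finset.range (n + 1),
      ((if ((j : ℤ) - (0 : ℕ)) % 5 = 1 then ((0 : ℕ) : ℤ) else 0) -
        (if ((j : ℤ) - (0 : ℕ)) % 5 = 4 then ((0 : ℕ) : ℤ) else 0)) * cc n 0 j = 0 := by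
    apply Finset.sum_eq_zero
    intro j _
    simp
  rw [z1, add_zero]
  simp only [Finset.sum_range_succ']
  rw [Finset.sum_add_distrib]
  have k2 : ∑ k ∈ Finset.range n, ((if (((0 : ℕ) : ℤ) - (k + 1 : ℕ)) % 5 = 1
        then ((k + 1 : ℕ) : ℤ) else 0) -
      (if (((0 : ℕ) : ℤ) - (k + 1 : ℕ)) % 5 = 4 then ((k + 1 : ℕ) : ℤ) else 0)) *
        cc n (k + 1) 0 =
      ∑ k ∈ Finset.range n, (if ((k + 1 : ℤ) % 5 = 4) then (k + 1 : ℤ) else 0) * cc n (k + 1) 0 -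
      ∑ k ∈ Finset.range n, (if ((k + 1 : ℤ) % 5 = 1) then (k + 1 : ℤ) else 0) *
        cc n (k + 1) 0 := by
    rw [← Finset.sum_sub_distrib]
    apply Finset.sum_congr rfl
    intro k _
    rw [← sub_mul]
    congr 1
    push_cast
    have a1 : ((0 : ℤ) - (k + 1)) % 5 = 1 ↔ ((k : ℤ) + 1) % 5 = 4 := by omega
    have a2 : ((0 : ℤ) - (k + 1)) % 5 = 4 ↔ ((k : ℤ) + 1) % 5 = 1 := by omega
    simp only [a1, a2]
  rw [k2]
  set D := ∑ k ∈ Finset.range n, ∑ j ∈ Finset.range n,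
    ((if (((j + 1 : ℕ) : ℤ) - (k + 1 : ℕ)) % 5 = 1 then ((k + 1 : ℕ) : ℤ) else 0) -
      (if (((j + 1 : ℕ) : ℤ) - (k + 1 : ℕ)) % 5 = 4 then ((k + 1 : ℕ) : ℤ) else 0)) *
        cc n (k + 1) (j + 1) with hD
  have k3 : D = ∑ k ∈ Finset.range n, ∑ j ∈ Finset.range n,
    ((if (((k + 1 : ℕ) : ℤ) - (j + 1 : ℕ)) % 5 = 1 then ((j + 1 : ℕ) : ℤ) else 0) -
      (if (((k + 1 : ℕ) : ℤ) - (j + 1 : ℕ)) % 5 = 4 then ((j + 1 : ℕ) : ℤ) else 0)) *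
        cc n (k + 1) (j + 1) := by
    rw [hD, Finset.sum_comm]
    apply Finset.sum_congr rfl
    intro k _
    apply Finset.sum_congr rfl
    intro j _
    rw [cc_comm n (j + 1) (k + 1) (by omega) (by omega)]
  set S : ℤ := ∑ k ∈ Finset.range n, ∑ j ∈ Finset.range n,
    ((if 0 < (j : ℤ) - k ∧ ((j : ℤ) - k) % 5 = 4 then (j : ℤ) - k else 0) -
    (if 0 < (j : ℤ) - k ∧ ((j : ℤ) - k) % 5 = 1 then (j : ℤ) - k else 0)) *
      cc n (k + 1) (j + 1) with hS
  have k4 : S = ∑ k ∈ Finset.range n, ∑ j ∈ Finset.range n,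
    ((if 0 < (k : ℤ) - j ∧ ((k : ℤ) - j) % 5 = 4 then (k : ℤ) - j else 0) -
    (if 0 < (k : ℤ) - j ∧ ((k : ℤ) - j) % 5 = 1 then (k : ℤ) - j else 0)) *
      cc n (k + 1) (j + 1) := by
    rw [hS, Finset.sum_comm]
    apply Finset.sum_congr rfl
    intro k _
    apply Finset.sum_congr rfl
    intro j _
    rw [cc_comm n (j + 1) (k + 1) (by omega) (by omega)]
  have k5 : D + D = S + S := by
    conv_lhs =>
      enter [2]
      rw [k3]
    conv_rhs =>
      enter [2]
      rw [k4]
    rw [hD, hS]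
    simp only [← Finset.sum_add_distrib]
    apply Finset.sum_congr rfl
    intro k _
    apply Finset.sum_congr rfl
    intro j _
    rw [← add_mul, ← add_mul]
    congr 1
    push_cast
    have a1 : ((j : ℤ) + 1 - (k + 1)) = j - k := by ring
    have a2 : ((k : ℤ) + 1 - (j + 1)) = k - j := by ring
    rw [a1, a2]
    split_ifs <;> omega
  have k6 : D = S := by linarith
  rw [k6, hS]
  simp only [sub_mul, Finset.sum_sub_distrib]
  ring

end CrankMom

section Val

variable {t : ℝ}

theorem zpow_anti_lt_one (h0 : 0 < t) (h1 : t < 1 / 8) {m n : ℤ} (h : m ≤ n) :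
    t ^ n ≤ t ^ m :=
  zpow_right_anti₀ h0 (by linarith) h

theorem summable_pow_abs (h0 : 0 < t) (h1 : t < 1 / 8) :
    Summable fun m : ℤ => t ^ |m| := by
  have h : Summable fun n : ℕ => t ^ n := summable_geometric_of_lt_one h0.le (by linarith)
  apply Summable.of_nat_of_neg
  · simpa using h
  · simpa using h

theorem summable_gauss (h0 : 0 < t) (h1 : t < 1 / 8) (L : ℕ) :
    Summable fun m : ℤ => t ^ (m ^ 2 - L * |m|) := by
  refine Summable.of_nonneg_of_le (fun m => (zpow_pos h0 _).le) (fun m => ?_)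
    ((summable_pow_abs h0 h1).mul_left (t ^ (-((L : ℤ) + 1) ^ 2)))
  rw [← zpow_add₀ h0.ne']
  apply zpow_anti_lt_one h0 h1
  nlinarith [sq_nonneg (2 * |m| - ((L : ℤ) + 1)), sq_abs m, sq_nonneg ((L : ℤ) + 1)]

theorem abs_pow_le_zpow (h0 : 0 < t) (h1 : t < 1 / 8) (d : ℤ) (i : ℕ) :
    |(d : ℝ)| ^ i ≤ t ^ (-(i * |d|)) := by
  have h2 : |(d : ℝ)| ≤ t ^ (-|d|) := by
    rw [← Int.cast_abs, Int.abs_eq_natAbs, zpow_neg, zpow_natCast, ← inv_pow]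
    have h3 : (2 : ℝ) ≤ t⁻¹ := by
      rw [le_inv_comm₀ (by norm_num) h0]; linarith
    calc (((d.natAbs : ℤ) : ℝ)) ≤ 2 ^ d.natAbs := by
          exact_mod_cast (Nat.lt_two_pow_self).le
      _ ≤ _ := by gcongr
  calc |(d : ℝ)| ^ i ≤ (t ^ (-|d|)) ^ i := by gcongr
    _ = _ := by rw [← zpow_natCast, ← zpow_mul]; congr 1; ring

/-- A family of coefficients `a` with exponents `d` decaying faster than a Gaussian. -/
def Adm (t : ℝ) (c : ℕ) {ι : Type} (a : ι → ℝ) (d : ι → ℤ) : Prop :=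
  ∀ L : ℕ, Summable fun j => |a j| * t ^ (-(c * d j ^ 2) - L * |d j|)

variable {ι : Type} {a : ι → ℝ} {d : ι → ℤ} {c : ℕ}

theorem Adm.summable_moment (h0 : 0 < t) (h1 : t < 1 / 8) (h : Adm t c a d) (i : ℕ) :
    Summable fun j => ‖a j * (d j : ℝ) ^ i‖ := by
  refine Summable.of_nonneg_of_le (fun _ => norm_nonneg _) (fun j => ?_) (h i)
  rw [norm_mul, norm_pow, Real.norm_eq_abs, Real.norm_eq_abs]
  gcongr
  refine (abs_pow_le_zpow h0 h1 _ _).trans (zpow_anti_lt_one h0 h1 ?_)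
  have : (0 : ℤ) ≤ c * d j ^ 2 := by positivity
  linarith

theorem Adm.summable_val (h0 : 0 < t) (h1 : t < 1 / 8) (h : Adm t c a d) (k : ℤ) :
    Summable fun j => ‖a j * t ^ (-2 * k * d j)‖ := by
  refine Summable.of_nonneg_of_le (fun _ => norm_nonneg _) (fun j => ?_) (h (2 * k.natAbs))
  rw [norm_mul, Real.norm_eq_abs, Real.norm_eq_abs, abs_of_pos (zpow_pos h0 _)]
  refine mul_le_mul_of_nonneg_left (zpow_anti_lt_one h0 h1 ?_) (abs_nonneg _)
  have : (0 : ℤ) ≤ c * d j ^ 2 := by positivity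
  have h2 : k * d j ≤ |k| * |d j| := by rw [← abs_mul]; exact le_abs_self _
  push_cast
  linarith

theorem Adm.mono (h0 : 0 < t) (h1 : t < 1 / 8) (h : Adm t c a d) {c' : ℕ} (hc : c' ≤ c) :
    Adm t c' a d := by
  intro L
  refine Summable.of_nonneg_of_le (fun _ => mul_nonneg (abs_nonneg _) (zpow_pos h0 _).le)
    (fun j => ?_) (h L)
  refine mul_le_mul_of_nonneg_left (zpow_anti_lt_one h0 h1 ?_) (abs_nonneg _)
  have : (c' : ℤ) * d j ^ 2 ≤ c * d j ^ 2 := by gcongr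
  linarith

/-- `F k = ∑ a_j t^(-2 k d_j)` for an admissible family with the given moments
`M_i = ∑ a_j d_j ^ i`. -/
def Val (t : ℝ) (c : ℕ) (F : ℤ → ℝ) (M0 M1 M2 : ℝ) : Prop :=
  ∃ (ι : Type) (a : ι → ℝ) (d : ι → ℤ), Adm t c a d ∧
    (∀ k, HasSum (fun j => a j * t ^ (-2 * k * d j)) (F k)) ∧
    HasSum a M0 ∧ HasSum (fun j => a j * d j) M1 ∧ HasSum (fun j => a j * (d j : ℝ) ^ 2) M2

variable {F F' : ℤ → ℝ} {M0 M1 M2 M0' M1' M2' : ℝ}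

theorem Val.mono (h0 : 0 < t) (h1 : t < 1 / 8) (h : Val t c F M0 M1 M2) {c' : ℕ}
    (hc : c' ≤ c) : Val t c' F M0 M1 M2 := by
  obtain ⟨ι, a, d, hA, hF, h3⟩ := h
  exact ⟨ι, a, d, hA.mono h0 h1 hc, hF, h3⟩

theorem Val.smul (h : Val t c F M0 M1 M2) (r : ℝ) :
    Val t c (fun k => r * F k) (r * M0) (r * M1) (r * M2) := by
  obtain ⟨ι, a, d, hA, hF, h2, h3, h4⟩ := h
  refine ⟨ι, fun j => r * a j, d, fun L => ?_, fun k => ?_, h2.mul_left r, ?_, ?_⟩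
  · simpa [abs_mul, mul_assoc] using (hA L).mul_left |r|
  · simpa [mul_assoc] using (hF k).mul_left r
  · simpa [mul_assoc] using h3.mul_left r
  · simpa [mul_assoc] using h4.mul_left r

theorem hasSum_sumElim {ι ι' : Type} {f : ι ⊕ ι' → ℝ} {x y : ℝ}
    (hx : HasSum (fun j => f (Sum.inl j)) x) (hy : HasSum (fun j => f (Sum.inr j)) y) :
    HasSum f (x + y) :=
  HasSum.sum hx hy

theorem Val.add (h : Val t c F M0 M1 M2) (h' : Val t c F' M0' M1' M2') :
    Val t c (fun k => F k + F' k) (M0 + M0') (M1 + M1') (M2 + M2') := by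
  obtain ⟨ι, a, d, hA, hF, h2, h3, h4⟩ := h
  obtain ⟨ι', a', d', hA', hF', h2', h3', h4'⟩ := h'
  refine ⟨ι ⊕ ι', Sum.elim a a', Sum.elim d d', fun L => ?_, fun k => ?_, ?_, ?_, ?_⟩
  · refine (hasSum_sumElim (x := ∑' j, |a j| * t ^ (-(c * d j ^ 2) - L * |d j|)) ?_
      (y := ∑' j, |a' j| * t ^ (-(c * d' j ^ 2) - L * |d' j|)) ?_).summable
    · simpa only [Sum.elim_inl] using (hA L).hasSum
    · simpa only [Sum.elim_inr] using (hA' L).hasSum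
  · apply hasSum_sumElim
    · simpa only [Sum.elim_inl] using hF k
    · simpa only [Sum.elim_inr] using hF' k
  · apply hasSum_sumElim
    · simpa only [Sum.elim_inl] using h2
    · simpa only [Sum.elim_inr] using h2'
  · apply hasSum_sumElim
    · simpa only [Sum.elim_inl] using h3
    · simpa only [Sum.elim_inr] using h3'
  · apply hasSum_sumElim
    · simpa only [Sum.elim_inl] using h4
    · simpa only [Sum.elim_inr] using h4'

theorem hasSum_of_eq {ι : Type} {f g : ι → ℝ} {x : ℝ} (h : HasSum f x)
    (e : ∀ j, g j = f j) : HasSum g x := by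
  rwa [show g = f from funext e]

theorem Adm.mul (h0 : 0 < t) (h1 : t < 1 / 8) {ι' : Type} {a' : ι' → ℝ} {d' : ι' → ℤ}
    (hA : Adm t (2 * c) a d) (hA' : Adm t (2 * c) a' d') :
    Adm t c (fun j : ι × ι' => a j.1 * a' j.2) (fun j => d j.1 + d' j.2) := by
  intro L
  have h2 := Summable.mul_of_nonneg (hA L) (hA' L)
    (fun _ => mul_nonneg (abs_nonneg _) (zpow_pos h0 _).le)
    (fun _ => mul_nonneg (abs_nonneg _) (zpow_pos h0 _).le)
  refine Summable.of_nonneg_of_le (fun _ => mul_nonneg (abs_nonneg _) (zpow_pos h0 _).le)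
    (fun j => ?_) h2
  rw [abs_mul, mul_mul_mul_comm, ← zpow_add₀ h0.ne']
  refine mul_le_mul_of_nonneg_left (zpow_anti_lt_one h0 h1 ?_) (by positivity)
  have h5 : |d j.1 + d' j.2| ≤ |d j.1| + |d' j.2| := abs_add_le _ _
  have h6 : (L : ℤ) * |d j.1 + d' j.2| ≤ L * (|d j.1| + |d' j.2|) :=
    mul_le_mul_of_nonneg_left h5 (by positivity)
  have h7 : (c : ℤ) * (d j.1 + d' j.2) ^ 2 ≤ c * (2 * d j.1 ^ 2 + 2 * d' j.2 ^ 2) :=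
    mul_le_mul_of_nonneg_left (by nlinarith [sq_nonneg (d j.1 - d' j.2)]) (by positivity)
  push_cast
  linarith

theorem hasSum_mul_of_norm {ι ι' : Type} {f : ι → ℝ} {g : ι' → ℝ} {x y : ℝ}
    (hx : HasSum f x) (hy : HasSum g y) (sf : Summable fun j => ‖f j‖)
    (sg : Summable fun j => ‖g j‖) :
    HasSum (fun j : ι × ι' => f j.1 * g j.2) (x * y) :=
  HasSum.mul hx hy (summable_mul_of_summable_norm sf sg)

theorem Val.mul (h0 : 0 < t) (h1 : t < 1 / 8) (h : Val t (2 * c) F M0 M1 M2)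
    (h' : Val t (2 * c) F' M0' M1' M2') :
    Val t c (fun k => F k * F' k) (M0 * M0') (M1 * M0' + M0 * M1')
      (M2 * M0' + 2 * (M1 * M1') + M0 * M2') := by
  obtain ⟨ι, a, d, hA, hF, h2, h3, h4⟩ := h
  obtain ⟨ι', a', d', hA', hF', h2', h3', h4'⟩ := h'
  have s0 := hA.summable_moment h0 h1 0
  have s1 := hA.summable_moment h0 h1 1
  have s2 := hA.summable_moment h0 h1 2
  have s0' := hA'.summable_moment h0 h1 0
  have s1' := hA'.summable_moment h0 h1 1
  have s2' := hA'.summable_moment h0 h1 2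
  simp only [pow_zero, mul_one, pow_one] at s0 s1 s0' s1'
  have e00 := hasSum_mul_of_norm h2 h2' s0 s0'
  have e10 := hasSum_mul_of_norm h3 h2' s1 s0'
  have e01 := hasSum_mul_of_norm h2 h3' s0 s1'
  have e11 := hasSum_mul_of_norm h3 h3' s1 s1'
  have e20 := hasSum_mul_of_norm h4 h2' s2 s0'
  have e02 := hasSum_mul_of_norm h2 h4' s0 s2'
  refine ⟨ι × ι', fun j => a j.1 * a' j.2, fun j => d j.1 + d' j.2, hA.mul h0 h1 hA',
    fun k => ?_, e00, hasSum_of_eq (e10.add e01) fun j => ?_,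
    hasSum_of_eq ((e20.add (e11.mul_left 2)).add e02) fun j => ?_⟩
  · refine hasSum_of_eq (hasSum_mul_of_norm (hF k) (hF' k)
      (hA.summable_val h0 h1 k) (hA'.summable_val h0 h1 k)) fun j => ?_
    rw [mul_add, zpow_add₀ h0.ne']
    ring
  · push_cast
    ring
  · push_cast
    ring

end Val

section Key

variable {t : ℝ}

/-- The rational function `∑ (5 s + c) x ^ s`. -/
noncomputable def eta (c x : ℝ) : ℝ := (c + (5 - c) * x) / (1 - x) ^ 2

theorem inv_one_sub_sq_le (h0 : 0 < t) (h1 : t < 1 / 8) (k : ℤ) :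
    |((1 - t ^ (2 * k)) ^ 2)⁻¹| ≤ 2 ∧ |t ^ (2 * k) * ((1 - t ^ (2 * k)) ^ 2)⁻¹| ≤ 2 := by
  rcases eq_or_ne k 0 with rfl | hk
  · simp
  have key : ∀ x : ℝ, 0 < x → x ≤ 1 / 8 → ((1 - x) ^ 2)⁻¹ ≤ 2 ∧ x * ((1 - x) ^ 2)⁻¹ ≤ 2 := by
    intro x hx hx8
    have h3 : ((1 - x) ^ 2)⁻¹ ≤ 2 := by
      rw [inv_le_comm₀ (by nlinarith) (by norm_num)]
      nlinarith
    have h4 : 0 ≤ ((1 - x) ^ 2)⁻¹ := by positivity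
    exact ⟨h3, by nlinarith⟩
  have hsm : ∀ m : ℤ, 0 < m → t ^ (2 * m) ≤ 1 / 8 := fun m hm =>
    (zpow_anti_lt_one h0 h1 (show (1 : ℤ) ≤ 2 * m by omega)).trans (by simpa using h1.le)
  have hp := zpow_pos h0 (2 * k)
  rw [abs_of_nonneg (by positivity), abs_of_nonneg (by positivity)]
  rcases lt_or_gt_of_ne hk with h | h
  · have h5 := key (t ^ (2 * -k)) (zpow_pos h0 _) (hsm _ (by omega))
    have h6 : t ^ (2 * k) = (t ^ (2 * -k))⁻¹ := by rw [← zpow_neg]; congr 1; ring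
    set x := t ^ (2 * -k)
    have hx : 0 < x := zpow_pos h0 _
    rw [h6]
    have hx1 : 1 - x ≠ 0 := by
      have := hsm (-k) (by omega)
      intro h; change x ≤ 1 / 8 at this; linarith
    have e1 : ((1 - x⁻¹) ^ 2)⁻¹ = x * (x * ((1 - x) ^ 2)⁻¹) := by
      rw [show 1 - x⁻¹ = -(1 - x) * x⁻¹ by field_simp; ring, mul_pow, mul_inv, neg_sq]
      field_simp
    have e2 : x⁻¹ * ((1 - x⁻¹) ^ 2)⁻¹ = x * ((1 - x) ^ 2)⁻¹ := by
      rw [e1]; field_simp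
    rw [e2, e1]
    have h7 : x ≤ 1 / 8 := hsm (-k) (by omega)
    have h8 : 0 ≤ x * ((1 - x) ^ 2)⁻¹ := by positivity
    exact ⟨by nlinarith, h5.2⟩
  · exact key _ hp (hsm k h)

theorem abs_eta_le (h0 : 0 < t) (h1 : t < 1 / 8) (c : ℝ) (k : ℤ) :
    |eta c (t ^ (2 * k))| ≤ 2 * |c| + 2 * |5 - c| := by
  obtain ⟨h2, h3⟩ := inv_one_sub_sq_le h0 h1 k
  have : eta c (t ^ (2 * k)) = c * ((1 - t ^ (2 * k)) ^ 2)⁻¹ +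
      (5 - c) * (t ^ (2 * k) * ((1 - t ^ (2 * k)) ^ 2)⁻¹) := by
    rw [eta]; ring
  rw [this]
  refine (abs_add_le _ _).trans ?_
  rw [abs_mul, abs_mul]
  nlinarith [abs_nonneg c, abs_nonneg (5 - c)]

theorem eta_zero (c : ℝ) : eta c 1 = 0 := by simp [eta]

/-- summand of the basic kernel -/
noncomputable def kerTerm (t : ℝ) (j k : ℤ) : ℝ :=
  -(-1 : ℝ) ^ k * t ^ (k ^ 2 + k - 2 * j * k) * ((1 - t ^ (2 * k)) ^ 2)⁻¹

/-- the basic kernel -/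
noncomputable def ker (t : ℝ) (j : ℤ) : ℝ := ∑' k : ℤ, kerTerm t j k

theorem abs_neg_one_zpow (k : ℤ) : |(-1 : ℝ) ^ k| = 1 := by
  rw [abs_zpow]; simp

theorem summable_shift_gauss (h0 : 0 < t) (h1 : t < 1 / 8) (j : ℤ) :
    Summable fun k : ℤ => t ^ (k ^ 2 + k - 2 * j * k) := by
  refine Summable.of_nonneg_of_le (fun m => (zpow_pos h0 _).le) (fun k => ?_)
    (summable_gauss h0 h1 (1 + 2 * j.natAbs))
  apply zpow_anti_lt_one h0 h1
  have h2 : j * k ≤ |j| * |k| := by rw [← abs_mul]; exact le_abs_self _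
  have h3 := neg_abs_le k
  push_cast
  linarith

theorem summable_kerTerm (h0 : 0 < t) (h1 : t < 1 / 8) (j : ℤ) : Summable (kerTerm t j) := by
  refine Summable.of_norm_bounded ((summable_shift_gauss h0 h1 j).mul_left 2) fun k => ?_
  rw [kerTerm, norm_mul, norm_mul, norm_neg, Real.norm_eq_abs, abs_neg_one_zpow,
    Real.norm_eq_abs, Real.norm_eq_abs, abs_of_pos (zpow_pos h0 _), one_mul, mul_comm]
  exact mul_le_mul_of_nonneg_right (inv_one_sub_sq_le h0 h1 k).1 (zpow_pos h0 _).le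

theorem neg_one_zpow_neg (k : ℤ) : (-1 : ℝ) ^ (-k) = (-1) ^ k := by
  rw [zpow_neg, ← inv_zpow]; norm_num

theorem zpow_two_mul_ne_one (h0 : 0 < t) (h1 : t < 1 / 8) {k : ℤ} (hk : k ≠ 0) :
    t ^ (2 * k) ≠ 1 := by
  rw [Ne, zpow_eq_one_iff_right₀ h0.le (by linarith)]
  omega

theorem ker_reflect (h0 : 0 < t) (h1 : t < 1 / 8) (j : ℤ) : ker t (-1 - j) = ker t j := by
  unfold ker
  rw [← (Equiv.neg ℤ).tsum_eq]
  apply tsum_congr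
  intro k
  simp only [Equiv.neg_apply, kerTerm, neg_one_zpow_neg]
  rcases eq_or_ne k 0 with rfl | hk
  · simp
  have h3 := sub_ne_zero.2 (zpow_two_mul_ne_one h0 h1 hk).symm
  have e1 : t ^ (2 * -k) = (t ^ (2 * k))⁻¹ := by rw [← zpow_neg]; congr 1; ring
  have e2 : t ^ ((-k) ^ 2 + -k - 2 * (-1 - j) * -k) =
      t ^ (k ^ 2 + k - 2 * j * k) * ((t ^ (2 * k))⁻¹ * (t ^ (2 * k))⁻¹) := by
    rw [← zpow_neg, ← zpow_add₀ h0.ne', ← zpow_add₀ h0.ne']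
    congr 1; ring
  rw [e1, e2]
  have hp := (zpow_pos h0 (2 * k)).ne'
  generalize t ^ (2 * k) = x at *
  have h4 : 1 - x⁻¹ = -(1 - x) * x⁻¹ := by field_simp; ring
  rw [h4, mul_pow, neg_sq]
  field_simp

theorem alternating_gauss (t : ℝ) (j : ℤ) :
    ∑' k : ℤ, (-1 : ℝ) ^ k * t ^ (k ^ 2 + k - 2 * j * k) = 0 := by
  have h : ∑' k : ℤ, (-1 : ℝ) ^ k * t ^ (k ^ 2 + k - 2 * j * k) =
      -∑' k : ℤ, (-1 : ℝ) ^ k * t ^ (k ^ 2 + k - 2 * j * k) := by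
    conv_lhs => rw [← (Equiv.subLeft (2 * j - 1)).tsum_eq]
    rw [← tsum_neg]
    apply tsum_congr
    intro k
    simp only [Equiv.subLeft_apply]
    have e : (-1 : ℝ) ^ (2 * j - 1 - k) = -(-1) ^ k := by
      rw [show 2 * j - 1 - k = 2 * (j - 1 - k) + (k + 1) by ring,
        zpow_add₀ (by norm_num), zpow_add₀ (by norm_num), zpow_mul]
      norm_num
    rw [e]
    have : (2 * j - 1 - k) ^ 2 + (2 * j - 1 - k) - 2 * j * (2 * j - 1 - k) =
      k ^ 2 + k - 2 * j * k := by ring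
    rw [this, neg_mul]
  linarith

theorem ker_second_difference (h0 : 0 < t) (h1 : t < 1 / 8) (j : ℤ) :
    ker t j - 2 * ker t (j - 1) + ker t (j - 2) = 1 := by
  have s := fun j => summable_kerTerm h0 h1 j
  unfold ker
  rw [← tsum_mul_left, ← (s j).tsum_sub ((s (j - 1)).mul_left 2),
    ← ((s j).sub ((s (j - 1)).mul_left 2)).tsum_add (s (j - 2))]
  have hs : Summable fun k : ℤ => (-1 : ℝ) ^ k * t ^ (k ^ 2 + k - 2 * j * k) := by
    refine Summable.of_norm_bounded (summable_shift_gauss h0 h1 j) fun k => ?_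
    rw [norm_mul, Real.norm_eq_abs, abs_neg_one_zpow, one_mul, Real.norm_eq_abs,
      abs_of_pos (zpow_pos h0 _)]
  have h3 := (hs.hasSum.neg).add (hasSum_ite_eq (0 : ℤ) (1 : ℝ))
  rw [alternating_gauss] at h3
  refine (hasSum_of_eq h3 fun k => ?_).tsum_eq.trans (by norm_num)
  simp only [kerTerm]
  rcases eq_or_ne k 0 with rfl | hk
  · simp
  rw [if_neg hk]
  have h4 := sub_ne_zero.2 (zpow_two_mul_ne_one h0 h1 hk).symm
  have e1 : t ^ (k ^ 2 + k - 2 * (j - 1) * k) = t ^ (k ^ 2 + k - 2 * j * k) * t ^ (2 * k) := by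
    rw [← zpow_add₀ h0.ne']; congr 1; ring
  have e2 : t ^ (k ^ 2 + k - 2 * (j - 2) * k) =
      t ^ (k ^ 2 + k - 2 * j * k) * (t ^ (2 * k) * t ^ (2 * k)) := by
    rw [← zpow_add₀ h0.ne', ← zpow_add₀ h0.ne']; congr 1; ring
  rw [e1, e2]
  field_simp
  ring

theorem int_const_of_step {f : ℤ → ℝ} (h : ∀ j, f j = f (j - 1)) (j : ℤ) : f j = f 0 := by
  induction j using Int.induction_on with
  | zero => rfl
  | succ i ih => rw [h, ← ih]; congr 1; ring
  | pred i ih => rw [← ih, h (-(i : ℤ))]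

theorem ker_eq (h0 : 0 < t) (h1 : t < 1 / 8) (j : ℤ) :
    ker t j = ker t 0 + ((j : ℝ) ^ 2 + j) / 2 := by
  have e1 : ∀ j : ℤ, ker t j - ker t (j - 1) - j = ker t 0 - ker t (0 - 1) - (0 : ℤ) := by
    intro j
    refine int_const_of_step (f := fun j => ker t j - ker t (j - 1) - j) (fun j => ?_) j
    have := ker_second_difference h0 h1 j
    rw [show j - 1 - 1 = j - 2 by ring]
    push_cast
    linarith
  have h2 := ker_reflect h0 h1 0
  rw [show (-1 - 0 : ℤ) = 0 - 1 by norm_num] at h2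
  have e2 := int_const_of_step (f := fun j => ker t j - ((j : ℝ) ^ 2 + j) / 2) (fun j => by
    have := e1 j
    rw [h2] at this
    push_cast at this ⊢
    linarith) j
  push_cast at e2
  linarith

theorem kernel_sum (h0 : 0 < t) (h1 : t < 1 / 8) (c : ℝ) (d : ℤ) :
    HasSum (fun k : ℤ => -(-1 : ℝ) ^ k * t ^ (k ^ 2 + k - 2 * d * k) * eta c (t ^ (2 * k)))
      (5 * ker t 0 + (5 * (d : ℝ) ^ 2 + (2 * c - 5) * d) / 2) := by
  have h2 := ((summable_kerTerm h0 h1 d).hasSum.mul_left c).add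
    ((summable_kerTerm h0 h1 (d - 1)).hasSum.mul_left (5 - c))
  have e : c * ∑' k, kerTerm t d k + (5 - c) * ∑' k, kerTerm t (d - 1) k =
      5 * ker t 0 + (5 * (d : ℝ) ^ 2 + (2 * c - 5) * d) / 2 := by
    change c * ker t d + (5 - c) * ker t (d - 1) = _
    rw [ker_eq h0 h1 d, ker_eq h0 h1 (d - 1)]
    push_cast
    ring
  rw [e] at h2
  refine hasSum_of_eq h2 fun k => ?_
  simp only [kerTerm, eta]
  have e1 : t ^ (k ^ 2 + k - 2 * (d - 1) * k) = t ^ (k ^ 2 + k - 2 * d * k) * t ^ (2 * k) := by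
    rw [← zpow_add₀ h0.ne']; congr 1; ring
  rw [e1]
  ring

variable {F : ℤ → ℝ} {M0 M1 M2 : ℝ}

theorem Val.hasSum_eta (h0 : 0 < t) (h1 : t < 1 / 8) (h : Val t 1 F M0 M1 M2) (c : ℝ) :
    HasSum (fun k : ℤ => -(-1 : ℝ) ^ k * t ^ (k ^ 2 + k) * F k * eta c (t ^ (2 * k)))
      (5 * ker t 0 * M0 + (5 * M2 + (2 * c - 5) * M1) / 2) := by
  obtain ⟨ι, a, d, hA, hF, h2, h3, h4⟩ := h
  set f : ι × ℤ → ℝ := fun p => a p.1 * (-(-1 : ℝ) ^ p.2 *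
    t ^ (p.2 ^ 2 + p.2 - 2 * d p.1 * p.2) * eta c (t ^ (2 * p.2))) with hf
  have hs : Summable f := by
    have s1 : Summable fun j => |a j| * t ^ (-(d j ^ 2) + d j) := by
      refine Summable.of_nonneg_of_le (fun _ => mul_nonneg (abs_nonneg _) (zpow_pos h0 _).le)
        (fun j => ?_) (hA 1)
      refine mul_le_mul_of_nonneg_left (zpow_anti_lt_one h0 h1 ?_) (abs_nonneg _)
      have := neg_abs_le (d j)
      push_cast
      linarith
    have s2 : Summable fun k : ℤ => t ^ (k ^ 2 + k) := by
      simpa using summable_shift_gauss h0 h1 0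
    have s3 := Summable.mul_of_nonneg s1 s2
      (fun _ => mul_nonneg (abs_nonneg _) (zpow_pos h0 _).le) (fun _ => (zpow_pos h0 _).le)
    have s4 := ((Equiv.prodShear (Equiv.refl ι) fun j => Equiv.subRight (d j)).summable_iff.2
      s3).mul_left (2 * |c| + 2 * |5 - c|)
    refine Summable.of_norm_bounded s4 fun p => ?_
    obtain ⟨j, k⟩ := p
    simp only [hf, Function.comp, Equiv.prodShear_apply, Equiv.refl_apply, Equiv.subRight_apply]
    rw [norm_mul, norm_mul, norm_mul, norm_neg, Real.norm_eq_abs, Real.norm_eq_abs,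
      abs_neg_one_zpow, Real.norm_eq_abs, Real.norm_eq_abs, abs_of_pos (zpow_pos h0 _),
      one_mul, mul_assoc |a j|, ← zpow_add₀ h0.ne']
    have e1 : -(d j ^ 2) + d j + ((k - d j) ^ 2 + (k - d j)) = k ^ 2 + k - 2 * d j * k := by ring
    rw [e1]
    have h5 := abs_eta_le h0 h1 c k
    have h6 := zpow_pos h0 (k ^ 2 + k - 2 * d j * k)
    calc |a j| * (t ^ (k ^ 2 + k - 2 * d j * k) * |eta c (t ^ (2 * k))|)
        ≤ |a j| * (t ^ (k ^ 2 + k - 2 * d j * k) * (2 * |c| + 2 * |5 - c|)) := by gcongr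
      _ = _ := by ring
  have a1 : HasSum (fun j => a j * (5 * ker t 0 + (5 * (d j : ℝ) ^ 2 + (2 * c - 5) * d j) / 2))
      (∑' p, f p) := by
    refine hs.hasSum.prod_fiberwise fun j => ?_
    exact (kernel_sum h0 h1 c (d j)).mul_left (a j)
  have a2 : HasSum (fun k : ℤ => -(-1 : ℝ) ^ k * t ^ (k ^ 2 + k) * F k * eta c (t ^ (2 * k)))
      (∑' p, f p) := by
    have s5 : HasSum (fun p : ℤ × ι => f p.swap) (∑' p, f p) :=
      (Equiv.prodComm ℤ ι).hasSum_iff.2 hs.hasSum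
    refine s5.prod_fiberwise fun k => ?_
    refine hasSum_of_eq (((hF k).mul_left (-(-1 : ℝ) ^ k * t ^ (k ^ 2 + k))).mul_right
      (eta c (t ^ (2 * k)))) fun j => ?_
    simp only [hf, Prod.swap]
    have e1 : t ^ (k ^ 2 + k - 2 * d j * k) = t ^ (k ^ 2 + k) * t ^ (-2 * k * d j) := by
      rw [← zpow_add₀ h0.ne']; congr 1; ring
    rw [e1]
    ring
  have a3 := ((h2.mul_left (5 * ker t 0)).add ((h4.mul_left (5 / 2)).add
    (h3.mul_left ((2 * c - 5) / 2))))
  have a4 : ∑' p, f p = 5 * ker t 0 * M0 + (5 * M2 + (2 * c - 5) * M1) / 2 := by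
    refine a1.unique (hasSum_of_eq a3 fun j => ?_) |>.trans ?_ <;> ring
  rwa [a4] at a2

theorem Val.moments_eq_zero (h0 : 0 < t) (h1 : t < 1 / 8) (h : Val t 1 F M0 M1 M2)
    (hF : ∀ k, F k = 0) : M0 = 0 ∧ M1 = 0 ∧ M2 = 0 := by
  have hM0 : M0 = 0 := by
    obtain ⟨ι, a, d, -, h2, h3, -⟩ := h
    refine h3.unique ?_
    have := h2 0
    rw [hF] at this
    simpa using this
  have e := fun c : ℝ => (h.hasSum_eta h0 h1 c).unique
    (hasSum_of_eq hasSum_zero fun k => by rw [hF]; ring)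
  have e1 := e 0
  have e2 := e 1
  rw [hM0] at e1 e2
  refine ⟨hM0, ?_, ?_⟩ <;> linarith

end Key

section Theta

variable {t : ℝ}

/-- summand of the theta series of index `a` -/
noncomputable def thetaTerm (t : ℝ) (a m : ℤ) : ℝ := (-1) ^ m * t ^ (5 * m * (m - 1) + 2 * a * m)

/-- the `i`-th moment of the theta series of index `a` -/
noncomputable def thetaMom (t : ℝ) (i : ℕ) (a : ℤ) : ℝ := ∑' m : ℤ, thetaTerm t a m * (m : ℝ) ^ i

theorem neg_one_zpow_mul_self (k : ℤ) : (-1 : ℝ) ^ k * (-1) ^ k = 1 := by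
  rw [← zpow_add₀ (by norm_num), ← two_mul, zpow_mul]; norm_num

theorem thetaTerm_adm (h0 : 0 < t) (h1 : t < 1 / 8) (a : ℤ) :
    Adm t 4 (thetaTerm t a) (fun m => m) := by
  intro L
  refine Summable.of_nonneg_of_le (fun _ => mul_nonneg (abs_nonneg _) (zpow_pos h0 _).le)
    (fun m => ?_) (summable_gauss h0 h1 (5 + 2 * a.natAbs + L))
  rw [thetaTerm, abs_mul, abs_neg_one_zpow, one_mul, abs_of_pos (zpow_pos h0 _),
    ← zpow_add₀ h0.ne']
  apply zpow_anti_lt_one h0 h1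
  have h2 : -(|a| * |m|) ≤ a * m := by rw [← abs_mul]; exact neg_abs_le _
  have h3 := le_abs_self m
  push_cast
  linarith

theorem hasSum_thetaMom (h0 : 0 < t) (h1 : t < 1 / 8) (i : ℕ) (a : ℤ) :
    HasSum (fun m : ℤ => thetaTerm t a m * (m : ℝ) ^ i) (thetaMom t i a) :=
  ((thetaTerm_adm h0 h1 a).summable_moment h0 h1 i).of_norm.hasSum

theorem val_theta (h0 : 0 < t) (h1 : t < 1 / 8) (a : ℤ) :
    Val t 4 (fun k => thetaMom t 0 (a - k)) (thetaMom t 0 a) (thetaMom t 1 a)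
      (thetaMom t 2 a) := by
  refine ⟨ℤ, thetaTerm t a, fun m => m, thetaTerm_adm h0 h1 a, fun k => ?_, ?_, ?_,
    hasSum_thetaMom h0 h1 2 a⟩
  · refine hasSum_of_eq (hasSum_thetaMom h0 h1 0 (a - k)) fun m => ?_
    rw [thetaTerm, thetaTerm, mul_assoc, ← zpow_add₀ h0.ne', pow_zero, mul_one]
    congr 2
    ring
  · exact hasSum_of_eq (hasSum_thetaMom h0 h1 0 a) fun m => by simp
  · exact hasSum_of_eq (hasSum_thetaMom h0 h1 1 a) fun m => by simp

theorem thetaTerm_shift (h0 : 0 < t) (s r m : ℤ) : thetaTerm t (5 * s + r) (m - s) =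
    (-1) ^ s * t ^ (-(5 * s * (s - 1) + 2 * r * s)) * thetaTerm t r m := by
  simp only [thetaTerm]
  rw [mul_mul_mul_comm, ← zpow_add₀ h0.ne', ← zpow_add₀ (by norm_num : (-1 : ℝ) ≠ 0)]
  congr 1
  · rw [show s + m = (m - s) + 2 * s by ring, zpow_add₀ (by norm_num), zpow_mul (-1) 2]
    norm_num
  · congr 1
    ring

theorem thetaMom_zero_shift (h0 : 0 < t) (s r : ℤ) : thetaMom t 0 (5 * s + r) =
    (-1) ^ s * t ^ (-(5 * s * (s - 1) + 2 * r * s)) * thetaMom t 0 r := by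
  simp only [thetaMom]
  rw [← (Equiv.subRight s).tsum_eq, ← tsum_mul_left]
  apply tsum_congr
  intro m
  rw [Equiv.subRight_apply, thetaTerm_shift h0]
  simp

theorem thetaMom_one_shift (h0 : 0 < t) (h1 : t < 1 / 8) (s r : ℤ) :
    thetaMom t 1 (5 * s + r) = (-1) ^ s * t ^ (-(5 * s * (s - 1) + 2 * r * s)) *
      (thetaMom t 1 r - s * thetaMom t 0 r) := by
  have h2 := ((hasSum_thetaMom h0 h1 1 r).sub ((hasSum_thetaMom h0 h1 0 r).mul_left
    (s : ℝ))).mul_left ((-1) ^ s * t ^ (-(5 * s * (s - 1) + 2 * r * s)))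
  have h3 := (Equiv.subRight s).hasSum_iff.2 (hasSum_thetaMom h0 h1 1 (5 * s + r))
  refine h3.unique (hasSum_of_eq h2 fun m => ?_)
  simp only [Function.comp, Equiv.subRight_apply, thetaTerm_shift h0]
  push_cast
  ring

theorem thetaMom_two_shift (h0 : 0 < t) (h1 : t < 1 / 8) (s r : ℤ) :
    thetaMom t 2 (5 * s + r) = (-1) ^ s * t ^ (-(5 * s * (s - 1) + 2 * r * s)) *
      (thetaMom t 2 r - 2 * s * thetaMom t 1 r + s ^ 2 * thetaMom t 0 r) := by
  have h2 := (((hasSum_thetaMom h0 h1 2 r).sub ((hasSum_thetaMom h0 h1 1 r).mul_left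
    (2 * s : ℝ))).add ((hasSum_thetaMom h0 h1 0 r).mul_left ((s : ℝ) ^ 2))).mul_left
      ((-1) ^ s * t ^ (-(5 * s * (s - 1) + 2 * r * s)))
  have h3 := (Equiv.subRight s).hasSum_iff.2 (hasSum_thetaMom h0 h1 2 (5 * s + r))
  refine h3.unique (hasSum_of_eq h2 fun m => ?_)
  simp only [Function.comp, Equiv.subRight_apply, thetaTerm_shift h0]
  push_cast
  ring

theorem thetaMom_reflect (t : ℝ) (i : ℕ) (a : ℤ) :
    thetaMom t i (5 - a) = (-1) ^ i * thetaMom t i a := by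
  simp only [thetaMom]
  rw [← (Equiv.neg ℤ).tsum_eq, ← tsum_mul_left]
  apply tsum_congr
  intro m
  simp only [Equiv.neg_apply, thetaTerm, neg_one_zpow_neg]
  rw [show 5 * -m * (-m - 1) + 2 * (5 - a) * -m = 5 * m * (m - 1) + 2 * a * m by ring]
  push_cast
  rw [neg_pow]
  ring

theorem thetaMom_zero_zero (h0 : 0 < t) : thetaMom t 0 0 = 0 := by
  have h2 := thetaMom_zero_shift h0 1 0
  have h3 := thetaMom_reflect t 0 0
  norm_num at h2 h3
  linarith

theorem thetaMom_two_zero (h0 : 0 < t) (h1 : t < 1 / 8) :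
    thetaMom t 2 0 = thetaMom t 1 0 := by
  have h2 := thetaMom_two_shift h0 h1 1 0
  have h3 := thetaMom_reflect t 2 0
  have h4 := thetaMom_zero_zero h0
  norm_num at h2 h3
  linarith

theorem tsum_ne_zero_of_abs_le (h0 : 0 < t) (h1 : t < 1 / 8) {f : ℤ → ℝ} (hf0 : f 0 = 1)
    (hf : ∀ m, |f m| ≤ t ^ |m|) : ∑' m, f m ≠ 0 := by
  have g : HasSum (fun n : ℕ => t ^ n) (1 - t)⁻¹ :=
    hasSum_geometric_of_lt_one h0.le (by linarith)
  have g2 : HasSum (fun m : ℤ => t ^ |m|) ((1 - t)⁻¹ + t * (1 - t)⁻¹) := by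
    apply HasSum.of_nat_of_neg_add_one
    · simpa using g
    · refine hasSum_of_eq (g.mul_left t) fun n => ?_
      rw [abs_neg, show |(n : ℤ) + 1| = ((n + 1 : ℕ) : ℤ) by
        rw [abs_of_nonneg (by positivity)]; push_cast; rfl]
      rw [zpow_natCast, pow_succ']
  have hs : Summable f := Summable.of_norm_bounded g2.summable hf
  have g3 := g2.sub (hasSum_ite_eq (0 : ℤ) (1 : ℝ))
  have g4 := hs.hasSum.sub (hasSum_ite_eq (0 : ℤ) (1 : ℝ))
  intro h
  rw [h] at g4
  have h5 : |(0 : ℝ) - 1| ≤ (1 - t)⁻¹ + t * (1 - t)⁻¹ - 1 := by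
    rw [← Real.norm_eq_abs, ← g4.tsum_eq]
    refine tsum_of_norm_bounded g3 fun m => ?_
    rcases eq_or_ne m 0 with rfl | hm
    · simp [hf0]
    · simpa [hm] using hf m
  have h6 : (1 - t)⁻¹ < 8 / 7 := by
    rw [inv_lt_comm₀ (by linarith) (by norm_num)]; linarith
  have h7 : 0 < (1 - t)⁻¹ := inv_pos.2 (by linarith)
  norm_num at h5
  nlinarith

theorem thetaMom_zero_ne_zero (h0 : 0 < t) (h1 : t < 1 / 8) {a : ℤ} (ha : a = 1 ∨ a = 2) :
    thetaMom t 0 a ≠ 0 := by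
  apply tsum_ne_zero_of_abs_le h0 h1
  · simp [thetaTerm]
  · intro m
    rw [pow_zero, mul_one, thetaTerm, abs_mul, abs_neg_one_zpow, one_mul,
      abs_of_pos (zpow_pos h0 _)]
    apply zpow_anti_lt_one h0 h1
    have := Int.le_self_sq m
    rcases abs_cases m with ⟨h, h'⟩ | ⟨h, h'⟩ <;> rcases ha with rfl | rfl <;> rw [h] <;> nlinarith

end Theta

section Part

variable {t : ℝ}

theorem pZ_nonneg (z : ℤ) : 0 ≤ pZ z := by
  rcases lt_or_ge z 0 with h | h
  · rw [pZ_of_neg h]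
  · lift z to ℕ using h
    rw [pZ_natCast]
    positivity

theorem pZ_natCast_le (n : ℕ) : pZ n ≤ 2 ^ n := by
  rw [pZ_natCast]
  have h := Fintype.card_le_of_surjective _ (Nat.Partition.ofComposition_surj (n := n))
  rw [composition_card] at h
  exact_mod_cast h.trans (Nat.pow_le_pow_right (by norm_num) (Nat.sub_le n 1))

theorem pZ_mul_pow_le (h0 : 0 < t) (h1 : t < 1 / 8) (e : ℤ) (n : ℕ) :
    (pZ (5 * n + 2 - e) : ℝ) * t ^ (2 * (n : ℤ)) ≤ 2 ^ (2 - e) * (1 / 2) ^ n := by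
  rcases lt_or_ge (5 * (n : ℤ) + 2 - e) 0 with h | h
  · rw [pZ_of_neg h]
    simp
    positivity
  · obtain ⟨m, hm⟩ := Int.eq_ofNat_of_zero_le h
    have h2 : (pZ (5 * n + 2 - e) : ℝ) ≤ 2 ^ m := by
      rw [hm]; exact_mod_cast pZ_natCast_le m
    have h3 : t ^ (2 * (n : ℤ)) ≤ (1 / 64) ^ n := by
      rw [zpow_mul, zpow_natCast]
      have : t ^ (2 : ℤ) ≤ 1 / 64 := by rw [zpow_ofNat]; nlinarith
      gcongr
    calc (pZ (5 * n + 2 - e) : ℝ) * t ^ (2 * (n : ℤ)) ≤ 2 ^ m * (1 / 64) ^ n :=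
          mul_le_mul h2 h3 (zpow_pos h0 _).le (by positivity)
      _ = _ := by
          have e1 : (2 : ℝ) ^ m = 2 ^ (2 - e) * 32 ^ n := by
            rw [← zpow_natCast, show (m : ℤ) = (2 - e) + 5 * n by
              rw [← hm]; ring, zpow_add₀ (by norm_num), zpow_mul,
              zpow_natCast]
            norm_num
          rw [e1, mul_assoc, ← mul_pow]
          norm_num

/-- The generating series `∑ p(5n + 2 - e) t^(2n)`. -/
noncomputable def partSec (t : ℝ) (e : ℤ) : ℝ := ∑' n : ℤ, (pZ (5 * n + 2 - e) : ℝ) * t ^ (2 * n)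

theorem partSec_shift (h0 : 0 < t) (e k : ℤ) :
    partSec t (e + 5 * k) = t ^ (2 * k) * partSec t e := by
  unfold partSec
  rw [← (Equiv.addRight k).tsum_eq, ← tsum_mul_left]
  apply tsum_congr
  intro n
  rw [Equiv.coe_addRight, mul_add 2 n k, zpow_add₀ h0.ne',
    show 5 * (n + k) + 2 - (e + 5 * k) = 5 * n + 2 - e by ring]
  ring

theorem hasSum_partSec (h0 : 0 < t) (h1 : t < 1 / 8) {e : ℤ} (he : -2 ≤ e) :
    HasSum (fun n : ℕ => (pZ (5 * n + 2 - e) : ℝ) * t ^ (2 * (n : ℤ))) (partSec t e) := by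
  have h2 : Summable fun n : ℕ => (pZ (5 * n + 2 - e) : ℝ) * t ^ (2 * (n : ℤ)) := by
    refine Summable.of_nonneg_of_le (fun n => mul_nonneg (by exact_mod_cast pZ_nonneg _)
      (zpow_pos h0 _).le) (fun n => pZ_mul_pow_le h0 h1 e n)
      (Summable.mul_left _ (summable_geometric_of_lt_one (by norm_num) (by norm_num)))
  have h3 : partSec t e = ∑' n : ℕ, (pZ (5 * n + 2 - e) : ℝ) * t ^ (2 * (n : ℤ)) := by
    unfold partSec
    refine (Function.Injective.tsum_eq (f := fun n : ℤ => (pZ (5 * n + 2 - e) : ℝ) * t ^ (2 * n))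
      (Nat.cast_injective (R := ℤ)) ?_).symm
    intro n hn
    by_contra hc
    apply hn
    have : n < 0 := by
      by_contra h
      exact hc ⟨n.toNat, by simp; omega⟩
    simp only
    rw [pZ_of_neg (by omega)]
    simp
  rw [h3]
  exact h2.hasSum

theorem natAbs_le_pent (k : ℤ) : (k.natAbs : ℤ) ≤ pent k := by
  rw [← Int.abs_eq_natAbs]
  have h := two_mul_pent k
  have := Int.le_self_sq k
  have := Int.le_self_sq (-k)
  rcases abs_cases k with ⟨h', h''⟩ | ⟨h', h''⟩ <;> rw [h'] <;> nlinarith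

theorem summable_half_pow_abs : Summable fun k : ℤ => (1 / 2 : ℝ) ^ k.natAbs := by
  have h : Summable fun n : ℕ => (1 / 2 : ℝ) ^ n :=
    summable_geometric_of_lt_one (by norm_num) (by norm_num)
  apply Summable.of_nat_of_neg <;> simpa using h

theorem pent_zero : pent 0 = 0 := by decide

theorem euler_hasSum {n : ℕ} (hn : 0 < n) :
    HasSum (fun k : ℤ => (-1 : ℝ) ^ k * pZ (n - pent k)) 0 := by
  have hz : ∀ k : ℤ, n < k.natAbs → pZ (n - pent k) = 0 := by
    intro k hk
    have := natAbs_le_pent k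
    exact pZ_of_neg (by omega)
  have h2 : Summable fun k : ℤ => (-1 : ℝ) ^ k * pZ (n - pent k) := by
    apply summable_of_ne_finset_zero (s := Finset.Icc (-(n : ℤ)) n)
    intro k hk
    rw [Finset.mem_Icc] at hk
    rw [hz k (by omega)]
    simp
  have h3 := h2.hasSum.nat_add_neg
  have h4 := hasSum_sum_of_ne_finset_zero (L := .unconditional ℕ) (s := Finset.range (n + 2))
    (f := fun k : ℕ => (-1 : ℝ) ^ (k : ℤ) * pZ (n - pent k) +
      (-1) ^ (-(k : ℤ)) * pZ (n - pent (-k))) (by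
      intro k hk
      rw [Finset.mem_range] at hk
      rw [hz k (by omega), hz (-k) (by omega)]
      simp)
  have h5 := h3.unique h4
  have h6 := euler_recurrence (n + 1) n hn (by omega)
  rw [Finset.sum_range_succ'] at h5
  have h7 : ∀ k : ℕ, (-1 : ℝ) ^ ((k + 1 : ℕ) : ℤ) * pZ (n - pent (k + 1 : ℕ)) +
      (-1) ^ (-((k + 1 : ℕ) : ℤ)) * pZ (n - pent (-(k + 1 : ℕ))) =
      -(((-1) ^ k * (pZ (n - pent (k + 1)) + pZ (n - pent (-(k + 1)))) : ℤ) : ℝ) := by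
    intro k
    rw [neg_one_zpow_neg, zpow_natCast, pow_succ]
    push_cast
    ring
  simp only [h7] at h5
  rw [Finset.sum_neg_distrib, ← Int.cast_sum, ← h6] at h5
  simp [pent_zero] at h5
  have h8 : ∑' k : ℤ, (-1 : ℝ) ^ k * pZ (n - pent k) = 0 := by linarith
  rw [← h8]
  exact h2.hasSum

theorem euler_partSec (h0 : 0 < t) (h1 : t < 1 / 8) {e : ℤ} (he : -2 ≤ e) (he2 : e < 2) :
    HasSum (fun k : ℤ => (-1 : ℝ) ^ k * partSec t (e + pent k)) 0 := by
  set f : ℤ × ℕ → ℝ := fun p =>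
    (-1 : ℝ) ^ p.1 * (pZ (5 * p.2 + 2 - (e + pent p.1)) * t ^ (2 * (p.2 : ℤ))) with hf
  have hs : Summable f := by
    have g : Summable fun n : ℕ => (1 / 2 : ℝ) ^ n :=
      summable_geometric_of_lt_one (by norm_num) (by norm_num)
    have s := (Summable.mul_of_nonneg summable_half_pow_abs g (fun _ => by positivity)
      (fun _ => by positivity)).mul_left 16
    refine Summable.of_norm_bounded s fun p => ?_
    rw [hf, norm_mul, Real.norm_eq_abs, abs_neg_one_zpow, one_mul, Real.norm_eq_abs,
      abs_of_nonneg (mul_nonneg (by exact_mod_cast pZ_nonneg _) (zpow_pos h0 _).le)]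
    refine (pZ_mul_pow_le h0 h1 _ _).trans ?_
    rw [← mul_assoc]
    apply mul_le_mul_of_nonneg_right _ (by positivity)
    have := natAbs_le_pent p.1
    calc (2 : ℝ) ^ (2 - (e + pent p.1)) ≤ 2 ^ (4 - (p.1.natAbs : ℤ)) := by
          apply zpow_le_zpow_right₀ (by norm_num)
          omega
      _ = _ := by
        rw [zpow_sub₀ (by norm_num), zpow_natCast, one_div, inv_pow, div_eq_mul_inv]
        norm_num
  have a1 : HasSum (fun k : ℤ => (-1 : ℝ) ^ k * partSec t (e + pent k)) (∑' p, f p) := by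
    refine hs.hasSum.prod_fiberwise fun k => ?_
    have := natAbs_le_pent k
    exact (hasSum_partSec h0 h1 (by omega)).mul_left _
  have s5 : HasSum (fun p : ℕ × ℤ => f p.swap) (∑' p, f p) :=
    (Equiv.prodComm ℕ ℤ).hasSum_iff.2 hs.hasSum
  have a2 : HasSum (fun _ : ℕ => (0 : ℝ)) (∑' p, f p) := by
    refine s5.prod_fiberwise fun n => ?_
    obtain ⟨m, hm⟩ := Int.eq_ofNat_of_zero_le (show 0 ≤ 5 * (n : ℤ) + 2 - e by omega)
    have h6 := (euler_hasSum (n := m) (by omega)).mul_right (t ^ (2 * (n : ℤ)))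
    rw [zero_mul] at h6
    refine hasSum_of_eq h6 fun k => ?_
    simp only [hf, Prod.swap]
    rw [← sub_sub, hm, mul_assoc]
  rw [a2.unique hasSum_zero] at a1
  exact a1

end Part

section Gen

variable {t : ℝ}

theorem hasSum_eta {x : ℝ} (hx0 : 0 ≤ x) (hx : x < 1) (w : ℝ) :
    HasSum (fun s : ℕ => (5 * (s : ℝ) + w) * x ^ s) (eta w x) := by
  have hn : ‖x‖ < 1 := by rwa [Real.norm_eq_abs, abs_of_nonneg hx0]
  have h1 := (hasSum_coe_mul_geometric_of_norm_lt_one hn).mul_left 5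
  have h2 := (hasSum_geometric_of_norm_lt_one hn).mul_left w
  have h3 := h1.add h2
  have hx1 : 1 - x ≠ 0 := by linarith
  have e : 5 * (x / (1 - x) ^ 2) + w * (1 - x)⁻¹ = eta w x := by
    rw [eta]; field_simp; ring
  rw [e] at h3
  exact hasSum_of_eq h3 fun s => by ring

/-- The `n`-th coefficient of the weighted series of sections attached to exponents `e`. -/
def secSum (e : ℕ → ℤ) (w n : ℕ) : ℤ :=
  Finset.sum (Finset.range (5 * n + 3)) fun s : ℕ => (5 * (s : ℤ) + w) *
    Finset.sum (Finset.range (5 * n + 3)) fun k : ℕ =>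
      (-1) ^ k * pZ (5 * (n : ℤ) + 2 - e k - 5 * ((k : ℤ) + 1) * s)

theorem hasSum_sections (h0 : 0 < t) (h1 : t < 1 / 8) (e : ℕ → ℤ) (he : ∀ k : ℕ, (k : ℤ) ≤ e k)
    (w : ℕ) :
    ∃ S : ℝ, HasSum (fun n : ℕ => (secSum e w n : ℝ) * t ^ (2 * (n : ℤ))) S ∧
      HasSum (fun k : ℕ => (-1 : ℝ) ^ k * partSec t (e k) * eta w (t ^ (2 * ((k : ℤ) + 1)))) S := by
  set f : (ℕ × ℕ) × ℕ → ℝ := fun p => (5 * (p.1.2 : ℝ) + w) * ((-1 : ℝ) ^ p.1.1 *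
    (pZ (5 * p.2 + 2 - (e p.1.1 + 5 * ((p.1.1 + 1) * p.1.2))) * t ^ (2 * (p.2 : ℤ)))) with hf
  have hs : Summable f := by
    have g : Summable fun n : ℕ => (1 / 2 : ℝ) ^ n :=
      summable_geometric_of_lt_one (by norm_num) (by norm_num)
    have g2 := (hasSum_eta (x := 1 / 2) (by norm_num) (by norm_num) w).summable
    have s := ((Summable.mul_of_nonneg (Summable.mul_of_nonneg g g2 (fun _ => by positivity)
      (fun _ => by positivity)) g (fun _ => by positivity)
      (fun _ => by positivity)).mul_left 4)
    refine Summable.of_norm_bounded s fun p => ?_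
    obtain ⟨⟨k, s⟩, n⟩ := p
    simp only [hf]
    rw [norm_mul, norm_mul, norm_pow, norm_neg, norm_one, one_pow, one_mul, Real.norm_eq_abs,
      Real.norm_eq_abs, abs_of_nonneg (by positivity : (0 : ℝ) ≤ 5 * s + w),
      abs_of_nonneg (mul_nonneg (by exact_mod_cast pZ_nonneg _) (zpow_pos h0 _).le)]
    have h2 := pZ_mul_pow_le h0 h1 (e k + 5 * ((k + 1) * s)) n
    have h3 : (2 : ℝ) ^ (2 - (e k + 5 * (((k : ℤ) + 1) * s))) ≤
        4 * ((1 / 2) ^ k * (1 / 2) ^ s) := by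
      calc (2 : ℝ) ^ (2 - (e k + 5 * (((k : ℤ) + 1) * s))) ≤ 2 ^ (2 - ((k + s : ℕ) : ℤ)) := by
            apply zpow_le_zpow_right₀ (by norm_num)
            have := he k
            push_cast
            have : (0 : ℤ) ≤ k * s := by positivity
            have : 5 * (((k : ℤ) + 1) * s) = 5 * (k * s) + 5 * s := by ring
            omega
        _ = _ := by
          rw [zpow_sub₀ (by norm_num), zpow_natCast, one_div, inv_pow, div_eq_mul_inv, inv_pow,
            ← mul_inv, ← pow_add]
          norm_num
    calc (5 * (s : ℝ) + w) * (pZ (5 * n + 2 - (e k + 5 * ((k + 1) * s))) * t ^ (2 * (n : ℤ)))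
        ≤ (5 * (s : ℝ) + w) * ((4 * ((1 / 2) ^ k * (1 / 2) ^ s)) * (1 / 2) ^ n) := by
          refine mul_le_mul_of_nonneg_left (h2.trans ?_) (by positivity)
          exact mul_le_mul_of_nonneg_right h3 (by positivity)
      _ = _ := by ring
  have a1 : HasSum (fun q : ℕ × ℕ => (5 * (q.2 : ℝ) + w) * ((-1 : ℝ) ^ q.1 *
      partSec t (e q.1 + 5 * ((q.1 + 1) * q.2)))) (∑' p, f p) := by
    refine hs.hasSum.prod_fiberwise fun q => ?_
    have := he q.1
    have : (0 : ℤ) ≤ ((q.1 : ℤ) + 1) * q.2 := by positivity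
    exact ((hasSum_partSec h0 h1 (by omega)).mul_left _).mul_left _
  refine ⟨∑' p, f p, ?_, ?_⟩
  · have s5 : HasSum (fun p : ℕ × (ℕ × ℕ) => f p.swap) (∑' p, f p) :=
      (Equiv.prodComm ℕ (ℕ × ℕ)).hasSum_iff.2 hs.hasSum
    refine s5.prod_fiberwise fun n => ?_
    have h4 := hasSum_sum_of_ne_finset_zero (L := .unconditional (ℕ × ℕ))
      (s := Finset.range (5 * n + 3) ×ˢ Finset.range (5 * n + 3))
      (f := fun q : ℕ × ℕ => f (Prod.swap (n, q))) (by
        intro q hq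
        have hq2 : 5 * n + 3 ≤ q.1 ∨ 5 * n + 3 ≤ q.2 := by
          by_contra hc
          push Not at hc
          exact hq (Finset.mem_product.2 ⟨Finset.mem_range.2 hc.1, Finset.mem_range.2 hc.2⟩)
        simp only [hf, Prod.swap]
        rw [pZ_of_neg]
        · simp
        · have := he q.1
          have : (0 : ℤ) ≤ q.1 * q.2 := by positivity
          have : 5 * (((q.1 : ℤ) + 1) * q.2) = 5 * (q.1 * q.2) + 5 * q.2 := by ring
          omega)
    convert h4 using 1
    rw [Finset.sum_product_right, secSum]
    push_cast
    rw [Finset.sum_mul]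
    apply Finset.sum_congr rfl
    intro s _
    rw [Finset.mul_sum, Finset.sum_mul]
    apply Finset.sum_congr rfl
    intro k _
    simp only [hf, Prod.swap]
    rw [show (5 * (n : ℤ) + 2 - (e k + 5 * ((k + 1) * s))) = 5 * n + 2 - e k - 5 * (k + 1) * s by
      ring]
    ring
  · refine a1.prod_fiberwise fun k => ?_
    have hx : t ^ (2 * ((k : ℤ) + 1)) < 1 :=
      (zpow_anti_lt_one h0 h1 (show (1 : ℤ) ≤ 2 * ((k : ℤ) + 1) by omega)).trans_lt (by
        simp; linarith)
    refine hasSum_of_eq ((hasSum_eta (zpow_pos h0 _).le hx w).mul_left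
      ((-1 : ℝ) ^ k * partSec t (e k))) fun s => ?_
    simp only
    rw [partSec_shift h0, ← zpow_natCast (t ^ (2 * ((k : ℤ) + 1))), ← zpow_mul, ← mul_assoc 2]
    ring

/-- A power series with vanishing sums near zero has vanishing coefficients. -/
theorem coeff_eq_zero_of_hasSum (u : ℕ → ℝ)
    (h : ∀ t : ℝ, 0 < t → t < 1 / 8 → HasSum (fun n : ℕ => u n * t ^ (2 * (n : ℤ))) 0) (n : ℕ) :
    u n = 0 := by
  induction n using Nat.strong_induction_on with
  | _ n ih =>
    by_contra hne
    have hb := (h (1 / 16) (by norm_num) (by norm_num)).summable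
    obtain ⟨C, hC⟩ : ∃ C, ∀ m, |u m * (1 / 16 : ℝ) ^ (2 * (m : ℤ))| ≤ C := by
      obtain ⟨C, hC⟩ := hb.tendsto_atTop_zero.abs.bddAbove_range
      exact ⟨C, fun m => hC ⟨m, rfl⟩⟩
    have hu : ∀ m, |u m| ≤ C * 256 ^ m := by
      intro m
      have := hC m
      rw [zpow_mul, zpow_natCast, abs_mul,
        abs_of_pos (by positivity : (0 : ℝ) < ((1 / 16) ^ (2 : ℤ)) ^ m)] at this
      have h3 : ((1 / 16 : ℝ) ^ (2 : ℤ)) ^ m * 256 ^ m = 1 := by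
        rw [← mul_pow]; norm_num
      calc |u m| = |u m| * ((1 / 16 : ℝ) ^ (2 : ℤ)) ^ m * 256 ^ m := by
            rw [mul_assoc, h3, mul_one]
        _ ≤ _ := by gcongr
    have hC0 : 0 ≤ C := (abs_nonneg _).trans (hC 0)
    have key : ∀ t : ℝ, 0 < t → t < 1 / 32 → |u n| ≤ t ^ 2 * (C * 256 ^ (n + 1) * 2) := by
      intro t h0 h1
      have hs := (hasSum_nat_add_iff' (n + 1)).2 (h t h0 (by linarith))
      rw [Finset.sum_range_succ, Finset.sum_eq_zero (fun m hm => by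
        rw [ih m (Finset.mem_range.1 hm), zero_mul]), zero_add, zero_sub] at hs
      have hg : HasSum (fun m : ℕ => C * 256 ^ (n + 1) * (t ^ 2) ^ (n + 1) * (1 / 2 : ℝ) ^ m)
          (C * 256 ^ (n + 1) * (t ^ 2) ^ (n + 1) * 2) := hasSum_geometric_two.mul_left _
      have h4 : |-(u n * t ^ (2 * (n : ℤ)))| ≤ C * 256 ^ (n + 1) * (t ^ 2) ^ (n + 1) * 2 := by
        rw [← Real.norm_eq_abs, ← hs.tsum_eq]
        refine tsum_of_norm_bounded hg fun m => ?_
        rw [norm_mul, Real.norm_eq_abs, Real.norm_eq_abs, abs_of_pos (zpow_pos h0 _), zpow_mul,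
          zpow_natCast, zpow_ofNat]
        have h6 : 256 * t ^ 2 ≤ 1 / 2 := by nlinarith
        calc |u (m + (n + 1))| * (t ^ 2) ^ (m + (n + 1))
            ≤ C * 256 ^ (m + (n + 1)) * (t ^ 2) ^ (m + (n + 1)) := by
              gcongr; exact hu _
          _ = C * 256 ^ (n + 1) * (t ^ 2) ^ (n + 1) * (256 * t ^ 2) ^ m := by
              rw [mul_pow, pow_add, pow_add]; ring
          _ ≤ _ := by gcongr
      rw [abs_neg, abs_mul, zpow_mul, zpow_natCast, zpow_ofNat,
          abs_of_pos (by positivity : 0 < (t ^ 2) ^ n)] at h4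
      have h5 : 0 < (t ^ 2) ^ n := by positivity
      rw [pow_succ (t ^ 2)] at h4
      nlinarith
    have hpos : 0 < |u n| := abs_pos.2 hne
    set K := C * 256 ^ (n + 1) * 2 with hK
    have hK0 : 0 ≤ K := by positivity
    set t0 := min (1 / 64) (|u n| / (K + 1)) with ht0
    have h7 : 0 < t0 := by positivity
    have h8 := key t0 h7 ((min_le_left _ _).trans_lt (by norm_num))
    have h9 : t0 * (K + 1) ≤ |u n| := by
      rw [← le_div_iff₀ (by positivity)]; exact min_le_right _ _
    have h10 : t0 ≤ 1 / 64 := min_le_left _ _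
    nlinarith [mul_nonneg h7.le hK0]

end Gen

section Quint

variable {t : ℝ}

theorem summable_quadratic (h0 : 0 < t) (h1 : t < 1 / 8) {α : ℤ} (hα : 1 ≤ α) (β γ : ℤ) :
    Summable fun s : ℤ => t ^ (α * s ^ 2 + β * s + γ) := by
  refine Summable.of_nonneg_of_le (fun m => (zpow_pos h0 _).le) (fun k => ?_)
    ((summable_gauss h0 h1 β.natAbs).mul_left (t ^ γ))
  rw [← zpow_add₀ h0.ne']
  apply zpow_anti_lt_one h0 h1
  have h2 : -(|β| * |k|) ≤ β * k := by rw [← abs_mul]; exact neg_abs_le _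
  have h3 : 1 * k ^ 2 ≤ α * k ^ 2 := mul_le_mul_of_nonneg_right hα (by positivity)
  push_cast
  linarith

theorem summable_signed_norm (h0 : 0 < t) (h1 : t < 1 / 8) {α : ℤ} (hα : 1 ≤ α) (β γ : ℤ) :
    Summable fun s : ℤ => ‖(-1 : ℝ) ^ s * t ^ (α * s ^ 2 + β * s + γ)‖ := by
  refine (summable_quadratic h0 h1 hα β γ).congr fun s => ?_
  rw [norm_mul, Real.norm_eq_abs, abs_neg_one_zpow, one_mul, Real.norm_eq_abs,
    abs_of_pos (zpow_pos h0 _)]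

/-- The alternating series with exponents `15 s ^ 2 + b s`. -/
noncomputable def altGauss (t : ℝ) (b : ℤ) : ℝ := ∑' s : ℤ, (-1 : ℝ) ^ s * t ^ (15 * s ^ 2 + b * s)

theorem summable_altGauss (h0 : 0 < t) (h1 : t < 1 / 8) (b : ℤ) :
    Summable fun s : ℤ => (-1 : ℝ) ^ s * t ^ (15 * s ^ 2 + b * s) := by
  simpa using (summable_signed_norm h0 h1 (show (1 : ℤ) ≤ 15 by norm_num) b 0).of_norm

theorem altGauss_neg (t : ℝ) (b : ℤ) : altGauss t (-b) = altGauss t b := by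
  unfold altGauss
  rw [← (Equiv.neg ℤ).tsum_eq]
  apply tsum_congr
  intro s
  rw [Equiv.neg_apply, neg_one_zpow_neg, neg_sq, neg_mul_neg]

theorem altGauss_shift (h0 : 0 < t) (b : ℤ) :
    altGauss t (b + 30) = -t ^ (-(15 + b)) * altGauss t b := by
  unfold altGauss
  rw [← (Equiv.subRight 1).tsum_eq, ← tsum_mul_left]
  apply tsum_congr
  intro s
  rw [Equiv.subRight_apply, zpow_sub₀ (by norm_num), show 15 * (s - 1) ^ 2 + (b + 30) * (s - 1) =
    -(15 + b) + (15 * s ^ 2 + b * s) by ring, zpow_add₀ h0.ne']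
  norm_num
  ring

theorem altGauss_five_ne_zero (h0 : 0 < t) (h1 : t < 1 / 8) : altGauss t 5 ≠ 0 := by
  apply tsum_ne_zero_of_abs_le h0 h1
  · simp
  · intro m
    rw [abs_mul, abs_neg_one_zpow, one_mul, abs_of_pos (zpow_pos h0 _)]
    apply zpow_anti_lt_one h0 h1
    have := Int.le_self_sq m
    have := Int.le_self_sq (-m)
    rcases abs_cases m with ⟨h, h'⟩ | ⟨h, h'⟩ <;> rw [h] <;> nlinarith

/-- Splitting a series over the integers by residue classes. -/
theorem hasSum_residues {f : ℤ → ℝ} {S : ℝ} (hf : HasSum f S) (j : ℕ) [NeZero j] :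
    S = ∑ r : Fin j, ∑' s : ℤ, f (j * s + (r : ℕ)) := by
  have h2 := (Int.divModEquiv j).symm.hasSum_iff.2 hf
  have h3 := (Equiv.prodComm (Fin j) ℤ).hasSum_iff.2 h2
  have h4 : ∀ r : Fin j, HasSum (fun s : ℤ => ((f ∘ (Int.divModEquiv j).symm) ∘
      Equiv.prodComm (Fin j) ℤ) (r, s)) (∑' s : ℤ, f (j * s + (r : ℕ))) := by
    intro r
    have h5 : Summable fun s : ℤ => f (j * s + (r : ℕ)) := by
      refine hf.summable.comp_injective (i := fun s : ℤ => (j : ℤ) * s + (r : ℕ)) ?_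
      intro a b hab
      have : (j : ℤ) ≠ 0 := by exact_mod_cast NeZero.ne j
      exact mul_left_cancel₀ this (by simpa using hab)
    refine hasSum_of_eq h5.hasSum fun s => ?_
    simp [mul_comm]
  exact h3.prod_fiberwise h4 |>.unique (hasSum_fintype _)

theorem even_odd_shift (g : ℤ → ℝ) (b : ℤ) :
    ∑' n, g (2 * n - b) - ∑' n, g (2 * n + b - 1) =
      (-1) ^ b * (∑' n, g (2 * n) - ∑' n, g (2 * n + 1)) := by
  rcases Int.even_or_odd' b with ⟨q, rfl | rfl⟩
  · have e1 : ∑' n, g (2 * n - 2 * q) = ∑' n, g (2 * n) := by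
      rw [← (Equiv.subRight q).tsum_eq fun n => g (2 * n)]
      exact tsum_congr fun n => by rw [Equiv.subRight_apply]; congr 1; ring
    have e2 : ∑' n, g (2 * n + 2 * q - 1) = ∑' n, g (2 * n + 1) := by
      rw [← (Equiv.addRight (q - 1)).tsum_eq fun n => g (2 * n + 1)]
      exact tsum_congr fun n => by rw [Equiv.coe_addRight]; congr 1; ring
    rw [e1, e2, zpow_mul]
    norm_num
  · have e1 : ∑' n, g (2 * n - (2 * q + 1)) = ∑' n, g (2 * n + 1) := by
      rw [← (Equiv.subRight (q + 1)).tsum_eq fun n => g (2 * n + 1)]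
      exact tsum_congr fun n => by rw [Equiv.subRight_apply]; congr 1; ring
    have e2 : ∑' n, g (2 * n + (2 * q + 1) - 1) = ∑' n, g (2 * n) := by
      rw [← (Equiv.addRight q).tsum_eq fun n => g (2 * n)]
      exact tsum_congr fun n => by rw [Equiv.coe_addRight]; congr 1; ring
    rw [e1, e2, zpow_add₀ (by norm_num), zpow_mul]
    norm_num

theorem quintuple_even (h0 : 0 < t) (h1 : t < 1 / 8) (b : ℤ) :
    ∑' n : ℤ, t ^ (60 * n ^ 2 + 10 * n - 30 * n * (2 * b)) -
      ∑' n : ℤ, t ^ (60 * n ^ 2 - 50 * n + 30 * n * (2 * b) - 10 * (2 * b) + 10) =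
      (-1) ^ b * t ^ (5 * b - 15 * b ^ 2) * altGauss t 5 := by
  have h2 := hasSum_residues (summable_altGauss h0 h1 5).hasSum 2
  rw [Fin.sum_univ_two] at h2
  have h3 := even_odd_shift (fun n => t ^ (15 * n ^ 2 + 5 * n)) b
  have h4 : altGauss t 5 = ∑' n : ℤ, t ^ (15 * (2 * n) ^ 2 + 5 * (2 * n)) -
      ∑' n : ℤ, t ^ (15 * (2 * n + 1) ^ 2 + 5 * (2 * n + 1)) := by
    rw [altGauss, h2, sub_eq_add_neg, ← tsum_neg]
    congr 1 <;> apply tsum_congr <;> intro n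
    · simp [zpow_mul]
    · simp [zpow_mul, zpow_add₀]
  rw [h4, mul_right_comm, ← h3, sub_mul, ← tsum_mul_right, ← tsum_mul_right]
  congr 1 <;> apply tsum_congr <;> intro n <;> rw [← zpow_add₀ h0.ne'] <;> congr 1 <;> ring

theorem quintuple_odd (t : ℝ) (b : ℤ) :
    ∑' n : ℤ, t ^ (60 * n ^ 2 + 10 * n - 30 * n * (2 * b + 1)) -
      ∑' n : ℤ, t ^ (60 * n ^ 2 - 50 * n + 30 * n * (2 * b + 1) - 10 * (2 * b + 1) + 10) = 0 := by
  rw [← (Equiv.addRight b).tsum_eq fun n : ℤ => t ^ (60 * n ^ 2 + 10 * n - 30 * n * (2 * b + 1)),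
    sub_eq_zero]
  apply tsum_congr
  intro n
  rw [Equiv.coe_addRight]
  congr 1
  ring

/-- The quintuple product identity in series form. -/
theorem quintuple (h0 : 0 < t) (h1 : t < 1 / 8) (a : ℤ) :
    (altGauss t (6 * a - 5) + t ^ (2 * a) * altGauss t (-6 * a - 5)) * thetaMom t 0 a =
      altGauss t 5 * thetaMom t 0 (2 * a) := by
  have n1 : Summable fun s : ℤ => ‖(-1 : ℝ) ^ s * t ^ (15 * s ^ 2 + (6 * a - 5) * s)‖ := by
    simpa using summable_signed_norm h0 h1 (show (1 : ℤ) ≤ 15 by norm_num) (6 * a - 5) 0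
  have n2 : Summable fun s : ℤ => ‖(-1 : ℝ) ^ s * t ^ (15 * s ^ 2 + (-6 * a - 5) * s)‖ := by
    simpa using summable_signed_norm h0 h1 (show (1 : ℤ) ≤ 15 by norm_num) (-6 * a - 5) 0
  have n3 : Summable fun m : ℤ => ‖thetaTerm t a m‖ := by
    simpa using (thetaTerm_adm h0 h1 a).summable_moment h0 h1 0
  have s1 : HasSum (fun s : ℤ => (-1 : ℝ) ^ s * t ^ (15 * s ^ 2 + (6 * a - 5) * s))
    (altGauss t (6 * a - 5)) := n1.of_norm.hasSum
  have s2 : HasSum (fun s : ℤ => (-1 : ℝ) ^ s * t ^ (15 * s ^ 2 + (-6 * a - 5) * s))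
    (altGauss t (-6 * a - 5)) := n2.of_norm.hasSum
  have s3 : HasSum (thetaTerm t a) (thetaMom t 0 a) := by
    simpa using hasSum_thetaMom h0 h1 0 a
  have p1 := hasSum_mul_of_norm s1 s3 n1 n3
  have p2 := (hasSum_mul_of_norm s2 s3 n2 n3).mul_left (t ^ (2 * a))
  have q1 := (Equiv.prodShear (Equiv.refl ℤ) fun n => Equiv.subRight (3 * n)).hasSum_iff.2 p1
  have q2 := (Equiv.prodShear (Equiv.refl ℤ) fun n => Equiv.addRight (3 * n - 1)).hasSum_iff.2 p2
  have q := (Equiv.prodComm ℤ ℤ).hasSum_iff.2 (q1.add q2)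
  have r := q.prod_fiberwise (g := fun N => (-1) ^ N * t ^ (5 * N * (N - 1) + 2 * a * N) *
      (∑' n : ℤ, t ^ (60 * n ^ 2 + 10 * n - 30 * n * N) -
      ∑' n : ℤ, t ^ (60 * n ^ 2 - 50 * n + 30 * n * N - 10 * N + 10))) fun N => by
    have w1 : Summable fun n : ℤ => t ^ (60 * n ^ 2 + 10 * n - 30 * n * N) := by
      refine (summable_quadratic h0 h1 (show (1 : ℤ) ≤ 60 by norm_num) (10 - 30 * N) 0).congr
        fun n => ?_
      congr 1; ring
    have w2 : Summable fun n : ℤ => t ^ (60 * n ^ 2 - 50 * n + 30 * n * N - 10 * N + 10) := by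
      refine (summable_quadratic h0 h1 (show (1 : ℤ) ≤ 60 by norm_num) (-50 + 30 * N)
        (-10 * N + 10)).congr fun n => ?_
      congr 1; ring
    refine hasSum_of_eq ((w1.hasSum.sub w2.hasSum).mul_left
      ((-1) ^ N * t ^ (5 * N * (N - 1) + 2 * a * N))) fun n => ?_
    simp only [Function.comp, Equiv.prodComm_apply, Prod.swap, Equiv.prodShear_apply,
      Equiv.refl_apply, Equiv.subRight_apply, Equiv.coe_addRight, thetaTerm]
    have e1 : (-1 : ℝ) ^ n * (-1) ^ (N - 3 * n) = (-1) ^ N := by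
      rw [← zpow_add₀ (by norm_num), show n + (N - 3 * n) = N + 2 * -n by ring,
        zpow_add₀ (by norm_num), zpow_mul]
      norm_num
    have e2 : (-1 : ℝ) ^ n * (-1) ^ (N + (3 * n - 1)) = -(-1) ^ N := by
      rw [← zpow_add₀ (by norm_num), show n + (N + (3 * n - 1)) = N + 2 * (2 * n - 1) + 1 by ring,
        zpow_add₀ (by norm_num), zpow_add₀ (by norm_num), zpow_mul]
      norm_num
    have e3 : t ^ (15 * n ^ 2 + (6 * a - 5) * n) *
        t ^ (5 * (N - 3 * n) * (N - 3 * n - 1) + 2 * a * (N - 3 * n)) =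
        t ^ (5 * N * (N - 1) + 2 * a * N) * t ^ (60 * n ^ 2 + 10 * n - 30 * n * N) := by
      rw [← zpow_add₀ h0.ne', ← zpow_add₀ h0.ne']
      congr 1; ring
    have e4 : t ^ (2 * a) * (t ^ (15 * n ^ 2 + (-6 * a - 5) * n) *
        t ^ (5 * (N + (3 * n - 1)) * (N + (3 * n - 1) - 1) + 2 * a * (N + (3 * n - 1)))) =
        t ^ (5 * N * (N - 1) + 2 * a * N) *
          t ^ (60 * n ^ 2 - 50 * n + 30 * n * N - 10 * N + 10) := by
      rw [← zpow_add₀ h0.ne', ← zpow_add₀ h0.ne', ← zpow_add₀ h0.ne']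
      congr 1; ring
    rw [mul_mul_mul_comm, e1, mul_mul_mul_comm, e2, e3, mul_left_comm (t ^ (2 * a)), e4]
    ring
  have u : HasSum (fun b : ℤ => altGauss t 5 * thetaTerm t (2 * a) b)
      (altGauss t 5 * thetaMom t 0 (2 * a)) := by
    simpa using (hasSum_thetaMom h0 h1 0 (2 * a)).mul_left (altGauss t 5)
  have inj : Function.Injective fun b : ℤ => 2 * b := fun x y h => by simpa using h
  have r' := (inj.hasSum_iff (fun N hN => by
    rcases Int.even_or_odd' N with ⟨b, rfl | rfl⟩
    · exact absurd ⟨b, rfl⟩ hN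
    · rw [quintuple_odd, mul_zero])).2 r
  rw [add_mul, mul_assoc]
  refine r'.unique (hasSum_of_eq u fun b => ?_)
  simp only [Function.comp]
  rw [quintuple_even h0 h1, thetaTerm]
  have e3 : (-1 : ℝ) ^ (2 * b) = 1 := by rw [zpow_mul]; norm_num
  rw [e3, one_mul, ← mul_assoc, mul_left_comm _ ((-1 : ℝ) ^ b), ← zpow_add₀ h0.ne', mul_comm]
  congr 3
  ring

end Quint

section PRel

variable {t : ℝ}

theorem partSec_pent_residue (h0 : 0 < t) (e s r : ℤ) :
    (-1 : ℝ) ^ (5 * s + r) * partSec t (e + pent (5 * s + r)) =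
      (-1) ^ r * partSec t (e + pent r) * ((-1) ^ s * t ^ (15 * s ^ 2 + (6 * r - 1) * s)) := by
  have e1 : (-1 : ℝ) ^ (5 * s + r) = (-1) ^ r * (-1) ^ s := by
    rw [← zpow_add₀ (by norm_num), show 5 * s + r = r + s + 2 * (2 * s) by ring,
      zpow_add₀ (by norm_num) (r + s), zpow_mul]
    norm_num
  obtain ⟨K, hK⟩ : (2 : ℤ) ∣ 15 * s ^ 2 + (6 * r - 1) * s := by
    obtain ⟨m, hm⟩ := Int.even_mul_succ_self s
    exact ⟨7 * s ^ 2 + 3 * r * s - s + m, by linear_combination hm⟩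
  have e2 : pent (5 * s + r) = pent r + 5 * K := by
    have h2 := two_mul_pent (5 * s + r)
    have h3 := two_mul_pent r
    have : 2 * pent (5 * s + r) = 2 * (pent r + 5 * K) := by
      linear_combination h2 - h3 + 5 * hK
    linarith
  rw [e1, e2, ← add_assoc, partSec_shift h0, hK]
  ring

theorem partSec_rel (h0 : 0 < t) (h1 : t < 1 / 8) {e : ℤ} (he : -2 ≤ e) (he2 : e < 2) :
    partSec t e * thetaMom t 0 2 ^ 2 =
      partSec t (e + 1) * (thetaMom t 0 1 * thetaMom t 0 2) +
        partSec t (e + 2) * thetaMom t 0 1 ^ 2 := by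
  have h := hasSum_residues (euler_partSec h0 h1 he he2) 5
  have key : ∀ r : ℤ, ∑' s : ℤ, (-1 : ℝ) ^ (5 * s + r) * partSec t (e + pent (5 * s + r)) =
      (-1) ^ r * partSec t (e + pent r) * altGauss t (6 * r - 1) := by
    intro r
    rw [altGauss, ← tsum_mul_left]
    exact tsum_congr fun s => partSec_pent_residue h0 e s r
  simp only [Nat.cast_ofNat, key, Fin.sum_univ_five] at h
  have p0 : pent 0 = 0 := by decide
  have p1 : pent 1 = 1 := by decide
  have p2 : pent 2 = 5 * 1 := by decide
  have p3 : pent 3 = 2 + 5 * 2 := by decide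
  have p4 : pent 4 = 2 + 5 * 4 := by decide
  have g4 := altGauss_shift h0 (-7)
  have q1 := quintuple h0 h1 1
  have q2 := quintuple h0 h1 2
  have g0 := altGauss_neg t 1
  have g1 := altGauss_neg t 11
  have g2 := altGauss_neg t 17
  have g3 := altGauss_neg t 7
  have hr := thetaMom_reflect t 0 1
  norm_num [p0, p1, p2, p3, p4, ← add_assoc] at h q1 q2 hr g4
  have s1 : partSec t (e + 5) = t ^ 2 * partSec t e := by
    simpa using partSec_shift h0 e 1
  have s2 : partSec t (e + 12) = t ^ 4 * partSec t (e + 2) := by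
    have := partSec_shift h0 (e + 2) 2
    norm_num [add_assoc] at this
    exact this
  have s4 : partSec t (e + 22) = t ^ 8 * partSec t (e + 2) := by
    have := partSec_shift h0 (e + 2) 4
    norm_num [add_assoc] at this
    exact this
  rw [hr] at q2
  rw [s1, s2, s4, g4, g0, g3] at h
  rw [g1] at q1
  rw [g2] at q2
  have h8 : t ^ 8 * (t ^ 8)⁻¹ = 1 := mul_inv_cancel₀ (by positivity)
  refine mul_left_cancel₀ (altGauss_five_ne_zero h0 h1) ?_
  linear_combination (-thetaMom t 0 1 * thetaMom t 0 2) * h -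
    partSec t e * thetaMom t 0 2 * q1 + partSec t (e + 2) * thetaMom t 0 1 * q2 +
    thetaMom t 0 1 * thetaMom t 0 2 * partSec t (e + 2) * altGauss t 7 * h8

end PRel

section Interp

variable {t : ℝ}

theorem forall_of_residues {p : ℤ → Prop} (h : ∀ m r, p r → p (5 * m + r)) (h0 : p 0) (h1 : p 1)
    (h2 : p 2) (h3 : p 3) (h4 : p 4) (k : ℤ) : p k := by
  rw [← Int.mul_ediv_add_emod k 5]
  apply h
  have := Int.emod_nonneg k (show (5 : ℤ) ≠ 0 by norm_num)
  have := Int.emod_lt_of_pos k (show (0 : ℤ) < 5 by norm_num)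
  interval_cases k % 5 <;> assumption

/-- The product of two shifted theta series. -/
noncomputable def thetaPair (t : ℝ) (a b k : ℤ) : ℝ := thetaMom t 0 (a - k) * thetaMom t 0 (b - k)

theorem thetaPair_period (h0 : 0 < t) {a b σ : ℤ} (hσ : a + b = σ) (m r : ℤ) :
    thetaPair t a b (5 * m + r) =
      t ^ (-10 * m ^ 2 - 10 * m + 2 * σ * m - 4 * r * m) * thetaPair t a b r := by
  subst hσ
  rw [thetaPair, thetaPair, show a - (5 * m + r) = 5 * -m + (a - r) by ring,
    show b - (5 * m + r) = 5 * -m + (b - r) by ring, thetaMom_zero_shift h0, thetaMom_zero_shift h0,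
    show ∀ u v w x y : ℝ, u * v * w * (u * x * y) = (u * u) * (v * x) * (w * y) by intros; ring,
    neg_one_zpow_mul_self, ← zpow_add₀ h0.ne', one_mul]
  congr 2
  ring

theorem thetaMom_zero_values (h0 : 0 < t) :
    thetaMom t 0 3 = thetaMom t 0 2 ∧ thetaMom t 0 4 = thetaMom t 0 1 ∧ thetaMom t 0 5 = 0 ∧
    thetaMom t 0 6 = -(t ^ 2)⁻¹ * thetaMom t 0 1 ∧ thetaMom t 0 (-1) = -(t ^ 2)⁻¹ * thetaMom t 0 1 ∧
    thetaMom t 0 (-2) = -(t ^ 4)⁻¹ * thetaMom t 0 2 ∧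
    thetaMom t 0 (-3) = -(t ^ 6)⁻¹ * thetaMom t 0 2 ∧
    thetaMom t 0 (-4) = -(t ^ 8)⁻¹ * thetaMom t 0 1 ∧ thetaMom t 0 (-5) = 0 := by
  have r1 := thetaMom_reflect t 0 1
  have r2 := thetaMom_reflect t 0 2
  have s0 := thetaMom_zero_shift h0 1 0
  have s1 := thetaMom_zero_shift h0 1 1
  have s2 := thetaMom_zero_shift h0 (-1) 4
  have s3 := thetaMom_zero_shift h0 (-1) 3
  have s4 := thetaMom_zero_shift h0 (-1) 2
  have s5 := thetaMom_zero_shift h0 (-1) 1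
  have s6 := thetaMom_zero_shift h0 (-1) 0
  norm_num [thetaMom_zero_zero h0] at r1 r2 s0 s1 s2 s3 s4 s5 s6
  rw [r1] at s2
  rw [r2] at s3
  refine ⟨r2, r1, s0, ?_, ?_, ?_, ?_, ?_, s6⟩ <;>
    simp only [s1, s2, s3, s4, s5, neg_mul]

theorem partSec_values (h0 : 0 < t) :
    partSec t 3 = t ^ 2 * partSec t (-2) ∧
    partSec t 4 = t ^ 2 * partSec t (-1) ∧
    partSec t 5 = t ^ 2 * partSec t 0 ∧
    partSec t 6 = t ^ 2 * partSec t 1 ∧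
    partSec t 9 = t ^ 4 * partSec t (-1) ∧
    partSec t 10 = t ^ 4 * partSec t 0 ∧
    partSec t 11 = t ^ 4 * partSec t 1 ∧
    partSec t 14 = t ^ 6 * partSec t (-1) ∧
    partSec t 18 = t ^ 8 * partSec t (-2) ∧
    partSec t 21 = t ^ 8 * partSec t 1 ∧
    partSec t 30 = t ^ 12 * partSec t 0 ∧
    partSec t 34 = t ^ 14 * partSec t (-1) := by
  have h := partSec_shift h0
  refine ⟨?_, ?_, ?_, ?_, ?_, ?_, ?_, ?_, ?_, ?_, ?_, ?_⟩
  · have := h (-2) 1; norm_num at this; exact_mod_cast this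
  · have := h (-1) 1; norm_num at this; exact_mod_cast this
  · have := h 0 1; norm_num at this; exact_mod_cast this
  · have := h 1 1; norm_num at this; exact_mod_cast this
  · have := h (-1) 2; norm_num at this; exact_mod_cast this
  · have := h 0 2; norm_num at this; exact_mod_cast this
  · have := h 1 2; norm_num at this; exact_mod_cast this
  · have := h (-1) 3; norm_num at this; exact_mod_cast this
  · have := h (-2) 4; norm_num at this; exact_mod_cast this
  · have := h 1 4; norm_num at this; exact_mod_cast this
  · have := h 0 6; norm_num at this; exact_mod_cast this
  · have := h (-1) 7; norm_num at this; exact_mod_cast this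

theorem partSec_pent_period (h0 : 0 < t) (c m r : ℤ) :
    partSec t (pent (5 * m + r) + c * (5 * m + r)) =
      t ^ (15 * m ^ 2 + (6 * r - 1) * m + 2 * c * m) * partSec t (pent r + c * r) := by
  obtain ⟨K, hK⟩ : (2 : ℤ) ∣ 15 * m ^ 2 + (6 * r - 1) * m := by
    obtain ⟨q, hq⟩ := Int.even_mul_succ_self m
    exact ⟨7 * m ^ 2 + 3 * r * m - m + q, by linear_combination hq⟩
  have e : pent (5 * m + r) + c * (5 * m + r) = pent r + c * r + 5 * (K + c * m) := by
    have h2 := two_mul_pent (5 * m + r)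
    have h3 := two_mul_pent r
    have : 2 * (pent (5 * m + r) + c * (5 * m + r)) = 2 * (pent r + c * r + 5 * (K + c * m)) := by
      linear_combination h2 - h3 + 5 * hK
    linarith
  rw [e, partSec_shift h0, hK]
  congr 2
  ring

/-- The integer `k (k - 1) / 2`. -/
def tz (k : ℤ) : ℤ := k * (k - 1) / 2

theorem two_mul_tz (k : ℤ) : 2 * tz k = k * (k - 1) :=
  Int.mul_ediv_cancel' (Int.even_mul_pred_self k).two_dvd

theorem partSec_tz_period (h0 : 0 < t) (c m r : ℤ) :
    partSec t (tz (5 * m + r) + c * (5 * m + r)) =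
      t ^ (5 * m ^ 2 + (2 * r - 1) * m + 2 * c * m) * partSec t (tz r + c * r) := by
  obtain ⟨K, hK⟩ : (2 : ℤ) ∣ 5 * m ^ 2 + (2 * r - 1) * m := by
    obtain ⟨q, hq⟩ := Int.even_mul_succ_self m
    exact ⟨2 * m ^ 2 + r * m - m + q, by linear_combination hq⟩
  have e : tz (5 * m + r) + c * (5 * m + r) = tz r + c * r + 5 * (K + c * m) := by
    have h2 := two_mul_tz (5 * m + r)
    have h3 := two_mul_tz r
    have : 2 * (tz (5 * m + r) + c * (5 * m + r)) = 2 * (tz r + c * r + 5 * (K + c * m)) := by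
      linear_combination h2 - h3 + 5 * hK
    linarith
  rw [e, partSec_shift h0, hK]
  congr 2
  ring

/-- The product of four shifted theta series. -/
noncomputable def thetaQuad (t : ℝ) (a b c d k : ℤ) : ℝ := thetaPair t a b k * thetaPair t c d k

theorem thetaQuad_period (h0 : 0 < t) {a b c d σ : ℤ} (hσ : a + b + (c + d) = σ) (m r : ℤ) :
    thetaQuad t a b c d (5 * m + r) =
      t ^ (-20 * m ^ 2 - 20 * m + 2 * σ * m - 8 * r * m) * thetaQuad t a b c d r := by
  subst hσ
  rw [thetaQuad, thetaQuad, thetaPair_period h0 rfl, thetaPair_period h0 rfl, mul_mul_mul_comm,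
    ← zpow_add₀ h0.ne']
  congr 2
  ring

theorem interp_rank_two (h0 : 0 < t) (h1 : t < 1 / 8) (k : ℤ) :
    t ^ (k ^ 2 + k) * (partSec t 0 / (thetaMom t 0 1 * thetaMom t 0 2) * thetaPair t 1 3 k -
        t ^ 2 * partSec t (-2) / (thetaMom t 0 1 * thetaMom t 0 2) * thetaPair t 0 4 k) =
      partSec t (pent k + 2 * k) := by
  have hb1 := thetaMom_zero_ne_zero h0 h1 (a := 1) (by norm_num)
  have hb2 := thetaMom_zero_ne_zero h0 h1 (a := 2) (by norm_num)
  have rel := partSec_rel h0 h1 (e := -2) (by norm_num) (by norm_num)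
  norm_num at rel
  obtain ⟨v3, v4, v5, v6, v7, v8, v9, v10, v11⟩ := thetaMom_zero_values h0
  have v0 := thetaMom_zero_zero h0
  obtain ⟨w3, w4, w5, w6, w9, w10, w11, w14, w18, w21, w30, w34⟩ := partSec_values h0
  revert k
  apply forall_of_residues
  · intro m r h
    have hm : t ^ (25 * m ^ 2 + 10 * m * r + 5 * m) * t ^ (-10 * m ^ 2 - 10 * m + 2 * 4 * m -
        4 * r * m) =
        t ^ (15 * m ^ 2 + (6 * r - 1) * m + 2 * 2 * m) := by
      rw [← zpow_add₀ h0.ne']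
      congr 1
      ring
    rw [thetaPair_period h0 (show (1 + 3 : ℤ) = 4 by norm_num), thetaPair_period h0 (show (0 +
        4 : ℤ) = 4 by norm_num), partSec_pent_period h0, ← h, ← hm,
      show (5 * m + r) ^ 2 + (5 * m + r) = r ^ 2 + r + (25 * m ^ 2 + 10 * m * r + 5 * m) by ring,
      zpow_add₀ h0.ne']
    ring
  all_goals norm_num [thetaPair, v0, v3, v4, v5, v6, v7, v8, v9, v10, v11,
    pent, w3, w4, w5, w6, w9, w10, w11, w14, w18, w21, w30, w34]
  all_goals try field_simp
  all_goals try norm_num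
  all_goals try linear_combination rel

theorem interp_rank_three (h0 : 0 < t) (h1 : t < 1 / 8) (k : ℤ) :
    t ^ (k ^ 2 + k) * (partSec t (-1) / (thetaMom t 0 1 * thetaMom t 0 2) * thetaPair t 2 3 k -
        partSec t 1 / (thetaMom t 0 1 * thetaMom t 0 2) * thetaPair t 1 4 k) =
      partSec t (pent k + 3 * k) := by
  have hb1 := thetaMom_zero_ne_zero h0 h1 (a := 1) (by norm_num)
  have hb2 := thetaMom_zero_ne_zero h0 h1 (a := 2) (by norm_num)
  have rel := partSec_rel h0 h1 (e := -1) (by norm_num) (by norm_num)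
  norm_num at rel
  obtain ⟨v3, v4, v5, v6, v7, v8, v9, v10, v11⟩ := thetaMom_zero_values h0
  have v0 := thetaMom_zero_zero h0
  obtain ⟨w3, w4, w5, w6, w9, w10, w11, w14, w18, w21, w30, w34⟩ := partSec_values h0
  revert k
  apply forall_of_residues
  · intro m r h
    have hm : t ^ (25 * m ^ 2 + 10 * m * r + 5 * m) * t ^ (-10 * m ^ 2 - 10 * m + 2 * 5 * m -
        4 * r * m) =
        t ^ (15 * m ^ 2 + (6 * r - 1) * m + 2 * 3 * m) := by
      rw [← zpow_add₀ h0.ne']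
      congr 1
      ring
    rw [thetaPair_period h0 (show (2 + 3 : ℤ) = 5 by norm_num), thetaPair_period h0 (show (1 +
        4 : ℤ) = 5 by norm_num), partSec_pent_period h0, ← h, ← hm,
      show (5 * m + r) ^ 2 + (5 * m + r) = r ^ 2 + r + (25 * m ^ 2 + 10 * m * r + 5 * m) by ring,
      zpow_add₀ h0.ne']
    ring
  all_goals norm_num [thetaPair, v0, v3, v4, v5, v6, v7, v8, v9, v10, v11,
    pent, w3, w4, w5, w6, w9, w10, w11, w14, w18, w21, w30, w34]
  all_goals try field_simp
  all_goals try norm_num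
  all_goals try linear_combination rel

theorem interp_crank_one (h0 : 0 < t) (h1 : t < 1 / 8) (k : ℤ) :
    t ^ (k ^ 2 + k) * (partSec t 0 / (thetaMom t 0 1 * thetaMom t 0 2 ^ 3) * thetaQuad t 1 3 2 2 k
        - partSec t 1 / (thetaMom t 0 1 ^ 3 * thetaMom t 0 2) * thetaQuad t 0 4 2 2 k +
        t ^ 2 * partSec t (-2) / (thetaMom t 0 1 ^ 2 * thetaMom t 0 2 ^ 2) * thetaQuad t 0 4 1 3 k)
        =
      partSec t (tz k + 1 * k) := by
  have hb1 := thetaMom_zero_ne_zero h0 h1 (a := 1) (by norm_num)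
  have hb2 := thetaMom_zero_ne_zero h0 h1 (a := 2) (by norm_num)
  obtain ⟨v3, v4, v5, v6, v7, v8, v9, v10, v11⟩ := thetaMom_zero_values h0
  have v0 := thetaMom_zero_zero h0
  obtain ⟨w3, w4, w5, w6, w9, w10, w11, w14, w18, w21, w30, w34⟩ := partSec_values h0
  revert k
  apply forall_of_residues
  · intro m r h
    have hm : t ^ (25 * m ^ 2 + 10 * m * r + 5 * m) * t ^ (-20 * m ^ 2 - 20 * m + 2 * 8 * m -
        8 * r * m) =
        t ^ (5 * m ^ 2 + (2 * r - 1) * m + 2 * 1 * m) := by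
      rw [← zpow_add₀ h0.ne']
      congr 1
      ring
    rw [thetaQuad_period h0 (show (1 + 3 + (2 + 2) : ℤ) = 8 by norm_num),
        thetaQuad_period h0 (show (0 + 4 + (2 + 2) : ℤ) = 8 by norm_num),
        thetaQuad_period h0 (show (0 + 4 + (1 + 3) : ℤ) = 8 by norm_num), partSec_tz_period h0,
        ← h, ← hm,
      show (5 * m + r) ^ 2 + (5 * m + r) = r ^ 2 + r + (25 * m ^ 2 + 10 * m * r + 5 * m) by ring,
      zpow_add₀ h0.ne']
    ring
  all_goals norm_num [thetaQuad, thetaPair, v0, v3, v4, v5, v6, v7, v8, v9, v10, v11,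
    tz, w3, w4, w5, w6, w9, w10, w11, w14, w18, w21, w30, w34]
  all_goals try field_simp

theorem interp_crank_two (h0 : 0 < t) (h1 : t < 1 / 8) (k : ℤ) :
    t ^ (k ^ 2 + k) * (partSec t 0 / (thetaMom t 0 1 ^ 3 * thetaMom t 0 2) * thetaQuad t 1 4 1 3 k
        - partSec t 2 / (thetaMom t 0 1 ^ 2 * thetaMom t 0 2 ^ 2) * thetaQuad t 2 3 0 4 k -
        t ^ 4 * partSec t (-1) / (thetaMom t 0 1 * thetaMom t 0 2 ^ 3) * thetaQuad t 0 6 1 2 k) =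
      partSec t (tz k + 2 * k) := by
  have hb1 := thetaMom_zero_ne_zero h0 h1 (a := 1) (by norm_num)
  have hb2 := thetaMom_zero_ne_zero h0 h1 (a := 2) (by norm_num)
  obtain ⟨v3, v4, v5, v6, v7, v8, v9, v10, v11⟩ := thetaMom_zero_values h0
  have v0 := thetaMom_zero_zero h0
  obtain ⟨w3, w4, w5, w6, w9, w10, w11, w14, w18, w21, w30, w34⟩ := partSec_values h0
  revert k
  apply forall_of_residues
  · intro m r h
    have hm : t ^ (25 * m ^ 2 + 10 * m * r + 5 * m) * t ^ (-20 * m ^ 2 - 20 * m + 2 * 9 * m -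
        8 * r * m) =
        t ^ (5 * m ^ 2 + (2 * r - 1) * m + 2 * 2 * m) := by
      rw [← zpow_add₀ h0.ne']
      congr 1
      ring
    rw [thetaQuad_period h0 (show (1 + 4 + (1 + 3) : ℤ) = 9 by norm_num),
        thetaQuad_period h0 (show (2 + 3 + (0 + 4) : ℤ) = 9 by norm_num),
        thetaQuad_period h0 (show (0 + 6 + (1 + 2) : ℤ) = 9 by norm_num), partSec_tz_period h0,
        ← h, ← hm,
      show (5 * m + r) ^ 2 + (5 * m + r) = r ^ 2 + r + (25 * m ^ 2 + 10 * m * r + 5 * m) by ring,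
      zpow_add₀ h0.ne']
    ring
  all_goals norm_num [thetaQuad, thetaPair, v0, v3, v4, v5, v6, v7, v8, v9, v10, v11,
    tz, w3, w4, w5, w6, w9, w10, w11, w14, w18, w21, w30, w34]
  all_goals try field_simp

end Interp

section WId

variable {t : ℝ}

theorem thetaMom_one_values (h0 : 0 < t) (h1 : t < 1 / 8) :
    thetaMom t 1 3 = -thetaMom t 1 2 ∧ thetaMom t 1 4 = -thetaMom t 1 1 ∧
    thetaMom t 1 5 = -thetaMom t 1 0 ∧
    thetaMom t 1 6 = -(t ^ 2)⁻¹ * (thetaMom t 1 1 - thetaMom t 0 1) ∧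
    thetaMom t 1 (-1) = -(t ^ 2)⁻¹ * (thetaMom t 0 1 - thetaMom t 1 1) := by
  have r1 := thetaMom_reflect t 1 1
  have r2 := thetaMom_reflect t 1 2
  have r0 := thetaMom_reflect t 1 0
  have s1 := thetaMom_one_shift h0 h1 1 1
  have s2 := thetaMom_one_shift h0 h1 (-1) 4
  norm_num [thetaMom_zero_zero h0] at r0 r1 r2 s1 s2
  rw [r1, (thetaMom_zero_values h0).2.1] at s2
  refine ⟨r2, r1, r0, ?_, ?_⟩
  · rw [s1]; norm_cast; ring
  · rw [s2]; norm_cast; ring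

theorem thetaMom_two_values (h0 : 0 < t) (h1 : t < 1 / 8) :
    thetaMom t 2 0 = thetaMom t 1 0 ∧
    thetaMom t 2 3 = thetaMom t 2 2 ∧ thetaMom t 2 4 = thetaMom t 2 1 ∧
    thetaMom t 2 5 = thetaMom t 1 0 ∧
    thetaMom t 2 6 = -(t ^ 2)⁻¹ * (thetaMom t 2 1 - 2 * thetaMom t 1 1 + thetaMom t 0 1) := by
  have r1 := thetaMom_reflect t 2 1
  have r2 := thetaMom_reflect t 2 2
  have r0 := thetaMom_reflect t 2 0
  have s1 := thetaMom_two_shift h0 h1 1 1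
  norm_num [thetaMom_two_zero h0 h1] at r0 r1 r2 s1
  refine ⟨thetaMom_two_zero h0 h1, r2, r1, r0, ?_⟩
  rw [s1]; norm_cast; ring

theorem val_thetaPair (h0 : 0 < t) (h1 : t < 1 / 8) (a b : ℤ) :
    Val t 2 (thetaPair t a b) (thetaMom t 0 a * thetaMom t 0 b)
      (thetaMom t 1 a * thetaMom t 0 b + thetaMom t 0 a * thetaMom t 1 b)
      (thetaMom t 2 a * thetaMom t 0 b + 2 * (thetaMom t 1 a * thetaMom t 1 b) +
        thetaMom t 0 a * thetaMom t 2 b) :=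
  Val.mul h0 h1 (val_theta h0 h1 a) (val_theta h0 h1 b)

theorem thetaPair_relation (h0 : 0 < t) {p q r : ℝ} {a b c d e f σ : ℤ}
    (hab : a + b = σ) (hcd : c + d = σ) (hef : e + f = σ)
    (h : ∀ k : ℤ, 0 ≤ k → k ≤ 4 →
      p * thetaPair t a b k + q * thetaPair t c d k + r * thetaPair t e f k = 0) (k : ℤ) :
    p * thetaPair t a b k + q * thetaPair t c d k + r * thetaPair t e f k = 0 := by
  revert k
  apply forall_of_residues
  · intro m k h
    rw [thetaPair_period h0 hab, thetaPair_period h0 hcd, thetaPair_period h0 hef]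
    linear_combination (t ^ (-10 * m ^ 2 - 10 * m + 2 * σ * m - 4 * k * m)) * h
  all_goals exact h _ (by norm_num) (by norm_num)

theorem thetaPair_moments (h0 : 0 < t) (h1 : t < 1 / 8) {p q r : ℝ} {a b c d e f σ : ℤ}
    (hab : a + b = σ) (hcd : c + d = σ) (hef : e + f = σ)
    (h : ∀ k : ℤ, 0 ≤ k → k ≤ 4 →
      p * thetaPair t a b k + q * thetaPair t c d k + r * thetaPair t e f k = 0) :
    p * (thetaMom t 1 a * thetaMom t 0 b + thetaMom t 0 a * thetaMom t 1 b) +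
      q * (thetaMom t 1 c * thetaMom t 0 d + thetaMom t 0 c * thetaMom t 1 d) +
      r * (thetaMom t 1 e * thetaMom t 0 f + thetaMom t 0 e * thetaMom t 1 f) = 0 ∧
    p * (thetaMom t 2 a * thetaMom t 0 b + 2 * (thetaMom t 1 a * thetaMom t 1 b) +
        thetaMom t 0 a * thetaMom t 2 b) +
      q * (thetaMom t 2 c * thetaMom t 0 d + 2 * (thetaMom t 1 c * thetaMom t 1 d) +
        thetaMom t 0 c * thetaMom t 2 d) +
      r * (thetaMom t 2 e * thetaMom t 0 f + 2 * (thetaMom t 1 e * thetaMom t 1 f) +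
        thetaMom t 0 e * thetaMom t 2 f) = 0 :=
  (Val.moments_eq_zero h0 h1 ((((val_thetaPair h0 h1 a b).smul p).add
    ((val_thetaPair h0 h1 c d).smul q)).add ((val_thetaPair h0 h1 e f).smul r) |>.mono h0 h1
      one_le_two) (thetaPair_relation h0 hab hcd hef h)).2

/-- The first moments of a quadratic relation between theta series. -/
theorem three_mul_thetaMom_one_two (h0 : 0 < t) (h1 : t < 1 / 8) :
    thetaMom t 0 2 ^ 2 * (3 * thetaMom t 1 2 * thetaMom t 0 1 - thetaMom t 1 1 * thetaMom t 0 2) =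
      -t ^ 2 * thetaMom t 1 0 * thetaMom t 0 1 ^ 3 := by
  obtain ⟨v3, v4, v5, v6, v7, v8, v9, v10, v11⟩ := thetaMom_zero_values h0
  have v0 := thetaMom_zero_zero h0
  obtain ⟨h, -⟩ := thetaPair_moments h0 h1 (p := thetaMom t 0 1 * thetaMom t 0 2)
    (q := -thetaMom t 0 2 ^ 2) (r := t ^ 2 * thetaMom t 0 1 ^ 2) (a := 2) (b := 2) (c := 1) (d := 3)
    (e := 0) (f := 4) rfl rfl rfl (fun k hk hk' => by
      interval_cases k <;> norm_num [thetaPair, v0, v3, v4, v5, v6, v7, v8, v9, v10, v11] <;>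
      field_simp <;> ring)
  obtain ⟨u3, u4, -⟩ := thetaMom_one_values h0 h1
  rw [u3, u4, v0, v3, v4] at h
  linear_combination h

theorem thetaMom_one_linear (h0 : 0 < t) (h1 : t < 1 / 8) :
    thetaMom t 0 1 ^ 2 * (thetaMom t 0 1 * thetaMom t 0 2 - 3 * thetaMom t 1 1 * thetaMom t 0 2 -
      thetaMom t 1 2 * thetaMom t 0 1) = -thetaMom t 1 0 * thetaMom t 0 2 ^ 3 := by
  obtain ⟨v3, v4, v5, v6, v7, v8, v9, v10, v11⟩ := thetaMom_zero_values h0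
  have v0 := thetaMom_zero_zero h0
  obtain ⟨h, -⟩ := thetaPair_moments h0 h1 (p := t ^ 2 * thetaMom t 0 1 * thetaMom t 0 2)
    (q := thetaMom t 0 1 ^ 2) (r := -thetaMom t 0 2 ^ 2) (a := 4) (b := -1) (c := 1) (d := 2)
    (e := 0) (f := 3) rfl rfl rfl (fun k hk hk' => by
      interval_cases k <;> norm_num [thetaPair, v0, v3, v4, v5, v6, v7, v8, v9, v10, v11] <;>
      field_simp <;> ring)
  obtain ⟨u3, u4, u5, u6, u7⟩ := thetaMom_one_values h0 h1
  rw [u3, u4, u7, v0, v3, v4, v7] at h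
  have ht : t ^ 2 * (t ^ 2)⁻¹ = 1 := mul_inv_cancel₀ (by positivity)
  linear_combination -h + thetaMom t 0 1 ^ 2 * thetaMom t 0 2 *
    (2 * thetaMom t 1 1 - thetaMom t 0 1) * ht

theorem thetaMom_two_relation (h0 : 0 < t) (h1 : t < 1 / 8) :
    thetaMom t 0 1 ^ 2 * (thetaMom t 2 2 * thetaMom t 0 2 - thetaMom t 1 2 ^ 2) -
      thetaMom t 0 2 ^ 2 * (thetaMom t 2 1 * thetaMom t 0 1 - thetaMom t 1 1 ^ 2) =
      t ^ 2 * thetaMom t 0 1 * thetaMom t 0 2 * thetaMom t 1 0 ^ 2 := by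
  obtain ⟨v3, v4, v5, v6, v7, v8, v9, v10, v11⟩ := thetaMom_zero_values h0
  have v0 := thetaMom_zero_zero h0
  obtain ⟨-, h⟩ := thetaPair_moments h0 h1 (p := thetaMom t 0 1 ^ 2)
    (q := -thetaMom t 0 2 ^ 2) (r := t ^ 2 * thetaMom t 0 1 * thetaMom t 0 2)
    (a := 2) (b := 3) (c := 1) (d := 4)
    (e := 0) (f := 5) rfl rfl rfl (fun k hk hk' => by
      interval_cases k <;> norm_num [thetaPair, v0, v3, v4, v5, v6, v7, v8, v9, v10, v11] <;>
      field_simp <;> ring)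
  obtain ⟨u3, u4, u5, u6, u7⟩ := thetaMom_one_values h0 h1
  obtain ⟨w0, w3, w4, w5, w6⟩ := thetaMom_two_values h0 h1
  rw [u3, u4, u5, w0, w3, w4, w5, v0, v3, v4, v5] at h
  linear_combination h / 2

end WId

section Identity

variable {t : ℝ}

theorem crank_rank_algebra {b1 b2 d0 d1 d2 s1 s2 P0 P1 P2 P3 P4 : ℝ} (hb1 : b1 ≠ 0)
    (hb2 : b2 ≠ 0) (r1 : P1 * b2 ^ 2 = P0 * (b1 * b2) + t ^ 2 * P4 * b1 ^ 2)
    (r2 : P2 * b2 ^ 2 = P1 * (b1 * b2) + P0 * b1 ^ 2)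
    (r3 : P3 * b2 ^ 2 = P2 * (b1 * b2) + P1 * b1 ^ 2)
    (r4 : P4 * b2 ^ 2 = P3 * (b1 * b2) + P2 * b1 ^ 2)
    (w1 : b2 ^ 2 * (3 * d2 * b1 - d1 * b2) = -t ^ 2 * d0 * b1 ^ 3)
    (w2 : b1 ^ 2 * (b1 * b2 - 3 * d1 * b2 - d2 * b1) = -d0 * b2 ^ 3)
    (w3 : b1 ^ 2 * (s2 * b2 - d2 ^ 2) - b2 ^ 2 * (s1 * b1 - d1 ^ 2) = t ^ 2 * b1 * b2 * d0 ^ 2) :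
    ∃ A c ρ : ℝ, A ≠ 0 ∧ b2 = A * b1 ∧ d0 = c * b1 ∧
    P3 = (t ^ 2 + 3 * A ^ 5) / (5 * A ^ 4) * P4 ∧
    P2 = (2 * A ^ 5 - t ^ 2) / (5 * A ^ 3) * P4 ∧
    P1 = (A ^ 5 + 2 * t ^ 2) / (5 * A ^ 2) * P4 ∧
    P0 = (A ^ 5 - 3 * t ^ 2) / (5 * A) * P4 ∧
    d1 = (3 + 3 * A ^ 2 * c + t ^ 2 * c / A ^ 3) / 10 * b1 ∧
    d2 = (1 + A ^ 2 * c - 3 * t ^ 2 * c / A ^ 3) / 10 * (A * b1) ∧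
    s1 = (ρ - t ^ 2 * c ^ 2 / A + ((3 + 3 * A ^ 2 * c + t ^ 2 * c / A ^ 3) / 10) ^ 2) * b1 ∧
    s2 = (ρ + ((1 + A ^ 2 * c - 3 * t ^ 2 * c / A ^ 3) / 10) ^ 2) * (A * b1) := by
  obtain ⟨A, rfl⟩ : ∃ A, b2 = A * b1 := ⟨b2 / b1, by field_simp⟩
  obtain ⟨c, rfl⟩ : ∃ c, d0 = c * b1 := ⟨d0 / b1, by field_simp⟩
  have hA : A ≠ 0 := left_ne_zero_of_mul hb2
  have e2 : P2 = A ^ 2 * P4 - A * P3 := by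
    refine mul_left_cancel₀ (pow_ne_zero 2 hb1) ?_
    linear_combination -r4
  have e1 : P1 = A ^ 2 * P3 - A * P2 := by
    refine mul_left_cancel₀ (pow_ne_zero 2 hb1) ?_
    linear_combination -r3
  have e0 : P0 = A ^ 2 * P2 - A * P1 := by
    refine mul_left_cancel₀ (pow_ne_zero 2 hb1) ?_
    linear_combination -r2
  have e3 : P3 = (t ^ 2 + 3 * A ^ 5) / (5 * A ^ 4) * P4 := by
    have : t ^ 2 * P4 = A ^ 2 * P1 - A * P0 := by
      refine mul_left_cancel₀ (pow_ne_zero 2 hb1) ?_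
      linear_combination -r1
    rw [e0, e1, e2] at this
    field_simp
    linear_combination -this
  obtain ⟨z1, rfl⟩ : ∃ z1, d1 = z1 * b1 := ⟨d1 / b1, by field_simp⟩
  obtain ⟨z2, rfl⟩ : ∃ z2, d2 = z2 * (A * b1) := ⟨d2 / (A * b1), by field_simp⟩
  have v1 : A ^ 3 * (3 * z2 - z1) = -t ^ 2 * c := by
    refine mul_left_cancel₀ (pow_ne_zero 4 hb1) ?_
    linear_combination w1
  have v2 : 1 - 3 * z1 - z2 = -c * A ^ 2 := by
    refine mul_left_cancel₀ (mul_ne_zero hA (pow_ne_zero 4 hb1)) ?_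
    linear_combination w2
  have f1 : z1 = (3 + 3 * A ^ 2 * c + t ^ 2 * c / A ^ 3) / 10 := by
    field_simp
    linear_combination -v1 - 3 * A ^ 3 * v2
  have f2 : z2 = (1 + A ^ 2 * c - 3 * t ^ 2 * c / A ^ 3) / 10 := by
    field_simp
    linear_combination 3 * v1 - A ^ 3 * v2
  obtain ⟨ρ, rfl⟩ : ∃ ρ, s2 = (ρ + z2 ^ 2) * (A * b1) :=
    ⟨s2 / (A * b1) - z2 ^ 2, by field_simp; ring⟩
  have v3 : A * s1 = (A * ρ + A * z1 ^ 2 - t ^ 2 * c ^ 2) * b1 := by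
    refine mul_left_cancel₀ (mul_ne_zero hA (pow_ne_zero 3 hb1)) ?_
    linear_combination -w3
  refine ⟨A, c, ρ, hA, rfl, rfl, e3, ?_, ?_, ?_, ?_, ?_, ?_, ?_⟩
  · rw [e2, e3]; field_simp; ring
  · rw [e1, e2, e3]; field_simp; ring
  · rw [e0, e1, e2, e3]; field_simp; ring
  · rw [f1]
  · rw [f2]
  · rw [← f1]
    field_simp
    linear_combination v3
  · rw [← f2]

theorem exists_hasSum_crank_rank (h0 : 0 < t) (h1 : t < 1 / 8) : ∃ V W : ℝ,
    HasSum (fun k : ℤ => -(-1 : ℝ) ^ k * (partSec t (tz k + 1 * k) - partSec t (tz k + 2 * k)) *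
      eta 1 (t ^ (2 * k))) V ∧
    HasSum (fun k : ℤ => -(-1 : ℝ) ^ k * (partSec t (pent k + 2 * k) - partSec t (pent k + 3 * k)) *
      eta 2 (t ^ (2 * k))) W ∧ V + 2 * W = 0 := by
  have hb1 := thetaMom_zero_ne_zero h0 h1 (a := 1) (by norm_num)
  have hb2 := thetaMom_zero_ne_zero h0 h1 (a := 2) (by norm_num)
  have vq : ∀ (a b c d : ℤ) (r : ℝ), Val t 1 (fun k => r * thetaQuad t a b c d k) _ _ _ :=
    fun a b c d r => ((val_thetaPair h0 h1 a b).mul h0 h1 (c := 1) (val_thetaPair h0 h1 c d)).smul r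
  have vp : ∀ (a b : ℤ) (r : ℝ), Val t 1 (fun k => r * thetaPair t a b k) _ _ _ :=
    fun a b r => ((val_thetaPair h0 h1 a b).mono h0 h1 one_le_two).smul r
  have hC := Val.hasSum_eta h0 h1 ((((vq 1 3 2 2
    (partSec t 0 / (thetaMom t 0 1 * thetaMom t 0 2 ^ 3))).add (vq 0 4 2 2
    (-(partSec t 1 / (thetaMom t 0 1 ^ 3 * thetaMom t 0 2))))).add (vq 0 4 1 3
    (t ^ 2 * partSec t (-2) / (thetaMom t 0 1 ^ 2 * thetaMom t 0 2 ^ 2)))).add (((vq 1 4 1 3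
    (-(partSec t 0 / (thetaMom t 0 1 ^ 3 * thetaMom t 0 2)))).add (vq 2 3 0 4
    (partSec t 2 / (thetaMom t 0 1 ^ 2 * thetaMom t 0 2 ^ 2)))).add (vq 0 6 1 2
    (t ^ 4 * partSec t (-1) / (thetaMom t 0 1 * thetaMom t 0 2 ^ 3))))) 1
  have hR := Val.hasSum_eta h0 h1 (((vp 1 3
    (partSec t 0 / (thetaMom t 0 1 * thetaMom t 0 2))).add (vp 0 4
    (-(t ^ 2 * partSec t (-2) / (thetaMom t 0 1 * thetaMom t 0 2))))).add ((vp 2 3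
    (-(partSec t (-1) / (thetaMom t 0 1 * thetaMom t 0 2)))).add (vp 1 4
    (partSec t 1 / (thetaMom t 0 1 * thetaMom t 0 2))))) 2
  refine ⟨_, _, hasSum_of_eq hC fun k => ?_, hasSum_of_eq hR fun k => ?_, ?_⟩
  · rw [← interp_crank_one h0 h1, ← interp_crank_two h0 h1]
    ring
  · rw [← interp_rank_two h0 h1, ← interp_rank_three h0 h1]
    ring
  · have r1 := partSec_rel h0 h1 (e := 1) (by norm_num) (by norm_num)
    have r2 := partSec_rel h0 h1 (e := 0) (by norm_num) (by norm_num)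
    have r3 := partSec_rel h0 h1 (e := -1) (by norm_num) (by norm_num)
    have r4 := partSec_rel h0 h1 (e := -2) (by norm_num) (by norm_num)
    norm_num at r1 r2 r3 r4
    rw [(partSec_values h0).1] at r1
    obtain ⟨A, c, ρ, hA, a1, a2, a3, a4, a5, a6, a7, a8, a9, a10⟩ := crank_rank_algebra hb1 hb2
      r1 r2 r3 r4 (three_mul_thetaMom_one_two h0 h1) (thetaMom_one_linear h0 h1)
      (thetaMom_two_relation h0 h1)
    obtain ⟨v3, v4, v5, v6, -⟩ := thetaMom_zero_values h0
    obtain ⟨u3, u4, u5, u6, -⟩ := thetaMom_one_values h0 h1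
    obtain ⟨w0, w3, w4, w5, w6⟩ := thetaMom_two_values h0 h1
    simp only [thetaMom_zero_zero h0, v3, v4, v6, u3, u4, u6, w0, w3, w4, w6, a1, a2, a3, a4, a5,
      a6, a7, a8, a9, a10]
    field_simp
    ring

end Identity

section Main

variable {t : ℝ}

theorem inv_mul_eta_inv {x : ℝ} (hx : x ≠ 0) (w : ℝ) : x⁻¹ * eta w x⁻¹ = eta (5 - w) x := by
  rcases eq_or_ne x 1 with rfl | h
  · simp [eta_zero]
  · have h2 : 1 - x ≠ 0 := sub_ne_zero.2 h.symm
    have h3 : x - 1 ≠ 0 := sub_ne_zero.2 h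
    have h4 : 1 - x⁻¹ ≠ 0 := by
      rw [show 1 - x⁻¹ = (x - 1) / x by field_simp]
      exact div_ne_zero h3 hx
    unfold eta
    rw [show 1 - x⁻¹ = (x - 1) / x by field_simp, show (1 - x) ^ 2 = (x - 1) ^ 2 by ring]
    field_simp
    ring

theorem hasSum_fold (h0 : 0 < t) {B B' : ℤ → ℝ} (hB : ∀ k, B (-k) = (t ^ (2 * k))⁻¹ * B' k)
    {w V : ℝ} (h : HasSum (fun k : ℤ => -(-1 : ℝ) ^ k * B k * eta w (t ^ (2 * k))) V) :
    HasSum (fun k : ℕ => (-1 : ℝ) ^ k * (B (k + 1) * eta w (t ^ (2 * ((k : ℤ) + 1))) +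
      B' (k + 1) * eta (5 - w) (t ^ (2 * ((k : ℤ) + 1))))) V := by
  have h2 := (hasSum_nat_add_iff' 1).2 h.nat_add_neg
  simp only [Finset.sum_range_one, Nat.cast_zero, neg_zero, mul_zero, zpow_zero, eta_zero,
    add_zero, sub_zero] at h2
  refine hasSum_of_eq h2 fun k => ?_
  have e : t ^ (2 * ((k : ℤ) + 1)) ≠ 0 := zpow_ne_zero _ h0.ne'
  rw [Nat.cast_add, Nat.cast_one, hB, neg_one_zpow_neg, ← inv_mul_eta_inv e, mul_neg,
    zpow_neg, zpow_add₀ (by norm_num) (k : ℤ) 1, zpow_natCast, zpow_one]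
  ring

theorem partSec_pent_neg (h0 : 0 < t) (c k : ℤ) :
    partSec t (pent (-k) + c * -k) = (t ^ (2 * k))⁻¹ * partSec t (pent k + (6 - c) * k) := by
  rw [← zpow_neg, ← mul_neg, ← partSec_shift h0]
  congr 1
  have := two_mul_pent k
  have := two_mul_pent (-k)
  nlinarith

theorem partSec_tz_neg (h0 : 0 < t) (c k : ℤ) :
    partSec t (tz (-k) + c * -k) = (t ^ (2 * k))⁻¹ * partSec t (tz k + (6 - c) * k) := by
  rw [← zpow_neg, ← mul_neg, ← partSec_shift h0]
  congr 1
  have := two_mul_tz k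
  have := two_mul_tz (-k)
  nlinarith

theorem hasSum_secSum (h0 : 0 < t) (h1 : t < 1 / 8) {b : ℤ → ℤ}
    (hb : ∀ k : ℕ, 0 ≤ b (k + 1)) (hneg : ∀ c k : ℤ, partSec t (b (-k) + c * -k) =
      (t ^ (2 * k))⁻¹ * partSec t (b k + (6 - c) * k)) {c : ℕ} (hc : 1 ≤ c) (hc' : c ≤ 4)
    {w w' : ℕ} (hw : w + w' = 5) {V : ℝ}
    (h : HasSum (fun k : ℤ => -(-1 : ℝ) ^ k *
      (partSec t (b k + c * k) - partSec t (b k + (c + 1) * k)) * eta w (t ^ (2 * k))) V) :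
    HasSum (fun n : ℕ => ((secSum (fun k => b (k + 1) + c * (k + 1)) w n -
      secSum (fun k => b (k + 1) + (c + 1) * (k + 1)) w n -
      (secSum (fun k => b (k + 1) + (5 - c) * (k + 1)) w' n -
      secSum (fun k => b (k + 1) + (6 - c) * (k + 1)) w' n) : ℤ) : ℝ) * t ^ (2 * (n : ℤ))) V := by
  have key : ∀ (d : ℤ) (v : ℕ), 1 ≤ d → ∃ S : ℝ,
      HasSum (fun n : ℕ => (secSum (fun k => b (k + 1) + d * (k + 1)) v n : ℝ) *
        t ^ (2 * (n : ℤ))) S ∧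
      HasSum (fun k : ℕ => (-1 : ℝ) ^ k * partSec t (b (k + 1) + d * (k + 1)) *
        eta v (t ^ (2 * ((k : ℤ) + 1)))) S := fun d v hd =>
    hasSum_sections h0 h1 _ (fun k => by nlinarith [hb k]) v
  obtain ⟨S1, p1, q1⟩ := key c w (by omega)
  obtain ⟨S2, p2, q2⟩ := key (c + 1) w (by omega)
  obtain ⟨S3, p3, q3⟩ := key (5 - c) w' (by omega)
  obtain ⟨S4, p4, q4⟩ := key (6 - c) w' (by omega)
  have hf := hasSum_fold h0 (B := fun k => partSec t (b k + c * k) - partSec t (b k + (c + 1) * k))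
    (B' := fun k => partSec t (b k + (6 - c) * k) - partSec t (b k + (5 - c) * k))
    (fun k => by
      simp only [hneg]
      rw [show (6 : ℤ) - (c + 1) = 5 - c by ring]
      ring) h
  have hV : V = S1 - S2 - (S3 - S4) := by
    refine hf.unique (hasSum_of_eq ((q1.sub q2).sub (q3.sub q4)) fun k => ?_)
    have hw' : (w' : ℝ) = 5 - w := by
      rw [eq_sub_iff_add_eq, add_comm]
      exact_mod_cast hw
    rw [hw']
    ring
  rw [hV]
  refine hasSum_of_eq ((p1.sub p2).sub (p3.sub p4)) fun n => ?_
  push_cast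
  ring

theorem pent_nonneg (k : ℕ) : 0 ≤ pent (k + 1) := le_trans (by positivity) (natAbs_le_pent _)

theorem tz_add_one (k : ℕ) : tz (k + 1) = tri k := by
  have h2 : (2 : ℤ) * tri k = k * (k + 1) := by exact_mod_cast two_mul_tri k
  have := two_mul_tz (k + 1)
  linarith

theorem secSum_rank (c w n : ℕ) : secSum (fun k => pent (k + 1) + c * (k + 1)) w n =
    ∑ s ∈ Finset.range (5 * n + 2 + 1), (5 * (s : ℤ) + w) * rankGe (5 * s + c) (5 * n + 2 : ℕ) := by
  refine Finset.sum_congr rfl fun s _ => ?_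
  have := rankGe_eq_sum (5 * n + 3) (5 * s + c) (5 * n + 2) (by omega) (by omega)
  push_cast at this ⊢
  rw [this]
  congr 1
  refine Finset.sum_congr rfl fun k _ => ?_
  congr 2
  ring

theorem secSum_crank (c w n : ℕ) : secSum (fun k => tz (k + 1) + c * (k + 1)) w n =
    ∑ s ∈ Finset.range (5 * n + 2 + 1), (5 * (s : ℤ) + w) * crankGe (5 * s + c) (5 * n + 2) := by
  refine Finset.sum_congr rfl fun s _ => ?_
  unfold crankGe
  congr 1
  refine Finset.sum_congr rfl fun k _ => ?_
  simp only [tz_add_one]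
  push_cast
  congr 2
  ring

/-- The combination of sections whose vanishing is equivalent to the congruence identity. -/
def crankRankCoeff (n : ℕ) : ℤ :=
  (secSum (fun k => tz (k + 1) + (1 : ℕ) * (k + 1)) 1 n -
    secSum (fun k => tz (k + 1) + (2 : ℕ) * (k + 1)) 1 n -
    (secSum (fun k => tz (k + 1) + (4 : ℕ) * (k + 1)) 4 n -
    secSum (fun k => tz (k + 1) + (5 : ℕ) * (k + 1)) 4 n)) +
  2 * (secSum (fun k => pent (k + 1) + (2 : ℕ) * (k + 1)) 2 n -
    secSum (fun k => pent (k + 1) + (3 : ℕ) * (k + 1)) 2 n -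
    (secSum (fun k => pent (k + 1) + (3 : ℕ) * (k + 1)) 3 n -
    secSum (fun k => pent (k + 1) + (4 : ℕ) * (k + 1)) 3 n))

theorem crankRankCoeff_eq_zero (n : ℕ) : crankRankCoeff n = 0 := by
  rw [← Int.cast_eq_zero (α := ℝ)]
  refine coeff_eq_zero_of_hasSum (fun n => (crankRankCoeff n : ℝ)) (fun t h0 h1 => ?_) n
  obtain ⟨V, W, hV, hW, hVW⟩ := exists_hasSum_crank_rank h0 h1
  have hC := hasSum_secSum h0 h1 (b := tz) (fun k => by rw [tz_add_one]; positivity)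
    (partSec_tz_neg h0) (c := 1) (w := 1) (w' := 4) (by norm_num) (by norm_num) (by norm_num)
    (V := V) (by exact_mod_cast hV)
  have hR := hasSum_secSum h0 h1 (b := pent) pent_nonneg
    (partSec_pent_neg h0) (c := 2) (w := 2) (w' := 3) (by norm_num) (by norm_num) (by norm_num)
    (V := W) (by exact_mod_cast hW)
  rw [← hVW]
  refine hasSum_of_eq (hC.add (hR.mul_left 2)) fun n => ?_
  norm_num [crankRankCoeff]
  ring

end Main

/-- For every `n ≥ 0`,
`Mω(1,5,5n+2) − Mω(4,5,5n+2) = 2 NT(3,5,5n+2) − 2 NT(2,5,5n+2)`. -/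
theorem statement_3 (n : ℕ) :
    Mw 1 5 (5 * n + 2) - Mw 4 5 (5 * n + 2)
      = 2 * NT 3 5 (5 * n + 2) - 2 * NT 2 5 (5 * n + 2) := by
  have h := crankRankCoeff_eq_zero n
  simp only [crankRankCoeff, secSum_crank, secSum_rank] at h
  rw [← mul_sub, NT_sub_NT, Mw_sub_Mw]
  simp only [mul_sub, Finset.sum_sub_distrib]
  push_cast at h ⊢
  linarith

end Beck
end

section
/- Let r, s, t be integers with 1 ≤ r ≤ 4, 1 ≤ s ≤ 4, 0 ≤ t ≤ 4 and r + s − 5 ≤ t. Then for every complex q with |q| < 1: ∑_{n≥0} q^{rn+t}/(1 − q^{5n+s}) − ∑_{n≥0} q^{(5−r)n+5+t−r−s}/(1 − q^{5n+5−s}) = q^t · (q^{r+s}, q^{5−r−s}, q^5, q^5; q^5)_∞ / (q^r, q^s, q^{5−r}, q^{5−s}; q^5)_∞, where in the case r + s = 5 the factor (q^{5−r−s}; q^5)_∞ = (1; q^5)_∞ = 0 makes the right-hand side equal to 0. -/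
/-!
Common definitions: for a partition `π` of `n`,
`numParts` is the number of parts, `largestPart` the largest part,
`omegaOnes` the number of parts equal to 1, `rank` and `crank` the
Dyson rank and Andrews–Garvan crank.  `NT m j n` is the total number of
parts over partitions of `n` with rank ≡ m (mod j), and `Mw m j n` is
the total number of ones over partitions of `n` with crank ≡ m (mod j).
`poch a q = (a; q)_∞ = ∏_{n ≥ 0} (1 - a qⁿ)`.
-/

namespace Beck

open Filter Topology

/-- The finite `q`-Pochhammer symbol `(a; q)_n = ∏_{k < n} (1 - a q ^ k)`. -/
noncomputable def finPoch (a q : ℂ) (n : ℕ) : ℂ := ∏ k ∈ Finset.range n, (1 - a * q ^ k)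

lemma prod_range_sub_mul_pow (q : ℂ) {c x : ℂ} (hc : c ≠ 0) (hx : x ≠ 0) (m n : ℕ) :
    ∏ k ∈ Finset.range (m + n), (c * q ^ m - x * q ^ k) =
      x ^ m * (∏ k ∈ Finset.range m, (-q ^ k)) * finPoch (c * q / x) q m
        * ((c * q ^ m) ^ n * finPoch (x / c) q n) := by
  rw [Finset.prod_range_add]
  congr 1
  · have h : finPoch (c * q / x) q m =
        ∏ k ∈ Finset.range m, (1 - c * q / x * q ^ (m - 1 - k)) :=
      (Finset.prod_range_reflect (fun k => 1 - c * q / x * q ^ k) m).symm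
    have hxm : x ^ m = ∏ _k ∈ Finset.range m, x := by simp
    rw [h, hxm, ← Finset.prod_mul_distrib, ← Finset.prod_mul_distrib]
    refine Finset.prod_congr rfl fun k hk => ?_
    obtain ⟨d, rfl⟩ : ∃ d, m = k + 1 + d :=
      ⟨m - (k + 1), by have := Finset.mem_range.1 hk; omega⟩
    rw [show k + 1 + d - 1 - k = d by omega]
    field_simp
    ring
  · have h : (c * q ^ m) ^ n = ∏ _k ∈ Finset.range n, (c * q ^ m) := by simp
    rw [finPoch, h, ← Finset.prod_mul_distrib]
    refine Finset.prod_congr rfl fun k _ => ?_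
    field_simp
    ring

lemma prod_erase_pow_sub_pow (q : ℂ) (i n : ℕ) :
    ∏ k ∈ (Finset.range (i + (n + 1))).erase i, (q ^ i - q ^ k) =
      (∏ k ∈ Finset.range i, (-q ^ k)) * finPoch q q i * ((q ^ i) ^ n * finPoch q q n) := by
  have h1 : ∏ k ∈ (Finset.range (i + (n + 1))).erase i, (q ^ i - q ^ k) =
      ∏ k ∈ Finset.range (i + (n + 1)), if k = i then 1 else q ^ i - q ^ k :=
    (Finset.prod_congr rfl fun k hk => by rw [if_neg (Finset.ne_of_mem_erase hk)]).trans
      (Finset.prod_erase _ (if_pos rfl))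
  rw [h1, Finset.prod_range_add, Finset.prod_range_succ']
  congr 1
  · have h := prod_range_sub_mul_pow q (one_ne_zero (α := ℂ)) one_ne_zero i 0
    simp only [add_zero, one_mul, one_pow, div_one, pow_zero, finPoch, Finset.range_zero,
      Finset.prod_empty, mul_one] at h
    rw [finPoch, ← h]
    exact Finset.prod_congr rfl fun k hk => by simp [(Finset.mem_range.1 hk).ne]
  · have h : (q ^ i) ^ n = ∏ _k ∈ Finset.range n, q ^ i := by simp
    rw [finPoch, h, ← Finset.prod_mul_distrib]
    simp only [add_zero, if_true, mul_one]
    refine Finset.prod_congr rfl fun k _ => ?_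
    rw [if_neg (by omega)]
    ring

/-- Partial fraction expansion of `∏_{k < M} (z - x q ^ k) / ∏_{k ≤ M} (z - q ^ k)`. -/
lemma partial_fraction {q x z : ℂ} (hinj : Function.Injective fun k : ℕ => q ^ k)
    (hx : x ≠ 0) (M : ℕ) (hz : ∀ k : ℕ, z ≠ q ^ k) :
    (∏ k ∈ Finset.range M, (z - x * q ^ k)) / ∏ k ∈ Finset.range (M + 1), (z - q ^ k) =
      ∑ i ∈ Finset.range (M + 1), x ^ i * (finPoch x q (M - i) / finPoch q q (M - i))
        * (finPoch (q / x) q i / finPoch q q i) / (z - q ^ i) := by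
  classical
  have hden : ∏ k ∈ Finset.range (M + 1), (z - q ^ k) ≠ 0 :=
    Finset.prod_ne_zero_iff.2 fun k _ => sub_ne_zero.2 (hz k)
  have hdeg : (Lagrange.nodal (Finset.range M) fun k => x * q ^ k).degree
      < (Finset.range (M + 1)).card := by
    rw [Lagrange.degree_nodal, Finset.card_range, Finset.card_range]
    exact_mod_cast M.lt_succ_self
  have key := congrArg (Polynomial.eval z)
    (Lagrange.eq_interpolate (s := Finset.range (M + 1)) (hinj.injOn) hdeg)
  rw [Lagrange.eval_interpolate_not_at_node _ (fun i _ => hz i)] at key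
  simp only [Lagrange.eval_nodal] at key
  rw [key, mul_div_cancel_left₀ _ hden]
  refine Finset.sum_congr rfl fun i hi => ?_
  obtain ⟨n, rfl⟩ : ∃ n, M = i + n := ⟨M - i, by have := Finset.mem_range.1 hi; omega⟩
  have hw := prod_erase_pow_sub_pow q i n
  have hne : ∏ k ∈ (Finset.range (i + (n + 1))).erase i, (q ^ i - q ^ k) ≠ 0 :=
    Finset.prod_ne_zero_iff.2 fun k hk =>
      sub_ne_zero.2 fun h => Finset.ne_of_mem_erase hk (hinj h).symm
  have hnum := prod_range_sub_mul_pow q (one_ne_zero (α := ℂ)) hx i n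
  simp only [one_mul, div_one] at hnum
  rw [Lagrange.nodalWeight, Finset.prod_inv_distrib, add_assoc, hnum, hw, Nat.add_sub_cancel_left]
  rw [hw] at hne
  simp only [mul_ne_zero_iff] at hne
  obtain ⟨⟨h1, h2⟩, h3, h4⟩ := hne
  have h5 := sub_ne_zero.2 (hz i)
  field_simp

/-- A finite form of the bilateral summation: both sides of the partial fraction expansion with
`2 * N + 1` nodes, centred at the middle node. -/
lemma finite_bilateral {q x a : ℂ} (hq : q ≠ 0) (hinj : Function.Injective fun k : ℕ => q ^ k)
    (hx : x ≠ 0) (ha : a ≠ 0) (h1 : ∀ k : ℕ, 1 - a * q ^ k ≠ 0)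
    (h2 : ∀ k : ℕ, 1 - q / a * q ^ k ≠ 0) (N : ℕ) :
    finPoch (a * x) q N * finPoch (q / (a * x)) q N
        / (finPoch a q (N + 1) * finPoch (q / a) q N) =
      ∑ j ∈ Finset.range (N + 1), (finPoch x q (N - j) / finPoch q q (N - j))
          * (finPoch (q / x) q (N + j) / finPoch q q (N + j)) * (x ^ j / (1 - a * q ^ j))
      - ∑ j ∈ Finset.range N, (finPoch (q / x) q (N - 1 - j) / finPoch q q (N - 1 - j))
          * (finPoch x q (N + 1 + j) / finPoch q q (N + 1 + j))
          * (q / (a * x) * (q / x) ^ j / (1 - q / a * q ^ j)) := by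
  have hz : ∀ k : ℕ, a⁻¹ * q ^ N ≠ q ^ k := by
    intro k hk
    rcases le_or_gt N k with h | h
    · obtain ⟨d, rfl⟩ := Nat.exists_eq_add_of_le h
      apply h1 d
      have hqN := pow_ne_zero N hq
      rw [pow_add] at hk
      field_simp at hk
      rw [← hk]; ring
    · obtain ⟨d, rfl⟩ := Nat.exists_eq_add_of_lt h
      apply h2 d
      have hqN := pow_ne_zero k hq
      have : a⁻¹ * q ^ (d + 1) = 1 := by
        apply mul_left_cancel₀ hqN
        linear_combination hk
      linear_combination -this
  have hp := partial_fraction hinj hx (2 * N) hz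
  have e1 := prod_range_sub_mul_pow q (inv_ne_zero ha) hx N N
  have e2 := prod_range_sub_mul_pow q (inv_ne_zero ha) (one_ne_zero (α := ℂ)) N (N + 1)
  rw [← two_mul] at e1
  rw [show N + (N + 1) = 2 * N + 1 by ring] at e2
  simp only [one_mul, one_pow, div_one, div_inv_eq_mul] at e1 e2
  rw [e1, e2, show 2 * N + 1 = N + (N + 1) by ring, Finset.sum_range_add,
    ← Finset.sum_range_reflect] at hp
  have hs : ∏ k ∈ Finset.range N, (-q ^ k) ≠ 0 :=
    Finset.prod_ne_zero_iff.2 fun k _ => neg_ne_zero.2 (pow_ne_zero k hq)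
  have hA : finPoch a q (N + 1) ≠ 0 := Finset.prod_ne_zero_iff.2 fun k _ => h1 k
  have hB : finPoch (q / a) q N ≠ 0 := Finset.prod_ne_zero_iff.2 fun k _ => h2 k
  have hqN := pow_ne_zero N hq
  have hxN := pow_ne_zero N hx
  rw [show a⁻¹ * q / x = q / (a * x) by field_simp, show a⁻¹ * q = q / a by field_simp,
    mul_comm x a] at hp
  have hL : finPoch (a * x) q N * finPoch (q / (a * x)) q N
        / (finPoch a q (N + 1) * finPoch (q / a) q N) =
      (x ^ N * (∏ k ∈ Finset.range N, (-q ^ k)) * finPoch (q / (a * x)) q N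
        * ((a⁻¹ * q ^ N) ^ N * finPoch (a * x) q N) /
      ((∏ k ∈ Finset.range N, (-q ^ k)) * finPoch (q / a) q N
        * ((a⁻¹ * q ^ N) ^ (N + 1) * finPoch a q (N + 1)))) * (a⁻¹ * q ^ N / x ^ N) := by
    rw [pow_succ (a⁻¹ * q ^ N)]
    have : a⁻¹ * q ^ N ≠ 0 := mul_ne_zero (inv_ne_zero ha) hqN
    generalize a⁻¹ * q ^ N = w at *
    field_simp
  rw [hL, hp, add_mul, add_comm, sub_eq_add_neg, ← Finset.sum_neg_distrib, Finset.sum_mul,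
    Finset.sum_mul]
  congr 1
  · refine Finset.sum_congr rfl fun j hj => ?_
    have hj' := Finset.mem_range.1 hj
    rw [show 2 * N - (N + j) = N - j by omega, pow_add x]
    have h3 := h1 j
    have h4 : a⁻¹ * q ^ N - q ^ (N + j) = a⁻¹ * q ^ N * (1 - a * q ^ j) := by
      field_simp; ring
    rw [h4]
    field_simp
  · refine Finset.sum_congr rfl fun j hj => ?_
    have hj' := Finset.mem_range.1 hj
    obtain ⟨d, rfl⟩ : ∃ d, N = d + 1 + j := ⟨N - 1 - j, by omega⟩
    rw [show d + 1 + j - 1 - j = d by omega, show 2 * (d + 1 + j) - d = d + 1 + j + 1 + j by omega]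
    have h3 := h2 j
    have h4 : a⁻¹ * q ^ (d + 1 + j) - q ^ d = - q ^ d * (1 - q / a * q ^ j) := by
      field_simp; ring
    rw [h4, div_pow]
    generalize 1 - q / a * q ^ j = w at *
    field_simp
    ring

lemma summable_norm_mul_pow {q : ℂ} (hq : ‖q‖ < 1) (a : ℂ) :
    Summable fun n : ℕ => ‖-(a * q ^ n)‖ := by
  simpa using (summable_geometric_of_lt_one (norm_nonneg q) hq).mul_left ‖a‖

lemma tendsto_finPoch {q : ℂ} (hq : ‖q‖ < 1) (a : ℂ) :
    Tendsto (finPoch a q) atTop (𝓝 (poch a q)) := by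
  have h := multipliable_one_add_of_summable (summable_norm_mul_pow hq a)
  simp only [← sub_eq_add_neg] at h
  exact h.hasProd.tendsto_prod_nat

lemma one_sub_mul_pow_ne_zero {q a : ℂ} (hq : ‖q‖ < 1) (ha : ‖a‖ < 1) (n : ℕ) :
    1 - a * q ^ n ≠ 0 := by
  intro h
  have h1 : ‖a * q ^ n‖ = 1 := by rw [← sub_eq_zero.1 h, norm_one]
  rw [norm_mul, norm_pow] at h1
  have := mul_le_of_le_one_right (norm_nonneg a) (pow_le_one₀ (norm_nonneg q) hq.le (n := n))
  linarith

lemma poch_ne_zero {q a : ℂ} (hq : ‖q‖ < 1) (ha : ‖a‖ < 1) : poch a q ≠ 0 := by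
  have h := tprod_one_add_ne_zero_of_summable (f := fun n : ℕ => -(a * q ^ n))
    (fun n => by simpa [← sub_eq_add_neg] using one_sub_mul_pow_ne_zero hq ha n)
    (summable_norm_mul_pow hq a)
  simp only [← sub_eq_add_neg] at h
  exact h

lemma summable_norm_pow_div {q x a : ℂ} (hq : ‖q‖ < 1) (hx : ‖x‖ < 1) :
    Summable fun n : ℕ => ‖x ^ n / (1 - a * q ^ n)‖ := by
  have ht : Tendsto (fun n : ℕ => (1 - a * q ^ n)⁻¹) atTop (𝓝 1) := by
    simpa using ((tendsto_pow_atTop_nhds_zero_of_norm_lt_one hq).const_mul a).const_sub 1 |>.inv₀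
      (by simp)
  obtain ⟨C, hC⟩ := isBounded_iff_forall_norm_le.1 (Metric.isBounded_range_of_tendsto _ ht)
  refine Summable.of_nonneg_of_le (fun _ => norm_nonneg _) (fun n => ?_)
    ((summable_geometric_of_lt_one (norm_nonneg x) hx).mul_right C)
  rw [div_eq_mul_inv, norm_mul, norm_pow]
  gcongr
  exact hC _ ⟨n, rfl⟩

/-- A windowed sum with convergent weights tends to the weighted full sum. -/
lemma tendsto_sum_window {g h u : ℕ → ℂ} {G H : ℂ} (hg : Tendsto g atTop (𝓝 G))
    (hh : Tendsto h atTop (𝓝 H)) (hu : Summable fun n => ‖u n‖) :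
    Tendsto (fun N => ∑ j ∈ Finset.range (N + 1), g (N - j) * h (N + j) * u j) atTop
      (𝓝 (G * H * ∑' n, u n)) := by
  obtain ⟨A, hA⟩ := isBounded_iff_forall_norm_le.1 (Metric.isBounded_range_of_tendsto _ hg)
  obtain ⟨B, hB⟩ := isBounded_iff_forall_norm_le.1 (Metric.isBounded_range_of_tendsto _ hh)
  have hA0 : 0 ≤ A := (norm_nonneg _).trans (hA _ ⟨0, rfl⟩)
  have hB0 : 0 ≤ B := (norm_nonneg _).trans (hB _ ⟨0, rfl⟩)
  have key := tendsto_tsum_of_dominated_convergence (𝓕 := atTop)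
    (f := fun N j => if j ∈ Finset.range (N + 1) then g (N - j) * h (N + j) * u j else 0)
    (g := fun j => G * H * u j) (bound := fun j => A * B * ‖u j‖) (hu.mul_left _) ?_ ?_
  · rw [tsum_mul_left] at key
    refine key.congr fun N => ?_
    rw [tsum_eq_sum (s := Finset.range (N + 1)) fun j hj => if_neg hj]
    exact Finset.sum_congr rfl fun j hj => if_pos hj
  · intro j
    have h1 : Tendsto (fun N => g (N - j) * h (N + j) * u j) atTop (𝓝 (G * H * u j)) :=
      ((hg.comp (tendsto_sub_atTop_nat j)).mul
        (hh.comp (tendsto_add_atTop_nat j))).mul_const _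
    refine h1.congr' ?_
    filter_upwards [eventually_ge_atTop j] with N hN
    rw [if_pos (Finset.mem_range.2 (by omega))]
  · refine Eventually.of_forall fun N j => ?_
    split_ifs
    · rw [norm_mul, norm_mul]
      gcongr
      · exact hA _ ⟨_, rfl⟩
      · exact hB _ ⟨_, rfl⟩
    · rw [norm_zero]; positivity

/-- The case `b = a q` of Ramanujan's `₁ψ₁` summation, with the bilateral sum split at zero. -/
theorem bilateral_sum {q x a : ℂ} (hq0 : q ≠ 0) (hx1 : ‖x‖ < 1) (hqx : ‖q‖ < ‖x‖)
    (ha1 : ‖a‖ < 1) (hqa : ‖q‖ < ‖a‖) :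
    (∑' n : ℕ, x ^ n / (1 - a * q ^ n))
      - ∑' n : ℕ, q / (a * x) * ((q / x) ^ n / (1 - q / a * q ^ n)) =
    poch (a * x) q * poch (q / (a * x)) q * poch q q * poch q q
      / (poch x q * poch a q * poch (q / x) q * poch (q / a) q) := by
  have hq : ‖q‖ < 1 := hqx.trans hx1
  have hqp : 0 < ‖q‖ := norm_pos_iff.2 hq0
  have hx0 : x ≠ 0 := norm_pos_iff.1 (hqp.trans hqx)
  have ha0 : a ≠ 0 := norm_pos_iff.1 (hqp.trans hqa)
  have hx' : ‖q / x‖ < 1 := by rw [norm_div]; exact (div_lt_one (hqp.trans hqx)).2 hqx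
  have ha' : ‖q / a‖ < 1 := by rw [norm_div]; exact (div_lt_one (hqp.trans hqa)).2 hqa
  have hinj : Function.Injective fun k : ℕ => q ^ k := by
    intro k l hkl
    have h : ‖q‖ ^ k = ‖q‖ ^ l := by simpa using congrArg norm hkl
    exact (pow_right_strictAnti₀ hqp hq).injective h
  have nQ := poch_ne_zero hq hq
  have nx := poch_ne_zero hq hx1
  have na := poch_ne_zero hq ha1
  have nx' := poch_ne_zero hq hx'
  have na' := poch_ne_zero hq ha'
  have hg := (tendsto_finPoch hq x).div (tendsto_finPoch hq q) nQ
  have hh := (tendsto_finPoch hq (q / x)).div (tendsto_finPoch hq q) nQ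
  have hS1 := tendsto_sum_window hg hh (summable_norm_pow_div (a := a) hq hx1)
  have hu2 : Summable fun n : ℕ => ‖q / (a * x) * ((q / x) ^ n / (1 - q / a * q ^ n))‖ := by
    simpa only [norm_mul] using
      (summable_norm_pow_div (a := q / a) hq hx').mul_left ‖q / (a * x)‖
  have hS2 := tendsto_sum_window hh (hg.comp (tendsto_add_atTop_nat 2)) hu2
  have hL := ((tendsto_finPoch hq (a * x)).mul (tendsto_finPoch hq (q / (a * x)))).div
    (((tendsto_finPoch hq a).comp (tendsto_add_atTop_nat 1)).mul (tendsto_finPoch hq (q / a)))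
    (mul_ne_zero na na')
  have hlim := tendsto_nhds_unique (hL.comp (tendsto_add_atTop_nat 1))
    (((hS1.comp (tendsto_add_atTop_nat 1)).sub hS2).congr fun N => by
      have := finite_bilateral hq0 hinj hx0 ha0 (one_sub_mul_pow_ne_zero hq ha1)
        (one_sub_mul_pow_ne_zero hq ha') (N + 1)
      simp only [Function.comp_apply, Pi.div_apply] at this ⊢
      rw [this]
      congr 1
      refine Finset.sum_congr rfl fun j _ => ?_
      rw [show N + 1 - 1 - j = N - j by omega, show N + j + 2 = N + 1 + 1 + j by omega,
        mul_div_assoc (q / (a * x))])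
  generalize (∑' n : ℕ, x ^ n / (1 - a * q ^ n)) = S1 at *
  generalize (∑' n : ℕ, q / (a * x) * ((q / x) ^ n / (1 - q / a * q ^ n))) = S2 at *
  generalize poch (q / (a * x)) q = p1 at *
  generalize poch (q / x) q = p2 at *
  generalize poch (q / a) q = p3 at *
  field_simp at hlim ⊢
  linear_combination -hlim

/-- The master identity (2.13): for integers `1 ≤ r, s ≤ 4`, `0 ≤ t ≤ 4` with
`r + s − 5 ≤ t` and complex `q` with `|q| < 1` (and `q ≠ 0`, since the power
`q^(5−r−s)` may have a negative exponent),
`∑_{n≥0} q^{rn+t}/(1 − q^{5n+s}) − ∑_{n≥0} q^{(5−r)n+5+t−r−s}/(1 − q^{5n+5−s})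
 = q^t (q^{r+s}, q^{5−r−s}, q⁵, q⁵; q⁵)_∞ / (q^r, q^s, q^{5−r}, q^{5−s}; q⁵)_∞`.
When `r + s = 5` the factor `(q^{5−r−s}; q⁵)_∞ = (1; q⁵)_∞ = 0` makes the
right-hand side zero. -/
theorem statement_5 (r s t : ℕ) (hr1 : 1 ≤ r) (hr4 : r ≤ 4) (hs1 : 1 ≤ s)
    (hs4 : s ≤ 4) (ht4 : t ≤ 4) (hrst : r + s ≤ t + 5)
    (q : ℂ) (hq : ‖q‖ < 1) (hq0 : q ≠ 0) :
    (∑' n : ℕ, q ^ (r * n + t) / (1 - q ^ (5 * n + s)))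
      - ∑' n : ℕ, q ^ ((5 - r) * n + (5 + t - r - s)) / (1 - q ^ (5 * n + 5 - s))
    = q ^ t * (poch (q ^ (r + s)) (q ^ 5) * poch (q ^ ((5 : ℤ) - r - s)) (q ^ 5)
          * poch (q ^ 5) (q ^ 5) * poch (q ^ 5) (q ^ 5))
        / (poch (q ^ r) (q ^ 5) * poch (q ^ s) (q ^ 5)
          * poch (q ^ (5 - r)) (q ^ 5) * poch (q ^ (5 - s)) (q ^ 5)) := by
  have hn : 0 < ‖q‖ := norm_pos_iff.2 hq0
  have hlt : ∀ k l : ℕ, k < l → ‖q ^ l‖ < ‖q ^ k‖ := fun k l hkl => by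
    simpa using pow_lt_pow_right_of_lt_one₀ hn hq hkl
  have hpow : ∀ k : ℕ, k ≤ 5 → q ^ 5 / q ^ k = q ^ (5 - k) := fun k hk =>
    (pow_sub₀ q hq0 hk).symm
  have h := bilateral_sum (q := q ^ 5) (x := q ^ r) (a := q ^ s) (pow_ne_zero 5 hq0)
    (by simpa using hlt 0 r hr1) (hlt r 5 (by omega)) (by simpa using hlt 0 s hs1)
    (hlt s 5 (by omega))
  have hz : q ^ ((5 : ℤ) - r - s) = q ^ 5 / (q ^ s * q ^ r) := by
    rw [zpow_sub₀ hq0, zpow_sub₀ hq0, div_div, mul_comm (q ^ s)]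
    norm_cast
  have hc : q ^ (5 + t - r - s) = q ^ t * (q ^ 5 / (q ^ s * q ^ r)) := by
    have hm : q ^ (5 + t - r - s) * (q ^ s * q ^ r) = q ^ t * q ^ 5 := by
      rw [← pow_add, ← pow_add, ← pow_add]
      congr 1
      omega
    rw [mul_div_assoc', eq_div_iff (mul_ne_zero (pow_ne_zero s hq0) (pow_ne_zero r hq0)), hm]
  have hS1 : ∑' n : ℕ, q ^ (r * n + t) / (1 - q ^ (5 * n + s)) =
      q ^ t * ∑' n : ℕ, (q ^ r) ^ n / (1 - q ^ s * (q ^ 5) ^ n) := by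
    rw [← tsum_mul_left]
    refine tsum_congr fun n => ?_
    rw [pow_add, pow_add, pow_mul, pow_mul, mul_comm (q ^ s)]
    ring
  have hS2 : ∑' n : ℕ, q ^ ((5 - r) * n + (5 + t - r - s)) / (1 - q ^ (5 * n + 5 - s)) =
      q ^ t * ∑' n : ℕ, q ^ 5 / (q ^ s * q ^ r) *
        ((q ^ 5 / q ^ r) ^ n / (1 - q ^ 5 / q ^ s * (q ^ 5) ^ n)) := by
    rw [← tsum_mul_left]
    refine tsum_congr fun n => ?_
    rw [pow_add, hc, hpow r (by omega), hpow s (by omega), Nat.add_sub_assoc (by omega),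
      pow_add, pow_mul, pow_mul, mul_comm (q ^ (5 - s))]
    ring
  rw [hS1, hS2, ← mul_sub, h, ← hz, hpow r (by omega), hpow s (by omega), ← pow_add,
    add_comm s r, mul_div_assoc']

end Beck
end
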